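/- Suppose p_c > 0 and let s > 0. For any essential enhancement (of some finite range R₀) of site percolation on the square lattice ℤ², there exists π(s) < p_c such that θ(p,s) > 0 for all p with π(s) < p < p_c. -/

import Mathlib

open MeasureTheory Filter Set Topology
open scoped ENNReal

namespace PercEnh

/-- Sites of the lattice (vertex set `ℤ²`). -/
abbrev Site : Type := ℤ × ℤ

/-- A configuration: the set of open sites. -/
abbrev Config : Type := Set Site

/-- Square-lattice (`ℤ²`-) adjacency: `‖x − y‖₁ = 1`. -/
def adjZ2 (x y : Site) : Prop := |x.1 - y.1| + |x.2 - y.2| = 1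

/-- Matching (star) adjacency: `x ≠ y` and `‖x − y‖_∞ = 1`. -/
def adjStar (x y : Site) : Prop := x ≠ y ∧ max |x.1 - y.1| |x.2 - y.2| = 1

/-- Euclidean norm of a site. -/
noncomputable def siteNorm (x : Site) : ℝ := Real.sqrt ((x.1 : ℝ) ^ 2 + (x.2 : ℝ) ^ 2)

/-- Sites in the closed Euclidean ball of radius `r` centred at the origin. -/
def siteBall (r : ℝ) : Set Site := {x | siteNorm x ≤ r}

/-- The shifted configuration `τ_x ω = {y − x : y ∈ ω}`. -/
def shiftConfig (x : Site) (ω : Config) : Config := {y | y + x ∈ ω}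

/-- An enhancement function of (finite) range `R₀`: takes values in subsets of
`𝔹₀ = ℤ² ∩ B(R₀)` and depends only on the restriction of the configuration to `𝔹₀`. -/
def IsEnhancement (R₀ : ℝ) (φ : Config → Config) : Prop :=
  0 ≤ R₀ ∧ (∀ ω, φ ω ⊆ siteBall R₀) ∧
    ∀ ω ω' : Config, ω ∩ siteBall R₀ = ω' ∩ siteBall R₀ → φ ω = φ ω'

/-- A monotonic enhancement function. -/
def Monotonic (φ : Config → Config) : Prop := ∀ ω ω' : Config, ω ⊆ ω' → φ ω ⊆ φ ω'

/-- The translate `φ_x(ω) = x + φ₀(τ_x ω)`. -/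
def enhAt (φ : Config → Config) (x : Site) (ω : Config) : Config :=
  (fun z => z + x) '' φ (shiftConfig x ω)

/-- The enhanced configuration `ω̂(ω, α) = ω ∪ ⋃_{x : α(x)=1} φ_x(ω)`. -/
def enhanced (φ : Config → Config) (ω : Config) (α : Site → Bool) : Config :=
  ω ∪ {y | ∃ x, α x = true ∧ y ∈ enhAt φ x ω}

/-- The fully (deterministically, with `s = 1`) enhanced configuration `ω̃`. -/
def fullyEnhanced (φ : Config → Config) (ω : Config) : Config :=
  ω ∪ {y | ∃ x, y ∈ enhAt φ x ω}

/-- `ω` contains a doubly-infinite self-repelling path (w.r.t. adjacency `adj`):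
a two-sided sequence of distinct sites of `ω` in which exactly the consecutive
pairs are adjacent. -/
def HasDISRPath (adj : Site → Site → Prop) (ω : Config) : Prop :=
  ∃ γ : ℤ → Site, Function.Injective γ ∧ (∀ i, γ i ∈ ω) ∧
    ∀ i j : ℤ, adj (γ i) (γ j) ↔ (j = i + 1 ∨ i = j + 1)

/-- The enhancement is essential: some configuration without a doubly-infinite
self-repelling path acquires one upon enhancement at the origin. -/
def Essential (adj : Site → Site → Prop) (φ : Config → Config) : Prop :=
  ∃ ω : Config, ¬ HasDISRPath adj ω ∧ HasDISRPath adj (ω ∪ φ ω)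

/-- A (finite, nonempty) path w.r.t. adjacency `adj`: distinct sites,
consecutive ones adjacent. -/
def IsPathOn (adj : Site → Site → Prop) (l : List Site) : Prop :=
  l ≠ [] ∧ l.Nodup ∧ l.Chain' adj

/-- `x` and `y` are joined by a path of sites of `ω`. -/
def ConnectedIn (adj : Site → Site → Prop) (ω : Config) (x y : Site) : Prop :=
  ∃ l : List Site, IsPathOn adj l ∧ (∀ z ∈ l, z ∈ ω) ∧
    l.head? = some x ∧ l.getLast? = some y

/-- `x` belongs to an infinite open cluster of `ω`. -/
def InInfiniteCluster (adj : Site → Site → Prop) (ω : Config) (x : Site) : Prop :=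
  {y | ConnectedIn adj ω x y}.Infinite

/-- `ω` contains an infinite open cluster. -/
def HasInfiniteCluster (adj : Site → Site → Prop) (ω : Config) : Prop :=
  ∃ x, InInfiniteCluster adj ω x

/-- The configuration corresponding to `η : Site → Bool`. -/
def toConfig (η : Site → Bool) : Config := {x | η x = true}

/-- A cylinder event. -/
def cylinder (F : Finset Site) (b : Site → Bool) : Set (Site → Bool) :=
  {η | ∀ x ∈ F, η x = b x}

/-- `μ` is the Bernoulli product measure with density `p` of open sites. -/
def IsBernoulli (p : ℝ) (μ : Measure (Site → Bool)) : Prop :=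
  IsProbabilityMeasure μ ∧
    ∀ (F : Finset Site) (b : Site → Bool),
      μ (cylinder F b) = ∏ x ∈ F, ENNReal.ofReal (if b x then p else 1 - p)

/-- The percolation probability `θ`: the probability that the origin lies in an
infinite open cluster. -/
noncomputable def theta (adj : Site → Site → Prop) (μ : Measure (Site → Bool)) : ℝ :=
  (μ {η | InInfiniteCluster adj (toConfig η) 0}).toReal

/-- The percolation probability of the enhanced process (`μ` the law of the
configuration, `ν` the law of the activation variables). -/
noncomputable def thetaEnh (adj : Site → Site → Prop) (φ : Config → Config)
    (μ ν : Measure (Site → Bool)) : ℝ :=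
  ((μ.prod ν) {ηα | InInfiniteCluster adj (enhanced φ (toConfig ηα.1) ηα.2) 0}).toReal

/-- The critical point `p_c = sup {p ∈ [0,1] : θ(p) = 0}` for the family `P`. -/
noncomputable def pcOf (adj : Site → Site → Prop) (P : ℝ → Measure (Site → Bool)) : ℝ :=
  sSup {p | p ∈ Icc (0:ℝ) 1 ∧ theta adj (P p) = 0}

/-- The connectivity function `τ_p(x)`. -/
noncomputable def tau (adj : Site → Site → Prop) (μ : Measure (Site → Bool)) (x : Site) : ℝ :=
  (μ {η | ConnectedIn adj (toConfig η) 0 x}).toReal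

/-- The connectivity function `τ_{p,s}(x)` of the enhanced process. -/
noncomputable def tauEnh (adj : Site → Site → Prop) (φ : Config → Config)
    (μ ν : Measure (Site → Bool)) (x : Site) : ℝ :=
  ((μ.prod ν) {ηα | ConnectedIn adj (enhanced φ (toConfig ηα.1) ηα.2) 0 x}).toReal

/-- The mean cluster size `χ(p) = E_p‖C‖ = ∑_x τ_p(x)`. -/
noncomputable def chi (adj : Site → Site → Prop) (μ : Measure (Site → Bool)) : ℝ≥0∞ :=
  ∑' x : Site, μ {η | ConnectedIn adj (toConfig η) 0 x}

/-- The mean cluster size of the enhanced process. -/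
noncomputable def chiEnh (adj : Site → Site → Prop) (φ : Config → Config)
    (μ ν : Measure (Site → Bool)) : ℝ≥0∞ :=
  ∑' x : Site, (μ.prod ν) {ηα | ConnectedIn adj (enhanced φ (toConfig ηα.1) ηα.2) 0 x}


theorem adjZ2_symm {x y : Site} (h : adjZ2 x y) : adjZ2 y x := by
  unfold adjZ2 at *; rw [abs_sub_comm y.1, abs_sub_comm y.2]; exact h

theorem adjZ2_comm {x y : Site} : adjZ2 x y ↔ adjZ2 y x := ⟨adjZ2_symm, adjZ2_symm⟩

theorem adjZ2_ne {x y : Site} (h : adjZ2 x y) : x ≠ y := by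
  rintro rfl; simp [adjZ2] at h

/-- Both `x` and `y` lie in `ω` and they are joined by a nearest-neighbour walk in `ω`. -/
def Reach (ω : Config) (x y : Site) : Prop :=
  x ∈ ω ∧ Relation.ReflTransGen (fun a b => adjZ2 a b ∧ b ∈ ω) x y

namespace Reach

variable {ω ω' : Config} {x y z : Site}

theorem refl (h : x ∈ ω) : Reach ω x x := ⟨h, .refl⟩

theorem left_mem (h : Reach ω x y) : x ∈ ω := h.1

theorem right_mem (h : Reach ω x y) : y ∈ ω := by
  obtain ⟨hx, h⟩ := h
  rcases Relation.ReflTransGen.cases_tail h with rfl | ⟨_, _, h⟩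
  · exact hx
  · exact h.2

theorem trans (h : Reach ω x y) (h' : Reach ω y z) : Reach ω x z := ⟨h.1, h.2.trans h'.2⟩

theorem tail (h : Reach ω x y) (ha : adjZ2 y z) (hz : z ∈ ω) : Reach ω x z :=
  ⟨h.1, h.2.tail ⟨ha, hz⟩⟩

theorem of_adj (hx : x ∈ ω) (hy : y ∈ ω) (ha : adjZ2 x y) : Reach ω x y :=
  (refl hx).tail ha hy

theorem head (hx : x ∈ ω) (ha : adjZ2 x y) (h : Reach ω y z) : Reach ω x z :=
  (of_adj hx h.1 ha).trans h

theorem symm (h : Reach ω x y) : Reach ω y x := by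
  obtain ⟨hx, h⟩ := h
  induction h with
  | refl => exact refl hx
  | tail h1 h2 ih =>
    exact head h2.2 (adjZ2_symm h2.1) ih

theorem mono (hω : ω ⊆ ω') (h : Reach ω x y) : Reach ω' x y :=
  ⟨hω h.1, Relation.ReflTransGen.mono (fun _ _ h => ⟨h.1, hω h.2⟩) _ _ h.2⟩

/-- A set closed under adjacency within `ω` is preserved along walks. -/
theorem mem_of_closed {T : Set Site} (hT : ∀ a ∈ T, ∀ b ∈ ω, adjZ2 a b → b ∈ T)
    (h : Reach ω x y) (hx : x ∈ T) : y ∈ T := by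
  obtain ⟨_, h⟩ := h
  induction h with
  | refl => exact hx
  | tail h1 h2 ih => exact hT _ ih _ h2.2 h2.1

theorem exists_list (h : Reach ω x y) : ∃ l : List Site, IsPathOn adjZ2 (x :: l) ∧
    (∀ z ∈ x :: l, z ∈ ω) ∧ (x :: l).getLast? = some y := by
  obtain ⟨hx, h⟩ := h
  revert hx
  induction h using Relation.ReflTransGen.head_induction_on with
  | refl =>
    intro hx
    exact ⟨[], ⟨by simp, by simp, List.isChain_singleton _⟩, by simpa using hx, by simp⟩
  | @head a b hab hb ih =>
    intro ha
    obtain ⟨l, ⟨_, hl1, hl2⟩, hl3, hl4⟩ := ih hab.2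
    by_cases hm : a ∈ b :: l
    · obtain ⟨l1, l2, hl⟩ := List.append_of_mem hm
      refine ⟨l2, ⟨by simp, ?_, ?_⟩, ?_, ?_⟩
      · rw [hl] at hl1; exact (List.nodup_append.1 hl1).2.1
      · rw [hl] at hl2; exact (List.isChain_append.1 hl2).2.1
      · intro z hz; exact hl3 z (by rw [hl]; exact List.mem_append_right _ hz)
      · rw [hl] at hl4; rw [← hl4]; simp [List.getLast?_append, List.getLast?_cons]
    · refine ⟨b :: l, ⟨by simp, List.nodup_cons.2 ⟨hm, hl1⟩, List.isChain_cons_cons.2 ⟨hab.1, hl2⟩⟩, ?_, ?_⟩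
      · intro z hz
        rcases List.mem_cons.1 hz with rfl | hz
        · exact ha
        · exact hl3 z hz
      · rw [← hl4]; simp

theorem of_isChain : ∀ (l : List Site) (x : Site), (x :: l).IsChain adjZ2 → (∀ z ∈ x :: l, z ∈ ω) →
    (x :: l).getLast? = some y → Reach ω x y
  | [], x, _, hm, hl => by
    simp at hl; subst hl; exact refl (hm _ (by simp))
  | b :: l, x, hc, hm, hl => by
    rw [List.isChain_cons_cons] at hc
    exact head (hm _ (by simp)) hc.1 (of_isChain l b hc.2 (fun z hz => hm z (by simp at hz ⊢; tauto))
      (by simpa using hl))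

end Reach

theorem connectedIn_iff {ω : Config} {x y : Site} : ConnectedIn adjZ2 ω x y ↔ Reach ω x y := by
  constructor
  · rintro ⟨l, ⟨h0, h1, h2⟩, h3, h4, h5⟩
    cases l with
    | nil => simp at h0
    | cons a l =>
      simp at h4; subst h4
      exact Reach.of_isChain l a h2 h3 h5
  · intro h
    obtain ⟨l, h1, h2, h3⟩ := h.exists_list
    exact ⟨_, h1, h2, by simp, h3⟩

theorem mem_enhAt {φ : Config → Config} {c y : Site} {ω : Config} :
    y ∈ enhAt φ c ω ↔ y - c ∈ φ (shiftConfig c ω) := by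
  unfold enhAt
  constructor
  · rintro ⟨z, hz, rfl⟩; simpa using hz
  · intro h; exact ⟨_, h, by simp⟩

theorem sub_mem_ball_of_mem_enhAt {R₀ : ℝ} {φ : Config → Config} (hφ : IsEnhancement R₀ φ)
    {c y : Site} {ω : Config} (h : y ∈ enhAt φ c ω) : y - c ∈ siteBall R₀ :=
  hφ.2.1 _ (mem_enhAt.1 h)

theorem enhAt_congr {R₀ : ℝ} {φ : Config → Config} (hφ : IsEnhancement R₀ φ) {c : Site}
    {ω ω' : Config} (h : ∀ y, y - c ∈ siteBall R₀ → (y ∈ ω ↔ y ∈ ω')) :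
    enhAt φ c ω = enhAt φ c ω' := by
  unfold enhAt
  rw [hφ.2.2 (shiftConfig c ω) (shiftConfig c ω')]
  ext z
  simp only [mem_inter_iff, shiftConfig, mem_ofPred_eq, and_congr_left_iff]
  intro hz
  exact h _ (by simpa using hz)

theorem siteBall_bound {R₀ : ℝ} {p : Site} (h : p ∈ siteBall R₀) :
    |p.1| ≤ ⌈R₀⌉ ∧ |p.2| ≤ ⌈R₀⌉ := by
  have h' : Real.sqrt ((p.1 : ℝ) ^ 2 + (p.2 : ℝ) ^ 2) ≤ R₀ := h
  have h1 : |(p.1 : ℝ)| ≤ R₀ := le_trans (Real.abs_le_sqrt (by nlinarith [sq_nonneg (p.2:ℝ)])) h'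
  have h2 : |(p.2 : ℝ)| ≤ R₀ := le_trans (Real.abs_le_sqrt (by nlinarith [sq_nonneg (p.1:ℝ)])) h'
  have h3 := Int.le_ceil R₀
  constructor
  · have : ((|p.1| : ℤ) : ℝ) ≤ ⌈R₀⌉ := by push_cast; linarith
    exact_mod_cast this
  · have : ((|p.2| : ℤ) : ℝ) ≤ ⌈R₀⌉ := by push_cast; linarith
    exact_mod_cast this

/-- Rotated lattice coordinates `(A, B)` in which sites are the integer points with odd
coordinate sum, and adjacency means that both coordinates change by one. -/
structure OddFrame (A B : Site → ℤ) : Prop where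
  adj : ∀ p q, adjZ2 p q ↔ |A p - A q| = 1 ∧ |B p - B q| = 1
  odd : ∀ p, (A p + B p) % 2 = 1
  surj : ∀ a b : ℤ, (a + b) % 2 = 1 → ∃ p, A p = a ∧ B p = b
  inj : ∀ p q, A p = A q → B p = B q → p = q

/-- The first rotated coordinate. -/
def rotA (p : Site) : ℤ := p.1 + p.2 - 1
/-- The second rotated coordinate. -/
def rotB (p : Site) : ℤ := p.1 - p.2

namespace OddFrame

variable {A B : Site → ℤ}

theorem swap (h : OddFrame A B) : OddFrame B A where
  adj p q := by rw [h.adj, and_comm]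
  odd p := by have := h.odd p; omega
  surj a b hab := by
    obtain ⟨p, h1, h2⟩ := h.surj b a (by omega)
    exact ⟨p, h2, h1⟩
  inj p q h1 h2 := h.inj p q h2 h1

theorem negB (h : OddFrame A B) : OddFrame A (fun p => -B p) where
  adj p q := by
    rw [h.adj]
    have : -B p - -B q = -(B p - B q) := by ring
    simp only [this, abs_neg]
  odd p := by have := h.odd p; omega
  surj a b hab := by
    obtain ⟨p, h1, h2⟩ := h.surj a (-b) (by omega)
    exact ⟨p, h1, by simp [h2]⟩
  inj p q h1 h2 := h.inj p q h1 (neg_injective h2)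

theorem negA (h : OddFrame A B) : OddFrame (fun p => -A p) B := h.swap.negB.swap

theorem translate (h : OddFrame A B) (c : Site) (a b : ℤ) (hab : (a + b) % 2 = 0)
    (hA : ∀ p q, A (p - c) - A (q - c) = A p - A q) (hB : ∀ p q, B (p - c) - B (q - c) = B p - B q) :
    OddFrame (fun p => A (p - c) + a) (fun p => B (p - c) + b) where
  adj p q := by
    rw [h.adj]
    simp only [add_sub_add_right_eq_sub, hA, hB]
  odd p := by have := h.odd (p - c); omega
  surj a' b' hab' := by
    obtain ⟨p, h1, h2⟩ := h.surj (a' - a) (b' - b) (by omega)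
    exact ⟨p + c, by simp [h1], by simp [h2]⟩
  inj p q h1 h2 := by
    have := h.inj (p - c) (q - c) (by simpa using h1) (by simpa using h2)
    simpa using this

theorem rot : OddFrame rotA rotB where
  adj p q := by
    unfold adjZ2 rotA rotB
    constructor
    · intro h; constructor <;> grind
    · intro h; grind
  odd p := by unfold rotA rotB; omega
  surj a b hab := ⟨((a + 1 + b) / 2, (a + 1 - b) / 2), by unfold rotA; simp only; omega, by unfold rotB; simp only; omega⟩
  inj p q h1 h2 := by
    unfold rotA at h1; unfold rotB at h2
    ext <;> omega

/-- Any two sites of a non-degenerate rectangle are joined inside it. -/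
theorem rect_reach (h : OddFrame A B) {a1 a2 b1 b2 : ℤ} (ha : a1 < a2) (hb : b1 < b2)
    {ω : Config} (hω : ∀ p, a1 ≤ A p → A p ≤ a2 → b1 ≤ B p → B p ≤ b2 → p ∈ ω)
    {p q : Site} (hp : a1 ≤ A p ∧ A p ≤ a2 ∧ b1 ≤ B p ∧ B p ≤ b2)
    (hq : a1 ≤ A q ∧ A q ≤ a2 ∧ b1 ≤ B q ∧ B q ≤ b2) : Reach ω p q := by
  have key : ∀ n : ℕ, ∀ p, (a1 ≤ A p ∧ A p ≤ a2 ∧ b1 ≤ B p ∧ B p ≤ b2) →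
      |A p - A q| ≤ n → |B p - B q| ≤ n → Reach ω p q := by
    intro n
    induction n with
    | zero =>
      intro p hp h1 h2
      have : p = q := h.inj p q (by grind) (by grind)
      subst this
      exact Reach.refl (hω _ hp.1 hp.2.1 hp.2.2.1 hp.2.2.2)
    | succ n ih =>
      intro p hp h1 h2
      by_cases he : p = q
      · subst he
        exact Reach.refl (hω _ hp.1 hp.2.1 hp.2.2.1 hp.2.2.2)
      have hne : A p ≠ A q ∨ B p ≠ B q := by
        by_contra hc; push Not at hc; exact he (h.inj p q hc.1 hc.2)
      have o1 := h.odd p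
      have o2 := h.odd q
      have hx : ∃ a, |A p - a| = 1 ∧ a1 ≤ a ∧ a ≤ a2 ∧ |a - A q| ≤ n := by
        rcases lt_trichotomy (A p) (A q) with hl | hl | hl
        · exact ⟨A p + 1, by simp, by omega, by omega, by rw [abs_le] at h1 ⊢; push_cast at h1; omega⟩
        · rcases lt_or_ge (A p) a2 with h' | h'
          · exact ⟨A p + 1, by simp, by omega, by omega, by rw [abs_le] at h2 ⊢; push_cast at h2; omega⟩
          · exact ⟨A p - 1, by simp, by omega, by omega, by rw [abs_le] at h2 ⊢; push_cast at h2; omega⟩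
        · exact ⟨A p - 1, by simp, by omega, by omega, by rw [abs_le] at h1 ⊢; push_cast at h1; omega⟩
      have hy : ∃ b, |B p - b| = 1 ∧ b1 ≤ b ∧ b ≤ b2 ∧ |b - B q| ≤ n := by
        rcases lt_trichotomy (B p) (B q) with hl | hl | hl
        · exact ⟨B p + 1, by simp, by omega, by omega, by rw [abs_le] at h2 ⊢; push_cast at h2; omega⟩
        · rcases lt_or_ge (B p) b2 with h' | h'
          · exact ⟨B p + 1, by simp, by omega, by omega, by rw [abs_le] at h1 ⊢; push_cast at h1; omega⟩
          · exact ⟨B p - 1, by simp, by omega, by omega, by rw [abs_le] at h1 ⊢; push_cast at h1; omega⟩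
        · exact ⟨B p - 1, by simp, by omega, by omega, by rw [abs_le] at h2 ⊢; push_cast at h2; omega⟩
      obtain ⟨a, ha1, ha2, ha3, ha4⟩ := hx
      obtain ⟨b, hb1, hb2, hb3, hb4⟩ := hy
      obtain ⟨r, rfl, rfl⟩ := h.surj a b (by
        rw [abs_eq zero_le_one] at ha1 hb1; omega)
      exact Reach.head (hω _ hp.1 hp.2.1 hp.2.2.1 hp.2.2.2) ((h.adj _ _).2 ⟨ha1, hb1⟩)
        (ih r ⟨ha2, ha3, hb2, hb3⟩ ha4 hb4)
  exact key (max (A p - A q).natAbs (B p - B q).natAbs) p hp (by grind) (by grind)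

end OddFrame

/-- A shortest walk inside `F` is an induced path. -/
theorem Reach.exists_induced {F : Config} {x y : Site} (h : Reach F x y) :
    ∃ (n : ℕ) (ρ : ℕ → Site), ρ 0 = x ∧ ρ n = y ∧ (∀ i ≤ n, ρ i ∈ F) ∧
      (∀ i < n, adjZ2 (ρ i) (ρ (i + 1))) ∧
      ∀ i j, i < j → j ≤ n → ρ i ≠ ρ j ∧ (adjZ2 (ρ i) (ρ j) → j = i + 1) := by
  classical
  let W : ℕ → Prop := fun n => ∃ ρ : ℕ → Site, ρ 0 = x ∧ ρ n = y ∧ (∀ i ≤ n, ρ i ∈ F) ∧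
      (∀ i < n, adjZ2 (ρ i) (ρ (i + 1)))
  have hW : ∃ n, W n := by
    obtain ⟨hx, h⟩ := h
    induction h with
    | refl => exact ⟨0, fun _ => x, rfl, rfl, fun _ _ => hx, fun i hi => by omega⟩
    | @tail b c hb hbc ih =>
      obtain ⟨n, ρ, h0, hn, hF, ha⟩ := ih
      refine ⟨n + 1, fun k => if k ≤ n then ρ k else c, by simp [h0], by simp, ?_, ?_⟩
      · intro i _
        dsimp only
        split_ifs with hi
        · exact hF i hi
        · exact hbc.2
      · intro i hi
        rcases Nat.lt_or_ge i n with h' | h'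
        · have := ha i h'
          simpa [h'.le, h'] using this
        · have : i = n := by omega
          subst this
          simp [hn, hbc.1]
  obtain ⟨n, ⟨ρ, h0, hn, hF, ha⟩, hmin⟩ : ∃ n, W n ∧ ∀ k < n, ¬ W k :=
    ⟨Nat.find hW, Nat.find_spec hW, fun k hk => Nat.find_min hW hk⟩
  refine ⟨n, ρ, h0, hn, hF, ha, fun i j hij hj => ⟨fun he => ?_, fun hadj => ?_⟩⟩
  · refine hmin (n - (j - i)) (by omega) ⟨fun k => if k ≤ i then ρ k else ρ (k + (j - i)), by simp [h0], ?_, ?_, ?_⟩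
    · dsimp only
      split_ifs with h1
      · have : j = n := by omega
        subst this
        rw [← hn, ← he]; congr 1; omega
      · rw [← hn]; congr 1; omega
    · intro k hk
      dsimp only
      split_ifs with h1
      · exact hF k (by omega)
      · exact hF _ (by omega)
    · intro k hk
      dsimp only
      rcases lt_trichotomy k i with h1 | h1 | h1
      · rw [if_pos h1.le, if_pos (by omega)]; exact ha k (by omega)
      · subst h1
        rw [if_pos le_rfl, if_neg (by omega), he]
        have := ha j (by omega)
        rwa [show k + 1 + (j - k) = j + 1 by omega]
      · rw [if_neg (by omega), if_neg (by omega)]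
        have := ha (k + (j - i)) (by omega)
        rwa [show k + 1 + (j - i) = k + (j - i) + 1 by omega]
  · by_contra hne
    refine hmin (n - (j - i - 1)) (by omega) ⟨fun k => if k ≤ i then ρ k else ρ (k + (j - i - 1)), by simp [h0], ?_, ?_, ?_⟩
    · dsimp only
      rw [if_neg (by omega), ← hn]; congr 1; omega
    · intro k hk
      dsimp only
      split_ifs with h1
      · exact hF k (by omega)
      · exact hF _ (by omega)
    · intro k hk
      dsimp only
      rcases lt_trichotomy k i with h1 | h1 | h1
      · rw [if_pos h1.le, if_pos (by omega)]; exact ha k (by omega)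
      · subst h1
        rw [if_pos le_rfl, if_neg (by omega)]
        rwa [show k + 1 + (j - k - 1) = j by omega]
      · rw [if_neg (by omega), if_neg (by omega)]
        have := ha (k + (j - i - 1)) (by omega)
        rwa [show k + 1 + (j - i - 1) = k + (j - i - 1) + 1 by omega]

theorem finite_adj (a : Site) : {b | adjZ2 a b}.Finite := by
  refine (Set.finite_Icc (a - 1) (a + 1)).subset fun b hb => ?_
  have hb' : |a.1 - b.1| + |a.2 - b.2| = 1 := hb
  simp only [mem_Icc, Prod.le_def, Prod.fst_sub, Prod.snd_sub, Prod.fst_add, Prod.snd_add, Prod.fst_one, Prod.snd_one]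
  refine ⟨⟨?_, ?_⟩, ?_, ?_⟩ <;> grind

theorem exists_bound_of_injective {γ : ℤ → Site} (hγ : Function.Injective γ) {S : Set Site}
    (hS : S.Finite) : ∃ N : ℤ, 0 ≤ N ∧ ∀ t, N ≤ |t| → γ t ∉ S := by
  have hf := hS.preimage hγ.injOn
  obtain ⟨u, hu⟩ := (hf.image (fun t => |t|)).bddAbove
  refine ⟨max 0 (u + 1), by simp, fun t ht hm => ?_⟩
  have := hu ⟨t, hm, rfl⟩
  dsimp only at this
  have := le_max_right 0 (u + 1)
  omega

/-- Replacing a finite middle piece of a doubly-infinite self-repelling path. -/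
theorem hasDISRPath_of_reach {ω : Config} {γ : ℤ → Site} (hγ : Function.Injective γ)
    (hadj : ∀ i j : ℤ, adjZ2 (γ i) (γ j) ↔ (j = i + 1 ∨ i = j + 1)) {a b : ℤ}
    (ha : ∀ t ≤ a, γ t ∈ ω) (hb : ∀ t ≥ b, γ t ∈ ω) (hab : Reach ω (γ a) (γ b)) :
    HasDISRPath adjZ2 ω := by
  obtain ⟨l, ⟨_, _, hl2⟩, hl3, hl4⟩ := hab.exists_list
  set Ls : Set Site := {z | z ∈ γ a :: l} with hLs
  have hLf : Ls.Finite := List.finite_toSet _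
  have hLr : Reach Ls (γ a) (γ b) := Reach.of_isChain l _ hl2 (fun z hz => hz) hl4
  obtain ⟨N1, hN1, hN1'⟩ := exists_bound_of_injective hγ
    (hLf.union (hLf.biUnion (t := fun a => {b | adjZ2 a b}) fun a _ => finite_adj a))
  obtain ⟨N, hN, hNa, hNb⟩ : ∃ N, N1 ≤ N ∧ |a| ≤ N ∧ |b| ≤ N :=
    ⟨max N1 (max |a| |b|), by simp, by simp, by simp⟩
  have hNL : ∀ t, N ≤ |t| → γ t ∉ Ls := fun t ht hm => hN1' t (by omega) (Or.inl hm)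
  have hNA : ∀ t, N ≤ |t| → ∀ f ∈ Ls, ¬ adjZ2 f (γ t) := fun t ht f hf hm =>
    hN1' t (by omega) (Or.inr (by simp only [mem_iUnion]; exact ⟨f, hf, hm⟩))
  clear hN1'
  rw [abs_le] at hNa hNb
  set F : Set Site := {z | z ∈ Ls ∨ ∃ t, (-N ≤ t ∧ t ≤ a ∨ b ≤ t ∧ t ≤ N) ∧ z = γ t} with hF
  have hFω : F ⊆ ω := by
    rintro z (hz | ⟨t, (ht | ht), rfl⟩)
    · exact hl3 z hz
    · exact ha t ht.2
    · exact hb t ht.1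
  have hseg : ∀ n : ℕ, ∀ t : ℤ, (∀ k, t ≤ k → k ≤ t + n → γ k ∈ F) → Reach F (γ t) (γ (t + n)) := by
    intro n
    induction n with
    | zero => intro t ht; simpa using Reach.refl (ht t le_rfl (by simp))
    | succ n ih =>
      intro t ht
      have := ih t (fun k h1 h2 => ht k h1 (by push_cast; omega))
      refine this.tail ((hadj _ _).2 (Or.inl ?_)) (ht _ (by omega) le_rfl)
      push_cast; ring
  have hr : Reach F (γ (-N)) (γ N) := by
    have h1 := hseg (a + N).toNat (-N) (fun k h1 h2 => Or.inr ⟨k, Or.inl ⟨h1, by omega⟩, rfl⟩)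
    have h2 := hseg (N - b).toNat b (fun k h1 h2 => Or.inr ⟨k, Or.inr ⟨h1, by omega⟩, rfl⟩)
    rw [show -N + ((a + N).toNat : ℤ) = a by omega] at h1
    rw [show b + ((N - b).toNat : ℤ) = N by omega] at h2
    exact (h1.trans (hLr.mono fun z hz => Or.inl hz)).trans h2
  have hout : ∀ t, N < |t| → ∀ f ∈ F, γ t ≠ f := by
    rintro t ht f (hf | ⟨u, hu, rfl⟩) he
    · exact hNL t (by omega) (he ▸ hf)
    · have := hγ he
      subst this
      rcases abs_cases t with h | h <;> omega
  have houtA : ∀ t, N < |t| → ∀ f ∈ F, adjZ2 (γ t) f → (t = N + 1 ∧ f = γ N) ∨ (t = -N - 1 ∧ f = γ (-N)) := by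
    rintro t ht f (hf | ⟨u, hu, rfl⟩) he
    · exact absurd (adjZ2_symm he) (hNA t (by omega) f hf)
    · rw [hadj] at he
      rcases abs_cases t with h | h
      · left
        have : u = N := by omega
        subst this; exact ⟨by omega, rfl⟩
      · right
        have : u = -N := by omega
        subst this; exact ⟨by omega, rfl⟩
  obtain ⟨n, ρ, h0, hn, hρF, hρa, hρ⟩ := hr.exists_induced
  let δ : ℤ → Site := fun t => if t < 0 then γ (-N + t) else if t ≤ n then ρ t.toNat else γ (N + (t - n))
  have hδ1 : ∀ t < 0, δ t = γ (-N + t) := fun t ht => if_pos ht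
  have hδ2 : ∀ k : ℕ, k ≤ n → δ k = ρ k := fun k hk => by
    simp only [δ]; rw [if_neg (by omega), if_pos (by omega)]; simp
  have hδ3 : ∀ t > (n : ℤ), δ t = γ (N + (t - n)) := fun t ht => by
    simp only [δ]; rw [if_neg (by omega), if_neg (by omega)]
  have key : ∀ i j : ℤ, i < j → δ i ≠ δ j ∧ (adjZ2 (δ i) (δ j) ↔ j = i + 1) := by
    intro i j hij
    rcases lt_or_ge i 0 with hi | hi
    · rw [hδ1 i hi]
      have hiN : N < |-N + i| := by rw [abs_of_neg (by omega)]; omega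
      rcases lt_or_ge j 0 with hj | hj
      · rw [hδ1 j hj, hadj]
        exact ⟨fun h => by have := hγ h; omega, by omega⟩
      rcases le_or_gt j n with hj' | hj'
      · lift j to ℕ using hj
        have hj'' : j ≤ n := by omega
        rw [hδ2 j hj'']
        refine ⟨hout _ hiN _ (hρF _ hj''), fun h => ?_, fun h => ?_⟩
        · rcases houtA _ hiN _ (hρF _ hj'') h with h | h
          · omega
          · rcases Nat.eq_zero_or_pos j with h1 | h1
            · subst h1; push_cast; omega
            · exact absurd (h0.trans h.2.symm) (hρ 0 j h1 hj'').1
        · have : j = 0 := by omega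
          subst this
          rw [h0, hadj]; left; push_cast at h; omega
      · rw [hδ3 j hj', hadj]
        exact ⟨fun h => by have := hγ h; omega, by omega⟩
    rcases le_or_gt i n with hi' | hi'
    · lift i to ℕ using hi
      have hi'' : i ≤ n := by omega
      rw [hδ2 i hi'']
      rcases le_or_gt j n with hj' | hj'
      · lift j to ℕ using (by omega)
        have hj'' : j ≤ n := by omega
        rw [hδ2 j hj'']
        refine ⟨(hρ i j (by omega) hj'').1, fun h => ?_, fun h => ?_⟩
        · have := (hρ i j (by omega) hj'').2 h
          subst this; push_cast; rfl
        · have : j = i + 1 := by omega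
          subst this
          exact hρa i (by omega)
      · rw [hδ3 j hj']
        have hjN : N < |N + (j - n)| := by rw [abs_of_pos (by omega)]; omega
        refine ⟨(hout _ hjN _ (hρF _ hi'')).symm, fun h => ?_, fun h => ?_⟩
        · rcases houtA _ hjN _ (hρF _ hi'') (adjZ2_symm h) with h | h
          · rcases Nat.lt_or_ge i n with h1 | h1
            · exact absurd (h.2.trans hn.symm) (hρ i n h1 le_rfl).1
            · omega
          · omega
        · have : i = n := by omega
          subst this
          rw [hn, hadj]; left; omega
    · rw [hδ3 i hi', hδ3 j (by omega), hadj]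
      exact ⟨fun h => by have := hγ h; omega, by omega⟩
  refine ⟨δ, fun i j h => ?_, fun i => ?_, fun i j => ?_⟩
  · by_contra hne
    rcases lt_or_gt_of_ne hne with h' | h'
    · exact (key i j h').1 h
    · exact (key j i h').1 h.symm
  · rcases lt_or_ge i 0 with hi | hi
    · rw [hδ1 i hi]; exact ha _ (by omega)
    rcases le_or_gt i n with hi' | hi'
    · lift i to ℕ using hi
      rw [hδ2 i (by omega)]; exact hFω (hρF i (by omega))
    · rw [hδ3 i hi']; exact hb _ (by omega)
  · rcases lt_trichotomy i j with h' | h' | h'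
    · rw [(key i j h').2]; omega
    · subst h'
      constructor
      · intro h; exact absurd rfl (adjZ2_ne h)
      · intro h; omega
    · rw [adjZ2_comm, (key j i h').2]; omega

/-- The finite core of an essential enhancement: a finite configuration inside a level set
together with two boundary sites which get connected only after the enhancement. -/
theorem Essential.exists_core {R₀ : ℝ} {φ : Config → Config} (hφ : IsEnhancement R₀ φ)
    (hess : Essential adjZ2 φ) (lev : Site → ℤ) (hlev : ∀ p q, adjZ2 p q → |lev p - lev q| ≤ 1)
    (hfin : ∀ n, {p | lev p ≤ n}.Finite) (m₁ : ℤ) (hball : ∀ p ∈ siteBall R₀, lev p ≤ m₁) :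
    ∃ (m : ℤ) (g : Config) (a b : Site), m₁ < m ∧ (∀ p ∈ g, lev p < m ∨ p = a ∨ p = b) ∧
      lev a = m ∧ lev b = m ∧ a ∈ g ∧ b ∈ g ∧ ¬ Reach g a b ∧ Reach (g ∪ φ g) a b := by
  obtain ⟨ω, hno, γ, hγ, hγω, hadj⟩ := hess
  obtain ⟨T, hT0, hT⟩ := exists_bound_of_injective hγ (hfin m₁)
  have hT' : ∀ t, T ≤ |t| → γ t ∈ ω := fun t ht => by
    rcases hγω t with h | h
    · exact h
    · exact absurd (hball _ (hφ.2.1 _ h)) (hT t ht)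
  obtain ⟨m, hm, hmT⟩ : ∃ m, m₁ < m ∧ ∀ t, |t| ≤ T → lev (γ t) < m := by
    obtain ⟨u, hu⟩ := ((Set.finite_Icc (-T) T).image (fun t => lev (γ t))).bddAbove
    refine ⟨max (m₁ + 1) (u + 1), by have := le_max_left (m₁ + 1) (u + 1); omega, fun t ht => ?_⟩
    have := hu ⟨t, abs_le.1 ht, rfl⟩
    dsimp only at this
    have := le_max_right (m₁ + 1) (u + 1)
    omega
  obtain ⟨T2, hT20, hT2⟩ := exists_bound_of_injective hγ (hfin (m - 1))
  have hT2' : ∀ t, T2 ≤ |t| → m ≤ lev (γ t) := fun t ht => by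
    have := hT2 t ht
    simp only [mem_ofPred_eq] at this
    omega
  have hexit : ∀ e : ℤ, (e = 1 ∨ e = -1) → ∃ n : ℕ, T < n ∧ lev (γ (e * n)) = m ∧ ∀ k : ℕ, k < n → lev (γ (e * k)) < m := by
    intro e he
    classical
    have habs : ∀ k : ℕ, |e * k| = k := by rcases he with rfl | rfl <;> simp
    have hex : ∃ n : ℕ, m ≤ lev (γ (e * n)) := ⟨T2.toNat, hT2' _ (by rw [habs]; omega)⟩
    have h1 := Nat.find_spec hex
    have h2 := fun k (hk : k < Nat.find hex) => Nat.find_min hex hk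
    set n := Nat.find hex
    have hTn : T < n := by
      by_contra hc
      have := hmT (e * n) (by rw [habs]; omega)
      omega
    refine ⟨n, hTn, ?_, fun k hk => by have := h2 k hk; omega⟩
    have h3 := h2 (n - 1) (by omega)
    have h4 := hlev (γ (e * n)) (γ (e * (n - 1 : ℕ))) ((hadj _ _).2 (by
      rw [Nat.cast_sub (by omega)]; rcases he with rfl | rfl <;> simp <;> omega))
    rw [abs_le] at h4
    omega
  obtain ⟨np, hp1, hp2, hp3⟩ := hexit 1 (Or.inl rfl)
  obtain ⟨nm, hm1, hm2, hm3⟩ := hexit (-1) (Or.inr rfl)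
  simp only [one_mul, neg_mul] at hp2 hp3 hm2 hm3
  have haω : γ (-nm) ∈ ω := hT' _ (by simp; omega)
  have hbω : γ np ∈ ω := hT' _ (by simp; omega)
  set g : Config := {p | p ∈ ω ∧ lev p < m} ∪ {γ (-nm), γ np} with hg
  have hgω : g ⊆ ω := by
    rintro p (hp | rfl | rfl)
    · exact hp.1
    · exact haω
    · exact hbω
  have hφg : φ g = φ ω := by
    apply hφ.2.2
    ext p
    constructor
    · rintro ⟨h1, h2⟩; exact ⟨hgω h1, h2⟩
    · rintro ⟨h1, h2⟩; exact ⟨Or.inl ⟨h1, lt_of_le_of_lt (hball p h2) hm⟩, h2⟩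
  refine ⟨m, g, γ (-nm), γ np, hm, ?_, hm2, hp2, Or.inr (by simp), Or.inr (by simp), ?_, ?_⟩
  · rintro p (hp | rfl | rfl)
    · exact Or.inl hp.2
    · right; left; rfl
    · right; right; rfl
  · intro hr
    refine hno (hasDISRPath_of_reach hγ hadj (a := -nm) (b := np) ?_ ?_ (hr.mono hgω))
    · intro t ht; exact hT' t (by rw [abs_of_neg (by omega)]; omega)
    · intro t ht; exact hT' t (by rw [abs_of_pos (by omega)]; omega)
  · rw [hφg]
    have hin : ∀ t : ℤ, -nm ≤ t → t ≤ np → γ t ∈ g ∪ φ ω := by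
      intro t h1 h2
      rcases hγω t with h | h
      · left
        by_cases e1 : t = -nm
        · right; left; rw [e1]
        by_cases e2 : t = np
        · right; right; rw [e2]; rfl
        left
        refine ⟨h, ?_⟩
        rcases le_total 0 t with h3 | h3
        · have := hp3 t.toNat (by omega)
          rwa [Int.toNat_of_nonneg h3] at this
        · have := hm3 (-t).toNat (by omega)
          rwa [Int.toNat_of_nonneg (by omega), neg_neg] at this
      · exact Or.inr h
    have hseg : ∀ n : ℕ, (n : ℤ) ≤ nm + np → Reach (g ∪ φ ω) (γ (-nm)) (γ (-nm + n)) := by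
      intro n
      induction n with
      | zero => intro _; simpa using Reach.refl (hin (-nm) le_rfl (by omega))
      | succ n ih =>
        intro h
        refine (ih (by omega)).tail ((hadj _ _).2 (Or.inl ?_)) (hin _ (by omega) (by omega))
        push_cast; ring
    have := hseg (nm + np) (by omega)
    rwa [show (-nm + (nm + np : ℕ) : ℤ) = np by push_cast; ring] at this

/-- A finite switch: the configuration `g` splits into two mutually non-adjacent parts `S` and
`g \ S`, containing all sites of `g` on the top side, respectively on the bottom side, of a
square of half-width `k`, and which get joined by the enhancement at the origin. -/
structure IsGadget (R₀ : ℝ) (φ : Config → Config) (A B : Site → ℤ) (k : ℤ) (g S : Config)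
    (t d : Site) : Prop where
  sub : S ⊆ g
  box : ∀ p ∈ g, |A p| < k ∧ |B p| ≤ k
  closed : ∀ p ∈ S, ∀ q ∈ g, adjZ2 p q → q ∈ S
  top : ∀ p ∈ g, B p = k → p ∈ S
  bot : ∀ p ∈ g, B p = -k → p ∉ S
  ball : ∀ p ∈ siteBall R₀, |A p| < k ∧ |B p| < k
  top_mem : t ∈ g
  bot_mem : d ∈ g
  top_eq : B t = k
  bot_eq : B d = -k
  reach : Reach (g ∪ φ g) t d

theorem IsGadget.neg {R₀ : ℝ} {φ : Config → Config} {A B : Site → ℤ} {k : ℤ} {g S : Config}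
    {t d : Site} (h : IsGadget R₀ φ A B k g S t d) :
    IsGadget R₀ φ A (fun p => -B p) k g (g \ S) d t where
  sub := sdiff_subset
  box p hp := by simpa using h.box p hp
  closed p hp q hq hpq := ⟨hq, fun hq' => hp.2 (h.closed q hq' p hp.1 (adjZ2_symm hpq))⟩
  top p hp hb := ⟨hp, h.bot p hp (by omega)⟩
  bot p hp hb hS := hS.2 (h.top p hp (by omega))
  ball p hp := by simpa using h.ball p hp
  top_mem := h.bot_mem
  bot_mem := h.top_mem
  top_eq := by rw [h.bot_eq, neg_neg]
  bot_eq := by rw [h.top_eq]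
  reach := h.reach.symm

/-- The supremum norm in rotated coordinates. -/
def level (A B : Site → ℤ) (p : Site) : ℤ := max |A p| |B p|

section

variable {R₀ : ℝ} {φ : Config → Config} {A B : Site → ℤ}

theorem gadget_of_parts (hφ : IsEnhancement R₀ φ) (hAB : OddFrame A B) {m m₁ k : ℤ}
    {g Gt Gb : Config} {a b : Site} (hm : m₁ < m) (hk : m < k)
    (hball : ∀ p ∈ siteBall R₀, level A B p ≤ m₁)
    (hg : ∀ p ∈ g, level A B p < m ∨ p = a ∨ p = b) (ha : level A B a = m) (hb : level A B b = m)
    (hag : a ∈ g) (hbg : b ∈ g) (hn : ¬ Reach g a b) (hr : Reach (g ∪ φ g) a b)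
    (ht : ∀ p ∈ Gt, m < level A B p ∧ |A p| < k ∧ |B p| ≤ k ∧ B p ≠ -k)
    (hd : ∀ p ∈ Gb, m < level A B p ∧ |A p| < k ∧ |B p| ≤ k ∧ B p ≠ k)
    (htd : ∀ p ∈ Gt, ∀ q ∈ Gb, ¬ adjZ2 p q) (had : ∀ p ∈ Gb, ¬ adjZ2 a p)
    (hbt : ∀ p ∈ Gt, ¬ adjZ2 b p)
    (hct : ∃ t, B t = k ∧ Reach (insert a Gt) a t) (hcd : ∃ d, B d = -k ∧ Reach (insert b Gb) b d) :
    ∃ g S t d, IsGadget R₀ φ A B k g S t d := by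
  obtain ⟨t, htk, htr⟩ := hct
  obtain ⟨d, hdk, hdr⟩ := hcd
  have hlev : ∀ p q, adjZ2 p q → level A B p < m → m < level A B q → False := by
    intro p q hpq h1 h2
    rw [hAB.adj] at hpq
    unfold level at h1 h2
    grind
  have hgle : ∀ p ∈ g, level A B p ≤ m := by
    intro p hp
    rcases hg p hp with h | rfl | rfl <;> omega
  have hgG : ∀ p ∈ g, ∀ q ∈ Gt ∪ Gb, adjZ2 p q → p = a ∨ p = b := by
    intro p hp q hq hpq
    rcases hg p hp with h | h | h
    · exact (hlev p q hpq h (by rcases hq with hq | hq; exacts [(ht q hq).1, (hd q hq).1])).elim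
    · exact Or.inl h
    · exact Or.inr h
  have hlt : ∀ p, level A B p ≤ m → |A p| < k ∧ |B p| < k := by
    intro p hp; unfold level at hp; constructor <;> omega
  have hreachG : ∀ {c e : Site} {G : Config}, G ⊆ Gt ∪ Gb → c ∈ g → B e = k ∨ B e = -k →
      Reach (insert c G) c e → e ∈ G := by
    intro c e G hG hc he hre
    rcases hre.right_mem with h | h
    · subst h
      have := hlt e (hgle e hc)
      rcases he with he | he <;> rw [he] at this <;> grind
    · exact h
  have htG := hreachG subset_union_left hag (Or.inl htk) htr
  have hdG := hreachG subset_union_right hbg (Or.inr hdk) hdr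
  have hφe : φ (g ∪ (Gt ∪ Gb)) = φ g := by
    apply hφ.2.2
    ext p
    constructor
    · rintro ⟨(h | h | h), h2⟩
      · exact ⟨h, h2⟩
      · have := (ht p h).1; have := hball p h2; omega
      · have := (hd p h).1; have := hball p h2; omega
    · rintro ⟨h1, h2⟩; exact ⟨Or.inl h1, h2⟩
  refine ⟨g ∪ (Gt ∪ Gb), {p | Reach g a p} ∪ Gt, t, d, ?_, ?_, ?_, ?_, ?_, ?_,
    Or.inr (Or.inl htG), Or.inr (Or.inr hdG), htk, hdk, ?_⟩
  · rintro p (hp | hp)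
    · exact Or.inl hp.right_mem
    · exact Or.inr (Or.inl hp)
  · rintro p (hp | hp | hp)
    · have := hlt p (hgle p hp); exact ⟨this.1, this.2.le⟩
    · exact ⟨(ht p hp).2.1, (ht p hp).2.2.1⟩
    · exact ⟨(hd p hp).2.1, (hd p hp).2.2.1⟩
  · rintro p (hp | hp) q (hq | hq | hq) hpq
    · exact Or.inl (hp.tail hpq hq)
    · exact Or.inr hq
    · rcases hgG p hp.right_mem q (Or.inr hq) hpq with rfl | rfl
      · exact absurd hpq (had q hq)
      · exact absurd hp hn
    · rcases hgG q hq p (Or.inl hp) (adjZ2_symm hpq) with rfl | rfl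
      · exact Or.inl (Reach.refl hag)
      · exact absurd (adjZ2_symm hpq) (hbt p hp)
    · exact Or.inr hq
    · exact absurd hpq (htd p hp q hq)
  · rintro p (hp | hp | hp) hB
    · have := (hlt p (hgle p hp)).2; rw [hB] at this; grind
    · exact Or.inr hp
    · exact absurd hB (hd p hp).2.2.2
  · rintro p - hB (hp | hp)
    · have := (hlt p (hgle p hp.right_mem)).2; rw [hB] at this; grind
    · exact (ht p hp).2.2.2 hB
  · intro p hp
    exact hlt p (by have := hball p hp; omega)
  · rw [hφe]
    have h1 : Reach (g ∪ (Gt ∪ Gb) ∪ φ g) a t := htr.mono (by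
      rintro p (rfl | hp)
      · exact Or.inl (Or.inl hag)
      · exact Or.inl (Or.inr (Or.inl hp)))
    have h2 : Reach (g ∪ (Gt ∪ Gb) ∪ φ g) b d := hdr.mono (by
      rintro p (rfl | hp)
      · exact Or.inl (Or.inl hbg)
      · exact Or.inl (Or.inr (Or.inr hp)))
    have h3 : Reach (g ∪ (Gt ∪ Gb) ∪ φ g) a b := hr.mono (by
      rintro p (hp | hp)
      · exact Or.inl (Or.inl hp)
      · exact Or.inr hp)
    exact (h1.symm.trans h3).trans h2

theorem OddFrame.exists_adj (hAB : OddFrame A B) (p : Site) {i j : ℤ} (hi : i = 1 ∨ i = -1)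
    (hj : j = 1 ∨ j = -1) : ∃ q, adjZ2 p q ∧ A q = A p + i ∧ B q = B p + j := by
  obtain ⟨q, h1, h2⟩ := hAB.surj (A p + i) (B p + j) (by have := hAB.odd p; omega)
  refine ⟨q, (hAB.adj _ _).2 ⟨?_, ?_⟩, h1, h2⟩
  · rw [h1]; rcases hi with rfl | rfl <;> simp
  · rw [h2]; rcases hj with rfl | rfl <;> simp

theorem OddFrame.exists_fst (hAB : OddFrame A B) (a b : ℤ) : ∃ p, (A p = a ∨ A p = a + 1) ∧ B p = b := by
  rcases Int.emod_two_eq_zero_or_one (a + b) with h | h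
  · obtain ⟨p, h1, h2⟩ := hAB.surj (a + 1) b (by omega)
    exact ⟨p, Or.inr h1, h2⟩
  · obtain ⟨p, h1, h2⟩ := hAB.surj a b h
    exact ⟨p, Or.inl h1, h2⟩

theorem level_eq_cases (hAB : OddFrame A B) {a : Site} {m : ℤ} (ha : level A B a = m) :
    (A a = m ∧ |B a| < m) ∨ (A a = -m ∧ |B a| < m) ∨ (B a = m ∧ |A a| < m) ∨ (B a = -m ∧ |A a| < m) := by
  have := hAB.odd a
  unfold level at ha
  grind

theorem exits_above (hAB : OddFrame A B) {m b₁ : ℤ} (hm : 1 ≤ m) {a : Site}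
    (ha : level A B a = m) (h1 : b₁ < B a) (h2 : -m ≤ b₁) :
    ∃ t, B t = m + 4 ∧ Reach (insert a {p | m < level A B p ∧ |A p| ≤ m + 3 ∧ |B p| ≤ m + 4 ∧ b₁ < B p}) a t := by
  rcases level_eq_cases hAB ha with ⟨h3, h4⟩ | ⟨h3, h4⟩ | ⟨h3, h4⟩ | ⟨h3, h4⟩
  · obtain ⟨q, hq, hq1, hq2⟩ := hAB.exists_adj a (Or.inl rfl : (1:ℤ) = 1 ∨ _) (Or.inl rfl : (1:ℤ) = 1 ∨ _)
    obtain ⟨t, ht1, ht2⟩ := hAB.exists_fst (m + 1) (m + 4)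
    rw [abs_lt] at h4
    refine ⟨t, ht2, Reach.head (mem_insert _ _) hq (hAB.rect_reach (a1 := m + 1) (a2 := m + 2)
      (b1 := B a + 1) (b2 := m + 4) (by omega) (by omega) ?_ (by omega) (by omega))⟩
    intro p h5 h6 h7 h8
    right
    refine ⟨?_, ?_, ?_, by omega⟩
    · unfold level; exact lt_max_of_lt_left (by rw [lt_abs]; omega)
    · rw [abs_le]; omega
    · rw [abs_le]; omega
  · obtain ⟨q, hq, hq1, hq2⟩ := hAB.exists_adj a (Or.inr rfl : (-1:ℤ) = 1 ∨ _) (Or.inl rfl : (1:ℤ) = 1 ∨ _)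
    obtain ⟨t, ht1, ht2⟩ := hAB.exists_fst (-(m + 2)) (m + 4)
    rw [abs_lt] at h4
    refine ⟨t, ht2, Reach.head (mem_insert _ _) hq (hAB.rect_reach (a1 := -(m + 2)) (a2 := -(m + 1))
      (b1 := B a + 1) (b2 := m + 4) (by omega) (by omega) ?_ (by omega) (by omega))⟩
    intro p h5 h6 h7 h8
    right
    refine ⟨?_, ?_, ?_, by omega⟩
    · unfold level; exact lt_max_of_lt_left (by rw [lt_abs]; omega)
    · rw [abs_le]; omega
    · rw [abs_le]; omega
  · obtain ⟨q, hq, hq1, hq2⟩ := hAB.exists_adj a (Or.inl rfl : (1:ℤ) = 1 ∨ _) (Or.inl rfl : (1:ℤ) = 1 ∨ _)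
    obtain ⟨t, ht1, ht2⟩ := hAB.exists_fst 0 (m + 4)
    rw [abs_lt] at h4
    refine ⟨t, ht2, Reach.head (mem_insert _ _) hq (hAB.rect_reach (a1 := -(m + 2)) (a2 := m + 2)
      (b1 := m + 1) (b2 := m + 4) (by omega) (by omega) ?_ (by omega) (by omega))⟩
    intro p h5 h6 h7 h8
    right
    refine ⟨?_, ?_, ?_, by omega⟩
    · unfold level; exact lt_max_of_lt_right (by rw [lt_abs]; omega)
    · rw [abs_le]; omega
    · rw [abs_le]; omega
  · omega

theorem exits_left (hAB : OddFrame A B) {m a₁ : ℤ} (hm : 1 ≤ m) {a : Site}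
    (ha : level A B a = m) (h1 : A a < a₁) (h2 : a₁ ≤ m) :
    ∃ t, B t = m + 6 ∧ Reach (insert a {p | m < level A B p ∧ |A p| < m + 6 ∧ |B p| ≤ m + 6 ∧
      (A p < a₁ ∧ -(m + 3) < B p ∨ m + 3 < B p)}) a t := by
  obtain ⟨t, ht1, ht2⟩ := hAB.exists_fst (-(m + 2)) (m + 6)
  refine ⟨t, ht2, ?_⟩
  set G : Config := {p | m < level A B p ∧ |A p| < m + 6 ∧ |B p| ≤ m + 6 ∧
      (A p < a₁ ∧ -(m + 3) < B p ∨ m + 3 < B p)} with hG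
  have hcol : ∀ p, -(m + 2) ≤ A p → A p ≤ -(m + 1) → -(m + 2) ≤ B p → B p ≤ m + 6 → -m ≤ A a → p ∈ insert a G := by
    intro p h5 h6 h7 h8 h9
    right
    refine ⟨?_, ?_, ?_, by omega⟩
    · unfold level; exact lt_max_of_lt_left (by rw [lt_abs]; omega)
    · rw [abs_lt]; omega
    · rw [abs_le]; omega
  rcases level_eq_cases hAB ha with ⟨h3, h4⟩ | ⟨h3, h4⟩ | ⟨h3, h4⟩ | ⟨h3, h4⟩
  · omega
  · obtain ⟨q, hq, hq1, hq2⟩ := hAB.exists_adj a (Or.inr rfl : (-1:ℤ) = 1 ∨ _) (Or.inl rfl : (1:ℤ) = 1 ∨ _)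
    rw [abs_lt] at h4
    exact Reach.head (mem_insert _ _) hq (hAB.rect_reach (a1 := -(m + 2)) (a2 := -(m + 1))
      (b1 := -(m + 2)) (b2 := m + 6) (by omega) (by omega)
      (fun p h5 h6 h7 h8 => hcol p h5 h6 h7 h8 (by omega)) (by omega) (by omega))
  · obtain ⟨q, hq, hq1, hq2⟩ := hAB.exists_adj a (Or.inr rfl : (-1:ℤ) = 1 ∨ _) (Or.inl rfl : (1:ℤ) = 1 ∨ _)
    rw [abs_lt] at h4
    refine Reach.head (mem_insert _ _) hq (hAB.rect_reach (a1 := -(m + 2)) (a2 := A a)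
      (b1 := m + 1) (b2 := m + 6) (by omega) (by omega) ?_ (by omega) (by omega))
    intro p h5 h6 h7 h8
    right
    refine ⟨?_, ?_, ?_, by omega⟩
    · unfold level; exact lt_max_of_lt_right (by rw [lt_abs]; omega)
    · rw [abs_lt]; omega
    · rw [abs_le]; omega
  · obtain ⟨q, hq, hq1, hq2⟩ := hAB.exists_adj a (Or.inr rfl : (-1:ℤ) = 1 ∨ _) (Or.inr rfl : (-1:ℤ) = 1 ∨ _)
    rw [abs_lt] at h4
    obtain ⟨c, hc1, hc2⟩ := hAB.surj (-(m + 2)) (-(m + 1)) (by omega)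
    refine Reach.head (mem_insert _ _) hq (Reach.trans (y := c) ?_ (hAB.rect_reach (a1 := -(m + 2)) (a2 := -(m + 1))
      (b1 := -(m + 2)) (b2 := m + 6) (by omega) (by omega)
      (fun p h5 h6 h7 h8 => hcol p h5 h6 h7 h8 (by omega)) (by omega) (by omega)))
    refine hAB.rect_reach (a1 := -(m + 2)) (a2 := A a)
      (b1 := -(m + 2)) (b2 := -(m + 1)) (by omega) (by omega) ?_ (by omega) (by omega)
    intro p h5 h6 h7 h8
    right
    refine ⟨?_, ?_, ?_, by omega⟩
    · unfold level; exact lt_max_of_lt_right (by rw [lt_abs]; omega)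
    · rw [abs_lt]; omega
    · rw [abs_le]; omega

theorem OddFrame.adj' (hAB : OddFrame A B) {p q : Site} (h : adjZ2 p q) :
    (A q = A p + 1 ∨ A q = A p - 1) ∧ (B q = B p + 1 ∨ B q = B p - 1) := by
  rw [hAB.adj, abs_eq zero_le_one, abs_eq zero_le_one] at h; omega

theorem exists_gadget (hφ : IsEnhancement R₀ φ) (hess : Essential adjZ2 φ) (hAB : OddFrame A B)
    (hfin : ∀ n, {p | level A B p ≤ n}.Finite) (m₁ : ℤ) (hm1 : 0 ≤ m₁)
    (hball : ∀ p ∈ siteBall R₀, level A B p ≤ m₁) :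
    ∃ k, m₁ < k ∧ ∃ g S t d, IsGadget R₀ φ A B k g S t d := by
  obtain ⟨m, g, a, b, hm, hg, ha, hb, hag, hbg, hn, hr⟩ := hess.exists_core hφ (level A B) (by
    intro p q hpq
    have := hAB.adj' hpq
    unfold level
    grind) hfin m₁ hball
  have hnadj : ¬ adjZ2 a b := fun h => hn (Reach.of_adj hag hbg h)
  have hne : a ≠ b := by
    rintro rfl; exact hn (Reach.refl hag)
  have hpar1 := hAB.odd a
  have hpar2 := hAB.odd b
  have hla : |A a| ≤ m ∧ |B a| ≤ m := by unfold level at ha; constructor <;> omega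
  have hlb : |A b| ≤ m ∧ |B b| ≤ m := by unfold level at hb; constructor <;> omega
  have hlne : ∀ p q, level A (fun p => -B p) p = level A B p ∧ level (fun p => -A p) (fun p => -B p) q = level A B q := by
    intro p q; simp [level]
  have caseV : ∀ a b, (∀ p ∈ g, level A B p < m ∨ p = a ∨ p = b) → level A B a = m → level A B b = m →
      a ∈ g → b ∈ g → ¬ Reach g a b → Reach (g ∪ φ g) a b → B b + 2 ≤ B a →
      ∃ k, m₁ < k ∧ ∃ g S t d, IsGadget R₀ φ A B k g S t d := by
    intro a b hg ha hb hag hbg hn hr hB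
    have hla : |A a| ≤ m ∧ |B a| ≤ m := by unfold level at ha; constructor <;> omega
    have hlb : |A b| ≤ m ∧ |B b| ≤ m := by unfold level at hb; constructor <;> omega
    simp only [abs_le] at hla hlb
    refine ⟨m + 4, by omega, gadget_of_parts hφ hAB (k := m + 4)
      (Gt := {p | m < level A B p ∧ |A p| ≤ m + 3 ∧ |B p| ≤ m + 4 ∧ B b + 1 < B p})
      (Gb := {p | m < level A B p ∧ |A p| ≤ m + 3 ∧ |B p| ≤ m + 4 ∧ B p < B b + 1})
      hm (by omega) hball hg ha hb hag hbg hn hr ?_ ?_ ?_ ?_ ?_ ?_ ?_⟩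
    · rintro p ⟨h1, h2, h3, h4⟩
      exact ⟨h1, by omega, h3, by omega⟩
    · rintro p ⟨h1, h2, h3, h4⟩
      exact ⟨h1, by omega, h3, by omega⟩
    · rintro p ⟨h1, h2, h3, h4⟩ q ⟨h5, h6, h7, h8⟩ hpq
      have := hAB.adj' hpq; omega
    · rintro p ⟨h1, h2, h3, h4⟩ hpq
      have := hAB.adj' hpq; omega
    · rintro p ⟨h1, h2, h3, h4⟩ hpq
      have := hAB.adj' hpq; omega
    · exact exits_above hAB (by omega) ha (by omega) (by omega)
    · obtain ⟨t, h1, h2⟩ := exits_above hAB.negB (m := m) (b₁ := -(B b + 1)) (by omega)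
        (((hlne b b).1).trans hb) (by omega) (by omega)
      refine ⟨t, by omega, h2.mono (insert_subset_insert ?_)⟩
      rintro p ⟨h3, h4, h5, h6⟩
      rw [(hlne p p).1] at h3
      rw [abs_neg] at h5
      exact ⟨h3, h4, h5, by omega⟩
  have caseH : ∀ a b, (∀ p ∈ g, level A B p < m ∨ p = a ∨ p = b) → level A B a = m → level A B b = m →
      a ∈ g → b ∈ g → ¬ Reach g a b → Reach (g ∪ φ g) a b → A a + 2 ≤ A b →
      ∃ k, m₁ < k ∧ ∃ g S t d, IsGadget R₀ φ A B k g S t d := by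
    intro a b hg ha hb hag hbg hn hr hA
    have hla : |A a| ≤ m ∧ |B a| ≤ m := by unfold level at ha; constructor <;> omega
    have hlb : |A b| ≤ m ∧ |B b| ≤ m := by unfold level at hb; constructor <;> omega
    simp only [abs_le] at hla hlb
    refine ⟨m + 6, by omega, gadget_of_parts hφ hAB (k := m + 6)
      (Gt := {p | m < level A B p ∧ |A p| < m + 6 ∧ |B p| ≤ m + 6 ∧
        (A p < A a + 1 ∧ -(m + 3) < B p ∨ m + 3 < B p)})
      (Gb := {p | m < level A B p ∧ |A p| < m + 6 ∧ |B p| ≤ m + 6 ∧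
        (A a + 1 < A p ∧ B p < m + 3 ∨ B p < -(m + 3))})
      hm (by omega) hball hg ha hb hag hbg hn hr ?_ ?_ ?_ ?_ ?_ ?_ ?_⟩
    · rintro p ⟨h1, h2, h3, h4⟩
      exact ⟨h1, by omega, h3, by omega⟩
    · rintro p ⟨h1, h2, h3, h4⟩
      exact ⟨h1, by omega, h3, by omega⟩
    · rintro p ⟨h1, h2, h3, h4⟩ q ⟨h5, h6, h7, h8⟩ hpq
      have := hAB.adj' hpq; omega
    · rintro p ⟨h1, h2, h3, h4⟩ hpq
      have := hAB.adj' hpq; omega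
    · rintro p ⟨h1, h2, h3, h4⟩ hpq
      have := hAB.adj' hpq; omega
    · exact exits_left hAB (by omega) ha (by omega) (by omega)
    · obtain ⟨t, h1, h2⟩ := exits_left hAB.negB.negA (m := m) (a₁ := -(A a + 1)) (by omega)
        (((hlne b b).2).trans hb) (by omega) (by omega)
      refine ⟨t, by omega, h2.mono (insert_subset_insert ?_)⟩
      rintro p ⟨h3, h4, h5, h6⟩
      rw [(hlne p p).2] at h3
      rw [abs_neg] at h4 h5
      exact ⟨h3, h4, h5, by omega⟩
  have hg' : ∀ p ∈ g, level A B p < m ∨ p = b ∨ p = a := fun p hp => by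
    rcases hg p hp with h | h | h <;> tauto
  have hn' : ¬ Reach g b a := fun h => hn h.symm
  have hdiff : B b + 2 ≤ B a ∨ B a + 2 ≤ B b ∨ A a + 2 ≤ A b ∨ A b + 2 ≤ A a := by
    by_contra hc
    push Not at hc
    by_cases hB : B a = B b
    · exact hne (hAB.inj a b (by omega) hB)
    · refine hnadj ((hAB.adj a b).2 ⟨?_, ?_⟩)
      · rw [abs_eq zero_le_one]; omega
      · rw [abs_eq zero_le_one]; omega
  rcases hdiff with h | h | h | h
  · exact caseV a b hg ha hb hag hbg hn hr h
  · exact caseV b a hg' hb ha hbg hag hn' hr.symm h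
  · exact caseH a b hg ha hb hag hbg hn hr h
  · exact caseH b a hg' hb ha hbg hag hn' hr.symm h

end

section

variable {R₀ : ℝ} {φ : Config → Config} {A B A₀ B₀ : Site → ℤ} {L k : ℤ} {C₁ C₂ : Config} {u v : Site}

theorem level_eq_iff {p : Site} {m : ℤ} (hm : 0 ≤ m) : level A B p = m ↔
    (-m ≤ A p ∧ A p ≤ m ∧ -m ≤ B p ∧ B p ≤ m) ∧ (A p = m ∨ A p = -m ∨ B p = m ∨ B p = -m) := by
  unfold level; grind

theorem level_lt_iff {p : Site} {m : ℤ} : level A B p < m ↔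
    -m < A p ∧ A p < m ∧ -m < B p ∧ B p < m := by
  unfold level; grind

theorem level_le_iff {p : Site} {m : ℤ} : level A B p ≤ m ↔
    -m ≤ A p ∧ A p ≤ m ∧ -m ≤ B p ∧ B p ≤ m := by
  unfold level; grind

theorem level_negB (p : Site) : level A (fun p => -B p) p = level A B p := by simp [level]

theorem level_swap (p : Site) : level B A p = level A B p := by simp [level, max_comm]

/-- Entry data for routing two boundary sites of a box through a horizontal separating line. -/
def Separated (L : ℤ) (A B : Site → ℤ) (C₁ C₂ : Config) (u v : Site) : Prop :=
  ∃ e₁ f₁ e₂ f₂ b₀, e₁ ∈ C₁ ∧ e₂ ∈ C₂ ∧ (e₁ = u ∨ adjZ2 u e₁) ∧ (e₂ = v ∨ adjZ2 v e₂) ∧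
    level A B e₁ = L ∧ level A B e₂ = L ∧ level A B f₁ = L - 1 ∧ level A B f₂ = L - 1 ∧
    adjZ2 e₁ f₁ ∧ adjZ2 e₂ f₂ ∧ -(L - 3) ≤ b₀ ∧ b₀ ≤ L - 3 ∧ B f₂ < b₀ ∧ b₀ < B f₁ ∧
    ¬ adjZ2 f₁ v ∧ ¬ adjZ2 f₁ e₂ ∧ ¬ adjZ2 f₂ u ∧ ¬ adjZ2 f₂ e₁

theorem Separated.of_neg (h : Separated L A (fun p => -B p) C₂ C₁ v u) :
    Separated L A B C₁ C₂ u v := by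
  obtain ⟨e₁, f₁, e₂, f₂, b₀, h⟩ := h
  simp only [level_negB] at h
  refine ⟨e₂, f₂, e₁, f₁, -b₀, ?_⟩
  refine ⟨h.2.1, h.1, h.2.2.2.1, h.2.2.1, ?_⟩
  obtain ⟨-, -, -, -, h5, h6, h7, h8, h9, h10, h11, h12, h13, h14, h15, h16, h17, h18⟩ := h
  exact ⟨h6, h5, h8, h7, h10, h9, by omega, by omega, by omega, by omega, h17, h18, h15, h16⟩

theorem level_negA (p : Site) : level (fun p => -A p) B p = level A B p := by simp [level]

theorem Separated.of_negA (h : Separated L (fun p => -A p) B C₁ C₂ u v) :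
    Separated L A B C₁ C₂ u v := by
  simpa only [Separated, level_negA] using h

theorem separated_of_conflict_aux (hAB : OddFrame A B) (hL : 10 ≤ L)
    (hC : ∀ p ∈ C₁, ∀ q ∈ C₂, p ≠ q ∧ ¬ adjZ2 p q) {u' w : Site} (hu' : u' ∈ C₁)
    (hw : w ∈ C₁) (hv : v ∈ C₂) (hlu' : level A B u' = L + 1)
    (hu'u : adjZ2 u' u) (huw : adjZ2 u w) (hwu' : w ≠ u')
    (h1 : A u = L) (h2 : B u = L - 1) (h3 : A v = L) (h4 : B v = L - 3) :
    Separated L A B C₁ C₂ u v := by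
  have a1 := hAB.adj' hu'u
  have a2 := hAB.adj' huw
  rw [level_eq_iff (by omega)] at hlu'
  have n1 : B w = L := by
    have : B w ≠ L - 2 := fun h => (hC w hw v hv).2 ((hAB.adj _ _).2
      ⟨by rw [abs_eq zero_le_one]; omega, by rw [abs_eq zero_le_one]; omega⟩)
    omega
  have n2 : B u' = L := by
    have : B u' ≠ L - 2 := fun h => (hC u' hu' v hv).2 ((hAB.adj _ _).2
      ⟨by rw [abs_eq zero_le_one]; omega, by rw [abs_eq zero_le_one]; omega⟩)
    omega
  have n3 : A w ≠ A u' := fun h => hwu' (hAB.inj _ _ h (by omega))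
  have hwA : A w = L - 1 := by omega
  clear n3 n2 hlu' a1 a2
  obtain ⟨f₁, hf1, hfA1, hfB1⟩ := hAB.exists_adj w (Or.inr rfl : (-1:ℤ) = 1 ∨ _) (Or.inr rfl : (-1:ℤ) = 1 ∨ _)
  obtain ⟨f₂, hf2, hfA2, hfB2⟩ := hAB.exists_adj v (Or.inr rfl : (-1:ℤ) = 1 ∨ _) (Or.inr rfl : (-1:ℤ) = 1 ∨ _)
  refine ⟨w, f₁, v, f₂, L - 3, hw, hv, Or.inr huw, Or.inl rfl, ?_, ?_, ?_, ?_, hf1, hf2, by omega,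
    by omega, by omega, by omega, ?_, ?_, ?_, ?_⟩
  · rw [level_eq_iff (by omega)]; omega
  · rw [level_eq_iff (by omega)]; omega
  · rw [level_eq_iff (by omega)]; omega
  · rw [level_eq_iff (by omega)]; omega
  · intro h; have := (hAB.adj' h).2; omega
  · intro h; have := (hAB.adj' h).2; omega
  · intro h; have := (hAB.adj' h).2; omega
  · intro h; have := (hAB.adj' h).2; omega

theorem separated_of_conflict (hAB : OddFrame A B) (hL : 10 ≤ L)
    (hC : ∀ p ∈ C₁, ∀ q ∈ C₂, p ≠ q ∧ ¬ adjZ2 p q) {u' w : Site} (hu' : u' ∈ C₁)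
    (hw : w ∈ C₁) (hv : v ∈ C₂) (hlu' : level A B u' = L + 1)
    (hu'u : adjZ2 u' u) (huw : adjZ2 u w) (hwu' : w ≠ u')
    (h1 : A u = L ∨ A u = -L) (h2 : B u = L - 1) (h3 : A v = A u) (h4 : B v = L - 3) :
    Separated L A B C₁ C₂ u v := by
  rcases h1 with h1 | h1
  · exact separated_of_conflict_aux hAB hL hC hu' hw hv hlu' hu'u huw hwu' h1 h2 (by omega) h4
  · exact (separated_of_conflict_aux hAB.negA hL hC hu' hw hv (by rw [level_negA, hlu']) hu'u huw hwu'
      (by omega) h2 (by omega) h4).of_negA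

theorem exists_inner (hAB : OddFrame A B) (hL : 10 ≤ L) (hlu : level A B u = L) (hB : B u ≠ -L) :
    ∃ f, adjZ2 u f ∧ level A B f = L - 1 ∧
      ((B f = B u + 1 ∧ B u ≤ L - 3) ∨
        (B u = L - 1 ∧ B f = L - 2 ∧ (A u = L ∧ A f = L - 1 ∨ A u = -L ∧ A f = -(L - 1))) ∨
        (B u = L ∧ B f = L - 1 ∧ -(L - 2) ≤ A f ∧ A f ≤ L - 2)) := by
  have o := hAB.odd u
  rw [level_eq_iff (by omega)] at hlu
  have : ∃ i j : ℤ, (i = 1 ∨ i = -1) ∧ (j = 1 ∨ j = -1) ∧ (0 < A u → i = -1) ∧ (A u ≤ 0 → i = 1) ∧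
      (B u ≤ L - 3 → j = 1) ∧ (L - 3 < B u → j = -1) := by
    refine ⟨if 0 < A u then -1 else 1, if B u ≤ L - 3 then 1 else -1, ?_⟩
    split_ifs <;> omega
  obtain ⟨i, j, hi, hj, h1, h2, h3, h4⟩ := this
  obtain ⟨f, hf, hf1, hf2⟩ := hAB.exists_adj u hi hj
  refine ⟨f, hf, ?_, ?_⟩
  · rw [level_eq_iff (by omega)]; omega
  · omega

set_option maxHeartbeats 2000000 in
theorem exists_separated (hAB : OddFrame A B) (hL : 10 ≤ L)
    (hC : ∀ p ∈ C₁, ∀ q ∈ C₂, p ≠ q ∧ ¬ adjZ2 p q) {u' w v' w' : Site}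
    (hu' : u' ∈ C₁) (hu : u ∈ C₁) (hw : w ∈ C₁) (hlu' : level A B u' = L + 1) (hlu : level A B u = L)
    (hu'u : adjZ2 u' u) (huw : adjZ2 u w) (hwu' : w ≠ u')
    (hv' : v' ∈ C₂) (hv : v ∈ C₂) (hw' : w' ∈ C₂) (hlv' : level A B v' = L + 1) (hlv : level A B v = L)
    (hv'v : adjZ2 v' v) (hvw' : adjZ2 v w') (hwv' : w' ≠ v')
    (hB : B v + 2 ≤ B u) : Separated L A B C₁ C₂ u v := by
  by_cases c1 : (A u = L ∨ A u = -L) ∧ B u = L - 1 ∧ A v = A u ∧ B v = L - 3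
  · exact separated_of_conflict hAB hL hC hu' hw hv hlu' hu'u huw hwu' c1.1 c1.2.1 c1.2.2.1 c1.2.2.2
  by_cases c2 : (A v = L ∨ A v = -L) ∧ B v = -(L - 1) ∧ A u = A v ∧ B u = -(L - 3)
  · apply Separated.of_neg
    have hC' : ∀ p ∈ C₂, ∀ q ∈ C₁, p ≠ q ∧ ¬ adjZ2 p q := fun p hp q hq =>
      ⟨(hC q hq p hp).1.symm, fun h => (hC q hq p hp).2 (adjZ2_symm h)⟩
    exact separated_of_conflict hAB.negB hL hC' hv' hw' hu (by rw [level_negB, hlv']) hv'v hvw' hwv'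
      c2.1 (by omega) c2.2.2.1 (by omega)
  have o1 := hAB.odd u
  have o2 := hAB.odd v
  have l1 := hlu
  have l2 := hlv
  have hlu0 := hlu
  have hlv0 := hlv
  rw [level_eq_iff (by omega)] at l1 l2
  obtain ⟨f₁, hf1, hlf1, hf1'⟩ := exists_inner hAB hL hlu (by omega)
  obtain ⟨f₂, hf2, hlf2, hf2'⟩ := exists_inner hAB.negB hL (by rw [level_negB, hlv] : level A (fun p => -B p) v = L) (by omega)
  rw [level_negB] at hlf2
  clear hC hwu' hwv' hlu' hlv' hlu hlv
  have a1 := hAB.adj' hf1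
  have a2 := hAB.adj' hf2
  have hb : ∃ b₀, -(L - 3) ≤ b₀ ∧ b₀ ≤ L - 3 ∧ B f₂ < b₀ ∧ b₀ < B f₁ := by
    clear a1 a2 hf1 hf2 hlf1 hlf2 c1 c2
    rcases le_or_gt (-(L - 3)) (B f₂ + 1) with h | h
    · refine ⟨B f₂ + 1, h, ?_, by omega, ?_⟩ <;>
      rcases hf1' with h1 | h1 | h1 <;> rcases hf2' with h2 | h2 | h2 <;> omega
    · refine ⟨-(L - 3), le_rfl, by omega, by omega, ?_⟩
      rcases hf1' with h1 | h1 | h1 <;> omega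
  obtain ⟨b₀, hb1, hb2, hb3, hb4⟩ := hb
  have n1 : ¬ adjZ2 f₁ v := by
    intro h; have := hAB.adj' h
    clear hf2' a2 c2 hb3 hb4
    rcases hf1' with h1 | h1 | h1 <;> omega
  have n2 : ¬ adjZ2 f₂ u := by
    intro h; have := hAB.adj' h
    clear hf1' a1 c1 hb3 hb4
    rcases hf2' with h1 | h1 | h1 <;> omega
  exact ⟨u, f₁, v, f₂, b₀, hu, hv, Or.inl rfl, Or.inl rfl, hlu0, hlv0, hlf1, hlf2, hf1, hf2,
    hb1, hb2, hb3, hb4, n1, n1, n2, n2⟩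

/-- The frame `(A, B)` is a translate of `(A₀, B₀)`. -/
def IsTranslate (A₀ B₀ A B : Site → ℤ) : Prop :=
  ∀ a b : ℤ, (a + b) % 2 = 0 → ∃ c, ∀ p, A₀ (p - c) = A p - a ∧ B₀ (p - c) = B p - b

theorem IsTranslate.negB (h : IsTranslate A₀ B₀ A B) :
    IsTranslate A₀ (fun p => -B₀ p) A (fun p => -B p) := by
  intro a b hab
  obtain ⟨c, hc⟩ := h a (-b) (by omega)
  exact ⟨c, fun p => ⟨(hc p).1, by have := (hc p).2; dsimp only; omega⟩⟩

/-- Inside the box of level `L`, two configurations attached to the two boundary clusters,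
together with an activation site `c`, joining `u` to `v` only via the enhancement at `c`. -/
def Routed (R₀ : ℝ) (φ : Config → Config) (L : ℤ) (lev : Site → ℤ) (C₁ C₂ : Config) (u v : Site) : Prop :=
  ∃ (Q₁ Q₂ : Config) (c : Site), (∀ p ∈ Q₁, lev p ≤ L ∧ (lev p < L ∨ p ∈ C₁)) ∧
    (∀ p ∈ Q₂, lev p ≤ L ∧ (lev p < L ∨ p ∈ C₂)) ∧ (∀ p ∈ Q₁, ∀ q ∈ Q₂, ¬ adjZ2 p q) ∧
    u ∈ Q₁ ∧ v ∈ Q₂ ∧ (∀ y, y - c ∈ siteBall R₀ → lev y ≤ L) ∧ lev c ≤ L ∧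
    Reach (Q₁ ∪ Q₂ ∪ enhAt φ c (Q₁ ∪ Q₂)) u v

theorem Routed.symm {lev : Site → ℤ} (h : Routed R₀ φ L lev C₁ C₂ u v) : Routed R₀ φ L lev C₂ C₁ v u := by
  obtain ⟨Q₁, Q₂, c, h1, h2, h3, h4, h5, h6, h7, h8⟩ := h
  refine ⟨Q₂, Q₁, c, h2, h1, fun p hp q hq h => h3 q hq p hp (adjZ2_symm h), h5, h4, h6, h7, ?_⟩
  rw [union_comm Q₂]
  exact h8.symm

theorem Routed.congr {lev lev' : Site → ℤ} (hl : ∀ p, lev p = lev' p) (h : Routed R₀ φ L lev C₁ C₂ u v) :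
    Routed R₀ φ L lev' C₁ C₂ u v := by
  rwa [show lev' = lev from funext fun p => (hl p).symm]

end

section

variable {R₀ : ℝ} {φ : Config → Config} {A B A₀ B₀ : Site → ℤ} {L k : ℤ} {C₁ C₂ : Config} {u v : Site}

theorem Reach.shift {ω : Config} {x y : Site} (c : Site) (h : Reach ω x y) :
    Reach {p | p - c ∈ ω} (x + c) (y + c) := by
  obtain ⟨hx, h⟩ := h
  induction h with
  | refl => exact Reach.refl (by simpa using hx)
  | tail _ h ih =>
    refine ih.tail ?_ (by simpa using h.2)
    simpa [adjZ2] using h.1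

set_option maxHeartbeats 1600000 in
theorem routed_aux (hφ : IsEnhancement R₀ φ) (hAB : OddFrame A B) {g S : Config} {t d : Site}
    (hG : IsGadget R₀ φ A₀ B₀ k g S t d) (htr : IsTranslate A₀ B₀ A B) (hL : 2 * k + 10 ≤ L)
    (hC : ∀ p ∈ C₁, ∀ q ∈ C₂, p ≠ q ∧ ¬ adjZ2 p q) (hu : u ∈ C₁) (hv : v ∈ C₂)
    (hlu : level A B u = L) (hlv : level A B v = L) {e₁ f₁ e₂ f₂ : Site} {b₀ : ℤ} (hb0 : 0 ≤ b₀)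
    (he1 : e₁ ∈ C₁) (he2 : e₂ ∈ C₂) (hue : e₁ = u ∨ adjZ2 u e₁) (hve : e₂ = v ∨ adjZ2 v e₂)
    (hle1 : level A B e₁ = L) (hle2 : level A B e₂ = L) (hlf1 : level A B f₁ = L - 1)
    (hlf2 : level A B f₂ = L - 1) (hef1 : adjZ2 e₁ f₁) (hef2 : adjZ2 e₂ f₂) (hb : b₀ ≤ L - 3)
    (hfb2 : B f₂ < b₀) (hfb1 : b₀ < B f₁) (n1 : ¬ adjZ2 f₁ v) (n2 : ¬ adjZ2 f₁ e₂)
    (n3 : ¬ adjZ2 f₂ u) (n4 : ¬ adjZ2 f₂ e₁) : Routed R₀ φ L (level A B) C₁ C₂ u v := by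
  have hk : 0 < k := lt_of_le_of_lt (abs_nonneg _) (hG.box _ hG.top_mem).1
  obtain ⟨a, ha0, ha1, hac⟩ : ∃ a : ℤ, 0 ≤ a ∧ a ≤ 1 ∧ (a + (b₀ - k)) % 2 = 0 :=
    ⟨(b₀ - k) % 2, by omega, by omega, by omega⟩
  obtain ⟨c, hc⟩ := htr a (b₀ - k) hac
  set K₁ : Config := {p | b₀ < B p ∧ B p ≤ L - 1 ∧ -(L - 2) ≤ A p ∧ A p ≤ L - 2} with hK1
  set K₂ : Config := {p | -(L - 1) ≤ B p ∧ B p < b₀ ∧ -(L - 2) ≤ A p ∧ A p ≤ L - 2 ∧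
    (A p < a - k ∨ a + k < A p ∨ B p < b₀ - 2 * k)} with hK2
  set g₁ : Config := {p | p - c ∈ S} with hg1
  set g₂ : Config := {p | p - c ∈ g ∧ p - c ∉ S} with hg2
  have hbox : ∀ p, p - c ∈ g → a - k < A p ∧ A p < a + k ∧ b₀ - 2 * k ≤ B p ∧ B p ≤ b₀ := by
    intro p hp
    have := hG.box _ hp
    rw [(hc p).1, (hc p).2, abs_lt, abs_le] at this
    omega
  have hbox1 : ∀ p ∈ g₁, a - k < A p ∧ A p < a + k ∧ b₀ - 2 * k < B p ∧ B p ≤ b₀ := by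
    intro p hp
    have h1 := hbox p (hG.sub hp)
    have h2 : B p ≠ b₀ - 2 * k := fun h =>
      hG.bot _ (hG.sub hp) (by rw [(hc p).2]; omega) hp
    omega
  have hbox2 : ∀ p ∈ g₂, a - k < A p ∧ A p < a + k ∧ b₀ - 2 * k ≤ B p ∧ B p < b₀ := by
    intro p hp
    have h1 := hbox p hp.1
    have h2 : B p ≠ b₀ := fun h => hp.2 (hG.top _ hp.1 (by rw [(hc p).2]; omega))
    omega
  have hballbox : ∀ y, y - c ∈ siteBall R₀ → a - k < A y ∧ A y < a + k ∧ b₀ - 2 * k < B y ∧ B y < b₀ := by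
    intro y hy
    have := hG.ball _ hy
    rw [(hc y).1, (hc y).2, abs_lt, abs_lt] at this
    omega
  have hBe1 := (hAB.adj' hef1).2
  have hBe2 := (hAB.adj' hef2).2
  have hBu : B u = B e₁ ∨ B e₁ = B u + 1 ∨ B e₁ = B u - 1 := by
    rcases hue with h | h
    · rw [h]; exact Or.inl rfl
    · exact Or.inr (hAB.adj' h).2
  have hBv : B v = B e₂ ∨ B e₂ = B v + 1 ∨ B e₂ = B v - 1 := by
    rcases hve with h | h
    · rw [h]; exact Or.inl rfl
    · exact Or.inr (hAB.adj' h).2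
  have of1 := hAB.odd f₁
  have of2 := hAB.odd f₂
  -- boundary sites: far from the gadget and from the opposite core
  have bd : ∀ p, level A B p = L → (B p ≤ b₀ - 2 * k - 2 ∨ b₀ + 2 ≤ B p ∨ A p < a - k - 1 ∨ a + k + 1 < A p) := by
    intro p hp; rw [level_eq_iff (by omega)] at hp; omega
  have bdf : ∀ p, level A B p = L - 1 → (B p ≤ b₀ - 2 * k - 2 ∨ b₀ + 2 ≤ B p ∨ A p < a - k - 1 ∨ a + k + 1 < A p) := by
    intro p hp; rw [level_eq_iff (by omega)] at hp; omega
  have hnotg : ∀ p, (B p ≤ b₀ - 2 * k - 2 ∨ b₀ + 2 ≤ B p ∨ A p < a - k - 1 ∨ a + k + 1 < A p) →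
      ∀ q, q - c ∈ g → ¬ adjZ2 p q := by
    intro p hp q hq hpq
    have h1 := hbox q hq
    have := hAB.adj' hpq
    omega
  have hnotK1 : ∀ p, level A B p = L → B p < L → ∀ q ∈ K₁, ¬ adjZ2 p q := by
    rintro p hp hp' q ⟨h1, h2, h3, h4⟩ hpq
    rw [level_eq_iff (by omega)] at hp
    have := hAB.adj' hpq
    omega
  have hnotK2 : ∀ p, level A B p = L → -L < B p → ∀ q ∈ K₂, ¬ adjZ2 p q := by
    rintro p hp hp' q ⟨h1, h2, h3, h4, -⟩ hpq
    rw [level_eq_iff (by omega)] at hp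
    have := hAB.adj' hpq
    omega
  have hBL : ∀ p, level A B p ≤ L → -L ≤ B p ∧ B p ≤ L := by
    intro p hp; rw [level_le_iff] at hp; omega
  have hgpart : ∀ p ∈ g₁, ∀ q ∈ g₂, ¬ adjZ2 p q := by
    intro p hp q hq hpq
    refine hq.2 (hG.closed _ hp _ hq.1 ?_)
    simpa [adjZ2] using hpq
  set Q₁ : Config := {u, e₁, f₁} ∪ (K₁ ∪ g₁) with hQ1
  set Q₂ : Config := {v, e₂, f₂} ∪ (K₂ ∪ g₂) with hQ2
  have memK1 : ∀ p, b₀ < B p → B p ≤ L - 1 → -(L - 2) ≤ A p → A p ≤ L - 2 → p ∈ Q₁ :=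
    fun p h1 h2 h3 h4 => Or.inr (Or.inl ⟨h1, h2, h3, h4⟩)
  refine ⟨Q₁, Q₂, c, ?_, ?_, ?_, Or.inl (by simp), Or.inl (by simp), ?_, ?_, ?_⟩
  · have hin : ∀ p, level A B p < L → level A B p ≤ L ∧ (level A B p < L ∨ p ∈ C₁) :=
      fun p h => ⟨h.le, Or.inl h⟩
    rintro p ((rfl | rfl | rfl) | ⟨h1, h2, h3, h4⟩ | hp)
    · exact ⟨hlu.le, Or.inr hu⟩
    · exact ⟨hle1.le, Or.inr he1⟩
    · exact hin _ (by omega)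
    · exact hin _ (by rw [level_lt_iff]; omega)
    · have := hbox1 p hp
      exact hin _ (by rw [level_lt_iff]; omega)
  · have hin : ∀ p, level A B p < L → level A B p ≤ L ∧ (level A B p < L ∨ p ∈ C₂) :=
      fun p h => ⟨h.le, Or.inl h⟩
    rintro p ((rfl | rfl | rfl) | ⟨h1, h2, h3, h4, -⟩ | hp)
    · exact ⟨hlv.le, Or.inr hv⟩
    · exact ⟨hle2.le, Or.inr he2⟩
    · exact hin _ (by omega)
    · exact hin _ (by rw [level_lt_iff]; omega)
    · have := hbox2 p hp
      exact hin _ (by rw [level_lt_iff]; omega)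
  · have c1 : ∀ p, p ∈ C₁ → level A B p = L → -L < B p → (¬ adjZ2 p f₂) → ∀ q ∈ Q₂, ¬ adjZ2 p q := by
      rintro p hp hl hB hf q ((rfl | rfl | rfl) | hq | hq)
      · exact (hC p hp _ hv).2
      · exact (hC p hp _ he2).2
      · exact hf
      · exact hnotK2 p hl hB q hq
      · exact hnotg p (bd p hl) q hq.1
    have c2 : ∀ q, q ∈ C₂ → level A B q = L → B q < L → (¬ adjZ2 q f₁) → ∀ p ∈ Q₁, ¬ adjZ2 q p := by
      rintro p hp hl hB hf q ((rfl | rfl | rfl) | hq | hq)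
      · exact fun h => (hC _ hu p hp).2 (adjZ2_symm h)
      · exact fun h => (hC _ he1 p hp).2 (adjZ2_symm h)
      · exact hf
      · exact hnotK1 p hl hB q hq
      · exact hnotg p (bd p hl) q (hG.sub hq)
    rintro p hp q hq hpq
    rcases hp with (rfl | rfl | rfl) | hp | hp
    · exact c1 _ hu hlu (by omega) (fun h => n3 (adjZ2_symm h)) q hq hpq
    · exact c1 _ he1 hle1 (by omega) (fun h => n4 (adjZ2_symm h)) q hq hpq
    · rcases hq with (rfl | rfl | rfl) | hq | hq
      · exact n1 hpq
      · exact n2 hpq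
      · have := (hAB.adj' hpq).2; omega
      · have h1 := hq.2.1; have := (hAB.adj' hpq).2; omega
      · exact hnotg _ (bdf _ hlf1) q hq.1 hpq
    · rcases hq with (rfl | rfl | rfl) | hq | hq
      · exact c2 _ hv hlv (by omega) (fun h => n1 (adjZ2_symm h)) p (Or.inr (Or.inl hp)) (adjZ2_symm hpq)
      · exact c2 _ he2 hle2 (by omega) (fun h => n2 (adjZ2_symm h)) p (Or.inr (Or.inl hp)) (adjZ2_symm hpq)
      · have h1 := hp.1; have := (hAB.adj' hpq).2; omega
      · have h1 := hp.1; have h2 := hq.2.1; have := (hAB.adj' hpq).2; omega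
      · have h1 := hp.1; have h2 := (hbox2 q hq).2.2.2; have := (hAB.adj' hpq).2; omega
    · rcases hq with (rfl | rfl | rfl) | hq | hq
      · exact c2 _ hv hlv (by omega) (fun h => n1 (adjZ2_symm h)) p (Or.inr (Or.inr hp)) (adjZ2_symm hpq)
      · exact c2 _ he2 hle2 (by omega) (fun h => n2 (adjZ2_symm h)) p (Or.inr (Or.inr hp)) (adjZ2_symm hpq)
      · exact hnotg _ (bdf _ hlf2) p (hG.sub hp) (adjZ2_symm hpq)
      · have h1 := hbox1 p hp
        have h2 := hAB.adj' hpq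
        have h3 := hq.2.2.2.2
        omega
      · exact hgpart p hp q hq hpq
  · intro y hy
    have := hballbox y hy
    rw [level_le_iff]; omega
  · have h1 := hc c
    have h2 := hc (t + c)
    have h3 := hc (d + c)
    rw [add_sub_cancel_right] at h2 h3
    have h0 := hG.top_eq
    have : (0 : Site) ∈ siteBall R₀ := by
      simp [siteBall, siteNorm, hφ.1]
    have := hballbox c (by simpa using this)
    rw [level_le_iff]; omega
  · set ζ := Q₁ ∪ Q₂ ∪ enhAt φ c (Q₁ ∪ Q₂) with hζ
    have hφc : enhAt φ c (Q₁ ∪ Q₂) = {p | p - c ∈ φ g} := by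
      rw [enhAt_congr hφ (ω' := {p | p - c ∈ g})]
      · ext p
        rw [mem_enhAt]
        have : shiftConfig c {p | p - c ∈ g} = g := by ext; simp [shiftConfig]
        rw [this]; rfl
      · intro y hy
        have hyb := hballbox y hy
        constructor
        · rintro (((rfl | rfl | rfl) | hp | hp) | ((rfl | rfl | rfl) | hp | hp))
          · have := bd _ hlu; omega
          · have := bd _ hle1; omega
          · have := bdf _ hlf1; omega
          · have := hp.1; omega
          · exact hG.sub hp
          · have := bd _ hlv; omega
          · have := bd _ hle2; omega
          · have := bdf _ hlf2; omega
          · have := hp.2.2.2.2; omega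
          · exact hp.1
        · intro h
          by_cases hS : y - c ∈ S
          · exact Or.inl (Or.inr (Or.inr hS))
          · exact Or.inr (Or.inr (Or.inr ⟨h, hS⟩))
    have hQ1ζ : Q₁ ⊆ ζ := fun p hp => Or.inl (Or.inl hp)
    have hQ2ζ : Q₂ ⊆ ζ := fun p hp => Or.inl (Or.inr hp)
    have mid : Reach ζ (t + c) (d + c) := by
      refine (hG.reach.shift c).mono ?_
      rintro p (hp | hp)
      · by_cases hS : p - c ∈ S
        · exact hQ1ζ (Or.inr (Or.inr hS))
        · exact hQ2ζ (Or.inr (Or.inr ⟨hp, hS⟩))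
      · right; rw [hφc]; exact hp
    have htb := hbox (t + c) (by simpa using hG.top_mem)
    have hdb := hbox (d + c) (by simpa using hG.bot_mem)
    have htB : B (t + c) = b₀ := by
      have := (hc (t + c)).2; rw [add_sub_cancel_right, hG.top_eq] at this; omega
    have hdB : B (d + c) = b₀ - 2 * k := by
      have := (hc (d + c)).2; rw [add_sub_cancel_right, hG.bot_eq] at this; omega
    obtain ⟨t', ht', ht1, ht2⟩ := hAB.exists_adj (t + c) (Or.inl rfl : (1:ℤ) = 1 ∨ _) (Or.inl rfl : (1:ℤ) = 1 ∨ _)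
    obtain ⟨d', hd', hd1, hd2⟩ := hAB.exists_adj (d + c) (Or.inl rfl : (1:ℤ) = 1 ∨ _) (Or.inr rfl : (-1:ℤ) = 1 ∨ _)
    have r1 : Reach ζ u e₁ := by
      rcases hue with h | h
      · rw [h]; exact Reach.refl (hQ1ζ (Or.inl (by simp)))
      · exact Reach.of_adj (hQ1ζ (Or.inl (by simp))) (hQ1ζ (Or.inl (by simp))) h
    have r2 : Reach ζ v e₂ := by
      rcases hve with h | h
      · rw [h]; exact Reach.refl (hQ2ζ (Or.inl (by simp)))
      · exact Reach.of_adj (hQ2ζ (Or.inl (by simp))) (hQ2ζ (Or.inl (by simp))) h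
    have hf1m : f₁ ∈ ζ := hQ1ζ (Or.inl (by simp))
    have hf2m : f₂ ∈ ζ := hQ2ζ (Or.inl (by simp))
    have r3 : Reach ζ u f₁ := r1.tail hef1 hf1m
    have r4 : Reach ζ v f₂ := r2.tail hef2 hf2m
    have top : ∀ p q, (-(L - 2) ≤ A p ∧ A p ≤ L - 2 ∧ b₀ + 1 ≤ B p ∧ B p ≤ L - 1) →
        (-(L - 2) ≤ A q ∧ A q ≤ L - 2 ∧ b₀ + 1 ≤ B q ∧ B q ≤ L - 1) → Reach ζ p q := by
      intro p q hp hq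
      exact hAB.rect_reach (by omega) (by omega)
        (fun p h1 h2 h3 h4 => hQ1ζ (memK1 p (by omega) h4 h1 h2)) hp hq
    have bot : ∀ p q, (-(L - 2) ≤ A p ∧ A p ≤ L - 2 ∧ -(L - 1) ≤ B p ∧ B p ≤ b₀ - 2 * k - 1) →
        (-(L - 2) ≤ A q ∧ A q ≤ L - 2 ∧ -(L - 1) ≤ B q ∧ B q ≤ b₀ - 2 * k - 1) → Reach ζ p q := by
      intro p q hp hq
      exact hAB.rect_reach (by omega) (by omega)
        (fun p h1 h2 h3 h4 => hQ2ζ (Or.inr (Or.inl ⟨h3, by omega, h1, h2, by omega⟩))) hp hq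
    have lft : ∀ p q, (-(L - 2) ≤ A p ∧ A p ≤ a - k - 1 ∧ -(L - 1) ≤ B p ∧ B p ≤ b₀ - 1) →
        (-(L - 2) ≤ A q ∧ A q ≤ a - k - 1 ∧ -(L - 1) ≤ B q ∧ B q ≤ b₀ - 1) → Reach ζ p q := by
      intro p q hp hq
      exact hAB.rect_reach (by omega) (by omega)
        (fun p h1 h2 h3 h4 => hQ2ζ (Or.inr (Or.inl ⟨h3, by omega, h1, by omega, by omega⟩))) hp hq
    have rgt : ∀ p q, (a + k + 1 ≤ A p ∧ A p ≤ L - 2 ∧ -(L - 1) ≤ B p ∧ B p ≤ b₀ - 1) →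
        (a + k + 1 ≤ A q ∧ A q ≤ L - 2 ∧ -(L - 1) ≤ B q ∧ B q ≤ b₀ - 1) → Reach ζ p q := by
      intro p q hp hq
      exact hAB.rect_reach (by omega) (by omega)
        (fun p h1 h2 h3 h4 => hQ2ζ (Or.inr (Or.inl ⟨h3, by omega, by omega, h2, by omega⟩))) hp hq
    rw [level_eq_iff (by omega)] at hlf1 hlf2
    clear hnotg bd bdf hnotK1 hnotK2 hBL hbox hbox1 hbox2 hballbox hBe1 hBe2 hBu hBv hφc memK1 n1 n2 n3 n4
    have r5 : Reach ζ f₁ t' := by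
      by_cases h1 : -(L - 2) ≤ A f₁ ∧ A f₁ ≤ L - 2
      · exact top _ _ (by omega) (by omega)
      · rcases lt_or_ge (A f₁) 0 with h2 | h2
        · obtain ⟨x, hx, hx1, hx2⟩ := hAB.exists_adj f₁ (Or.inl rfl : (1:ℤ) = 1 ∨ _) (Or.inl rfl : (1:ℤ) = 1 ∨ _)
          exact Reach.head hf1m hx (top _ _ (by omega) (by omega))
        · obtain ⟨x, hx, hx1, hx2⟩ := hAB.exists_adj f₁ (Or.inr rfl : (-1:ℤ) = 1 ∨ _) (Or.inl rfl : (1:ℤ) = 1 ∨ _)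
          exact Reach.head hf1m hx (top _ _ (by omega) (by omega))
    have r6 : Reach ζ f₂ d' := by
      by_cases h1 : -(L - 2) ≤ A f₂ ∧ A f₂ ≤ L - 2
      · exact bot _ _ (by omega) (by omega)
      · rcases lt_or_ge (A f₂) 0 with h2 | h2
        · obtain ⟨x, hx, hx1, hx2⟩ := hAB.exists_adj f₂ (Or.inl rfl : (1:ℤ) = 1 ∨ _) (Or.inr rfl : (-1:ℤ) = 1 ∨ _)
          obtain ⟨y, hy1, hy2⟩ := hAB.exists_fst (-(L - 2)) (-(L - 1))
          exact Reach.head hf2m hx ((lft _ y (by omega) (by omega)).trans (bot _ _ (by omega) (by omega)))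
        · obtain ⟨x, hx, hx1, hx2⟩ := hAB.exists_adj f₂ (Or.inr rfl : (-1:ℤ) = 1 ∨ _) (Or.inr rfl : (-1:ℤ) = 1 ∨ _)
          obtain ⟨y, hy1, hy2⟩ := hAB.exists_fst (L - 3) (-(L - 1))
          exact Reach.head hf2m hx ((rgt _ y (by omega) (by omega)).trans (bot _ _ (by omega) (by omega)))
    have r7 : Reach ζ u (t + c) := (r3.trans r5).tail (adjZ2_symm ht') mid.left_mem
    have r8 : Reach ζ v (d + c) := (r4.trans r6).tail (adjZ2_symm hd') mid.right_mem
    exact (r7.trans mid).trans r8.symm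

theorem routed_of_separated (hφ : IsEnhancement R₀ φ) (hAB : OddFrame A B) {g S : Config} {t d : Site}
    (hG : IsGadget R₀ φ A₀ B₀ k g S t d) (htr : IsTranslate A₀ B₀ A B) (hL : 2 * k + 10 ≤ L)
    (hC : ∀ p ∈ C₁, ∀ q ∈ C₂, p ≠ q ∧ ¬ adjZ2 p q) (hu : u ∈ C₁) (hv : v ∈ C₂)
    (hlu : level A B u = L) (hlv : level A B v = L) (hs : Separated L A B C₁ C₂ u v) :
    Routed R₀ φ L (level A B) C₁ C₂ u v := by
  obtain ⟨e₁, f₁, e₂, f₂, b₀, h1, h2, h3, h4, h5, h6, h7, h8, h9, h10, h11, h12, h13, h14, h15, h16, h17, h18⟩ := hs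
  rcases le_total 0 b₀ with hb | hb
  · exact routed_aux hφ hAB hG htr hL hC hu hv hlu hlv hb h1 h2 h3 h4 h5 h6 h7 h8 h9 h10 h12 h13 h14 h15 h16 h17 h18
  · have hC' : ∀ p ∈ C₂, ∀ q ∈ C₁, p ≠ q ∧ ¬ adjZ2 p q := fun p hp q hq =>
      ⟨(hC q hq p hp).1.symm, fun h => (hC q hq p hp).2 (adjZ2_symm h)⟩
    rw [← level_negB] at hlu hlv h5 h6 h7 h8
    exact (Routed.congr (level_negB (A := A) (B := B)) (routed_aux hφ hAB.negB hG.neg htr.negB hL hC' hv hu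
      hlv hlu (by omega : 0 ≤ -b₀)
      h2 h1 h4 h3 h6 h5 h8 h7 h10 h9 (by omega) (by omega) (by omega) h17 h18 h15 h16)).symm

end

section

variable {R₀ : ℝ} {φ : Config → Config} {A B A₀ B₀ : Site → ℤ} {L k : ℤ} {C₁ C₂ : Config} {u v : Site}

/-- Diamond-shaped distance of `p` from `x`, in rotated coordinates. -/
def boxLevel (x p : Site) : ℤ := level rotA rotB (p - x)

/-- `C` reaches `u`, a site of level `L`, from outside the box and continues past it. -/
def Enters (lev : Site → ℤ) (L : ℤ) (C : Config) (u : Site) : Prop :=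
  ∃ u' w, u' ∈ C ∧ u ∈ C ∧ w ∈ C ∧ lev u' = L + 1 ∧ lev u = L ∧ adjZ2 u' u ∧ adjZ2 u w ∧ w ≠ u'

theorem Enters.congr {lev lev' : Site → ℤ} (hl : ∀ p, lev p = lev' p) {C : Config} (h : Enters lev L C u) :
    Enters lev' L C u := by
  rwa [show lev' = lev from funext fun p => (hl p).symm]

theorem routed_of_gap (hφ : IsEnhancement R₀ φ) (hAB : OddFrame A B) {g S : Config} {t d : Site}
    (hG : IsGadget R₀ φ A₀ B₀ k g S t d) (htr : IsTranslate A₀ B₀ A B) (hk : 0 ≤ k) (hL : 2 * k + 10 ≤ L)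
    (hC : ∀ p ∈ C₁, ∀ q ∈ C₂, p ≠ q ∧ ¬ adjZ2 p q) (h1 : Enters (level A B) L C₁ u)
    (h2 : Enters (level A B) L C₂ v) (hB : B v + 2 ≤ B u ∨ B u + 2 ≤ B v) :
    Routed R₀ φ L (level A B) C₁ C₂ u v := by
  have hC' : ∀ p ∈ C₂, ∀ q ∈ C₁, p ≠ q ∧ ¬ adjZ2 p q := fun p hp q hq =>
    ⟨(hC q hq p hp).1.symm, fun h => (hC q hq p hp).2 (adjZ2_symm h)⟩
  obtain ⟨u', w, a1, a2, a3, a4, a5, a6, a7, a8⟩ := h1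
  obtain ⟨v', w', b1, b2, b3, b4, b5, b6, b7, b8⟩ := h2
  rcases hB with hB | hB
  · exact routed_of_separated hφ hAB hG htr hL hC a2 b2 a5 b5
      (exists_separated hAB (by omega) hC a1 a2 a3 a4 a5 a6 a7 a8 b1 b2 b3 b4 b5 b6 b7 b8 hB)
  · exact (routed_of_separated hφ hAB hG htr hL hC' b2 a2 b5 a5
      (exists_separated hAB (by omega) hC' b1 b2 b3 b4 b5 b6 b7 b8 a1 a2 a3 a4 a5 a6 a7 a8 hB)).symm

theorem rot_frame (x : Site) : OddFrame (fun p => rotA (p - x)) (fun p => rotB (p - x)) := by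
  simpa using OddFrame.rot.translate x 0 0 (by norm_num)
    (fun p q => by simp only [rotA, Prod.fst_sub, Prod.snd_sub]; ring)
    (fun p q => by simp only [rotB, Prod.fst_sub, Prod.snd_sub]; ring)

theorem rot_isTranslate (x : Site) :
    IsTranslate rotA rotB (fun p => rotA (p - x)) (fun p => rotB (p - x)) := by
  intro a b hab
  refine ⟨x + ((a + b) / 2, (a - b) / 2), fun p => ?_⟩
  simp only [rotA, rotB, Prod.fst_sub, Prod.snd_sub, Prod.fst_add, Prod.snd_add]
  omega

theorem rot_isTranslate_swap (x : Site) :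
    IsTranslate rotB rotA (fun p => rotB (p - x)) (fun p => rotA (p - x)) := by
  intro a b hab
  obtain ⟨c, hc⟩ := rot_isTranslate x b a (by omega)
  exact ⟨c, fun p => ⟨(hc p).2, (hc p).1⟩⟩

theorem level_finite (n : ℤ) : {p : Site | level rotA rotB p ≤ n}.Finite := by
  refine (Set.finite_Icc ((-(|n| + 1), -(|n| + 1)) : Site) (|n| + 1, |n| + 1)).subset ?_
  intro p hp
  have : max |rotA p| |rotB p| ≤ n := hp
  rw [max_le_iff, abs_le, abs_le] at this
  have hn := le_abs_self n
  simp only [rotA, rotB] at this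
  rw [mem_Icc, Prod.le_def, Prod.le_def]
  dsimp only
  omega

theorem exists_routing (hφ : IsEnhancement R₀ φ) (hess : Essential adjZ2 φ) :
    ∃ L : ℤ, 10 ≤ L ∧ ∀ (x : Site) (C₁ C₂ : Config) (u v : Site),
      (∀ p ∈ C₁, ∀ q ∈ C₂, p ≠ q ∧ ¬ adjZ2 p q) → Enters (boxLevel x) L C₁ u →
      Enters (boxLevel x) L C₂ v → Routed R₀ φ L (boxLevel x) C₁ C₂ u v := by
  have hR : 0 ≤ ⌈R₀⌉ := Int.ceil_nonneg hφ.1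
  have hball : ∀ p ∈ siteBall R₀, level rotA rotB p ≤ 2 * ⌈R₀⌉ + 1 := by
    intro p hp
    have := siteBall_bound hp
    rw [abs_le, abs_le] at this
    rw [level, max_le_iff, abs_le, abs_le]
    simp only [rotA, rotB]
    omega
  obtain ⟨k, hk, g, S, t, d, hG⟩ := exists_gadget hφ hess OddFrame.rot level_finite
    (2 * ⌈R₀⌉ + 1) (by omega) hball
  obtain ⟨k', hk', g', S', t', d', hG'⟩ := exists_gadget hφ hess OddFrame.rot.swap
    (by simpa only [level_swap (A := rotB) (B := rotA)] using level_finite) (2 * ⌈R₀⌉ + 1) (by omega)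
    (by simpa only [level_swap (A := rotB) (B := rotA)] using hball)
  refine ⟨2 * max k k' + 10, by omega, fun x C₁ C₂ u v hC h1 h2 => ?_⟩
  have hl : ∀ p, level (fun p => rotA (p - x)) (fun p => rotB (p - x)) p = boxLevel x p := fun p => rfl
  have hl' : ∀ p, level (fun p => rotB (p - x)) (fun p => rotA (p - x)) p = boxLevel x p :=
    fun p => level_swap _
  have huv : u ≠ v ∧ ¬ adjZ2 u v := by
    obtain ⟨_, _, _, hu, _⟩ := h1
    obtain ⟨_, _, _, hv, _⟩ := h2
    exact hC _ hu _ hv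
  have gap : (rotB (v - x) + 2 ≤ rotB (u - x) ∨ rotB (u - x) + 2 ≤ rotB (v - x)) ∨
      (rotA (v - x) + 2 ≤ rotA (u - x) ∨ rotA (u - x) + 2 ≤ rotA (v - x)) := by
    by_contra! hcon
    obtain ⟨hne, hadj⟩ := huv
    have hne' : ¬ (u.1 = v.1 ∧ u.2 = v.2) := fun h => hne (Prod.ext h.1 h.2)
    simp only [rotA, rotB, Prod.fst_sub, Prod.snd_sub] at hcon
    apply hadj
    rw [adjZ2]
    have : (u.1 - v.1 = 0 ∧ (u.2 - v.2 = 1 ∨ u.2 - v.2 = -1)) ∨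
      (u.2 - v.2 = 0 ∧ (u.1 - v.1 = 1 ∨ u.1 - v.1 = -1)) := by omega
    rcases this with ⟨h, h' | h'⟩ | ⟨h, h' | h'⟩ <;> rw [h, h'] <;> rfl
  rcases gap with hg | hg
  · exact (routed_of_gap hφ (rot_frame x) hG (rot_isTranslate x) (by omega) (by omega) hC h1 h2 hg).congr hl
  · exact (routed_of_gap hφ (rot_frame x).swap hG' (rot_isTranslate_swap x) (by omega) (by omega) hC
      (h1.congr fun p => (hl' p).symm) (h2.congr fun p => (hl' p).symm) hg).congr hl'

end

section

variable {R₀ : ℝ} {φ : Config → Config} {L : ℤ}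

theorem boxLevel_self (x : Site) : boxLevel x x = 1 := by
  simp [boxLevel, level, rotA, rotB]

theorem boxLevel_adj (x : Site) {p q : Site} (h : adjZ2 p q) : boxLevel x q ≤ boxLevel x p + 1 := by
  have := (rot_frame x).adj' h
  change max |rotA (q - x)| |rotB (q - x)| ≤ max |rotA (p - x)| |rotB (p - x)| + 1
  rw [max_le_iff, abs_le, abs_le]
  have h1 := le_max_left |rotA (p - x)| |rotB (p - x)|
  have h2 := le_max_right |rotA (p - x)| |rotB (p - x)|
  have h3 := neg_abs_le (rotA (p - x))
  have h4 := neg_abs_le (rotB (p - x))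
  have h5 := le_abs_self (rotA (p - x))
  have h6 := le_abs_self (rotB (p - x))
  omega

/-- A cluster visiting both the outside and the middle of a box enters the box at a site which is
not a dead end. -/
theorem exists_entry {η : Config} {x o y : Site} (ho : L < boxLevel x o) (hy : boxLevel x y < L)
    (h : Reach η o y) : ∃ u' u w, Reach (η \ {p | boxLevel x p ≤ L}) o u' ∧ u ∈ η ∧ w ∈ η ∧
      boxLevel x u' = L + 1 ∧ boxLevel x u = L ∧ adjZ2 u' u ∧ adjZ2 u w ∧ w ≠ u' := by
  by_contra! hcon
  set D : Config := {p | Reach (η \ {p | boxLevel x p ≤ L}) o p} with hD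
  have hoD : o ∈ D := Reach.refl ⟨h.left_mem, by simpa using ho⟩
  have hDlev : ∀ p ∈ D, L < boxLevel x p := fun p hp => by simpa using hp.right_mem.2
  have key : y ∈ D ∪ {u | boxLevel x u = L ∧ ∀ w ∈ η, adjZ2 u w → w ∈ D} := by
    refine Reach.mem_of_closed ?_ h (Or.inl hoD)
    rintro a (ha | ha) b hb hab
    · by_cases hbl : boxLevel x b ≤ L
      · have h1 := hDlev a ha
        have h2 := boxLevel_adj x (adjZ2_symm hab)
        have h3 := hcon a b
        refine Or.inr ⟨by omega, fun w hw hbw => ?_⟩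
        rw [h3 w ha hb hw (by omega) (by omega) hab hbw]
        exact ha
      · exact Or.inl (Reach.tail ha hab ⟨hb, hbl⟩)
    · exact Or.inl (ha.2 b hb hab)
  rcases key with hk | hk
  · have := hDlev y hk; omega
  · have := hk.1; omega

theorem Reach.exists_adj_of_insert {η : Config} {x o z : Site} (hox : o ≠ x)
    (h : Reach (insert x η) o z) (hn : ¬ Reach η o z) : ∃ y, Reach η o y ∧ adjZ2 y x := by
  by_contra! hcon
  have ho : o ∈ η := by
    rcases h.left_mem with h | h
    · exact absurd h hox
    · exact h
  refine hn (Reach.mem_of_closed (T := {p | Reach η o p}) ?_ h (Reach.refl ho))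
  rintro a ha b (rfl | hb) hab
  · exact absurd hab (hcon a ha)
  · exact Reach.tail ha hab hb

/-- Rearranging a configuration in a box around a pivotal site, so that activation of the
enhancement at some `c` becomes pivotal. -/
theorem exists_surgery (hφ : IsEnhancement R₀ φ) (hess : Essential adjZ2 φ) :
    ∃ L : ℤ, 10 ≤ L ∧ ∀ (η : Config) (x o : Site) (G : Config),
      L < boxLevel x o → (∀ g ∈ G, L < boxLevel x g) → (∃ z ∈ G, Reach (insert x η) o z) →
      (∀ g ∈ G, ¬ Reach η o g) →
      ∃ (η' : Config) (c : Site), (∀ p, L < boxLevel x p → (p ∈ η' ↔ p ∈ η)) ∧ boxLevel x c ≤ L ∧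
        (∀ y, y - c ∈ siteBall R₀ → boxLevel x y ≤ L) ∧ (∀ g ∈ G, ¬ Reach η' o g) ∧
        ∃ z ∈ G, Reach (η' ∪ enhAt φ c η') o z := by
  obtain ⟨L, hL, H⟩ := exists_routing hφ hess
  refine ⟨L, hL, ?_⟩
  rintro η x o G ho hG ⟨z, hz, hoz⟩ hno
  have hxs := boxLevel_self x
  have hnz := hno z hz
  obtain ⟨y₁, hy₁, hyx₁⟩ := hoz.exists_adj_of_insert (fun h => by rw [h] at ho; omega) hnz
  obtain ⟨y₂, hy₂, hyx₂⟩ := hoz.symm.exists_adj_of_insert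
    (fun h => by have := hG z hz; rw [h] at this; omega) (fun h => hnz h.symm)
  have l1 := boxLevel_adj x (adjZ2_symm hyx₁)
  have l2 := boxLevel_adj x (adjZ2_symm hyx₂)
  obtain ⟨u', u, w, a1, a2, a3, a4, a5, a6, a7, a8⟩ := exists_entry ho (by omega) hy₁
  obtain ⟨v', v, w', b1, b2, b3, b4, b5, b6, b7, b8⟩ := exists_entry (hG z hz) (by omega) hy₂
  have a1' : Reach η o u' := a1.mono sdiff_subset
  have b1' : Reach η z v' := b1.mono sdiff_subset
  set C₁ : Config := {p | Reach η o p} with hC1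
  set C₂ : Config := {p | Reach η z p} with hC2
  have hC : ∀ p ∈ C₁, ∀ q ∈ C₂, p ≠ q ∧ ¬ adjZ2 p q := by
    intro p hp q hq
    constructor
    · rintro rfl; exact hnz (Reach.trans hp (Reach.symm hq))
    · intro hpq
      exact hnz (Reach.trans (Reach.tail hp hpq (Reach.right_mem hq)) (Reach.symm hq))
  obtain ⟨Q₁, Q₂, c, h1, h2, h3, h4, h5, h6, h7, h8⟩ := H x C₁ C₂ u v hC
    ⟨u', w, a1', a1'.tail a6 a2, (a1'.tail a6 a2).tail a7 a3, a4, a5, a6, a7, a8⟩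
    ⟨v', w', b1', b1'.tail b6 b2, (b1'.tail b6 b2).tail b7 b3, b4, b5, b6, b7, b8⟩
  set Bx : Config := {p | boxLevel x p ≤ L} with hBx
  have hin : ∀ p, boxLevel x p ≤ L → (p ∈ Q₁ ∪ Q₂ ↔ p ∈ (η \ Bx) ∪ (Q₁ ∪ Q₂)) := by
    intro p hp
    exact ⟨Or.inr, fun h => h.resolve_left fun h => h.2 hp⟩
  refine ⟨(η \ Bx) ∪ (Q₁ ∪ Q₂), c, ?_, h7, h6, ?_, z, hz, ?_⟩
  · intro p hp
    constructor
    · rintro (h | h | h)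
      · exact h.1
      · have := (h1 p h).1; omega
      · have := (h2 p h).1; omega
    · intro h
      exact Or.inl ⟨h, fun h' : boxLevel x p ≤ L => by omega⟩
  · intro g hg hr
    have hgl := hG g hg
    have : g ∈ (C₁ \ Bx) ∪ Q₁ := by
      refine Reach.mem_of_closed ?_ hr (Or.inl ⟨Reach.refl hy₁.left_mem, fun h : boxLevel x o ≤ L => by omega⟩)
      rintro a (ha | ha) b (hb | hb | hb) hab
      · exact Or.inl ⟨Reach.tail ha.1 hab hb.1, hb.2⟩
      · exact Or.inr hb
      · have e1 : ¬ boxLevel x a ≤ L := ha.2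
        have e2 := boxLevel_adj x (adjZ2_symm hab)
        exact absurd hab (hC a ha.1 b ((h2 b hb).2.resolve_left (by omega))).2
      · have e1 : ¬ boxLevel x b ≤ L := hb.2
        have e2 := boxLevel_adj x hab
        exact Or.inl ⟨Reach.tail ((h1 a ha).2.resolve_left (by omega)) hab hb.1, hb.2⟩
      · exact Or.inr hb
      · exact absurd hab (h3 a ha b hb)
    rcases this with h | h
    · exact hno g hg h.1
    · have := (h1 g h).1; omega
  · rw [← enhAt_congr hφ (fun y hy => hin y (h6 y hy))]
    have r := h8.mono (ω' := (η \ Bx) ∪ (Q₁ ∪ Q₂) ∪ enhAt φ c (Q₁ ∪ Q₂)) (by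
      rintro p (hp | hp)
      · exact Or.inl (Or.inr hp)
      · exact Or.inr hp)
    have ra := a1.mono (ω' := (η \ Bx) ∪ (Q₁ ∪ Q₂) ∪ enhAt φ c (Q₁ ∪ Q₂)) fun p hp => Or.inl (Or.inl hp)
    have rb := b1.mono (ω' := (η \ Bx) ∪ (Q₁ ∪ Q₂) ∪ enhAt φ c (Q₁ ∪ Q₂)) fun p hp => Or.inl (Or.inl hp)
    exact ((ra.tail a6 r.left_mem).trans r).trans (rb.tail b6 r.right_mem).symm

end

section

variable {R₀ : ℝ} {φ : Config → Config} {L : ℤ}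

/-- Coordinates of the finite-volume model: `(x, 0)` is the state of the site `x`, `(x, 1)` its
activation and `(x, 2)` its ghost mark. -/
abbrev Idx : Type := Site × Fin 3

/-- The open sites of a state. -/
def openSites (S : Finset Idx) : Config := {x | (x, 0) ∈ S}

/-- The enhanced configuration of a state. -/
def enhSites (φ : Config → Config) (S : Finset Idx) : Config :=
  openSites S ∪ {y | ∃ x, (x, 1) ∈ S ∧ y ∈ enhAt φ x (openSites S)}

/-- The ghost-marked sites of a state. -/
def ghosts (S : Finset Idx) : Config := {x | (x, 2) ∈ S}

/-- The origin is connected to a ghost mark in the enhanced configuration. -/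
def HitsGhost (φ : Config → Config) (S : Finset Idx) : Prop :=
  ∃ z ∈ ghosts S, Reach (enhSites φ S) 0 z

theorem HitsGhost.mono {S T : Finset Idx} (h0 : openSites S = openSites T) (hST : S ⊆ T)
    (h : HitsGhost φ S) : HitsGhost φ T := by
  obtain ⟨z, hz, hr⟩ := h
  refine ⟨z, hST hz, hr.mono ?_⟩
  rintro p (hp | ⟨a, ha, hp⟩)
  · exact Or.inl (h0 ▸ hp)
  · exact Or.inr ⟨a, hST ha, h0 ▸ hp⟩

theorem exists_erase_step {ι : Type*} [DecidableEq ι] (P : Finset ι → Prop) (J T : Finset ι) (h : P T)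
    (h' : ¬ P (T \ J)) : ∃ j ∈ J, ∃ T' ⊆ T, T \ J ⊆ T' ∧ j ∈ T' ∧ P T' ∧ ¬ P (T'.erase j) := by
  induction J using Finset.induction_on generalizing T with
  | empty => simp [h] at h'
  | insert a J ha ih =>
    by_cases h1 : P (T.erase a)
    · obtain ⟨j, hj, T', h2, h3, h4⟩ := ih (T.erase a) h1 (by
        rwa [Finset.erase_sdiff_comm, ← Finset.sdiff_insert])
      exact ⟨j, Finset.mem_insert_of_mem hj, T', h2.trans (Finset.erase_subset _ _), by
        rwa [Finset.erase_sdiff_comm, ← Finset.sdiff_insert] at h3, h4⟩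
    · refine ⟨a, Finset.mem_insert_self _ _, T, subset_rfl, Finset.sdiff_subset, ?_, h, h1⟩
      by_contra hT
      rw [Finset.erase_eq_of_notMem hT] at h1
      exact h1 h

/-- `N` contains every site whose activation can influence the box of level `L` around `x`. -/
def Shields (R₀ : ℝ) (L : ℤ) (x : Site) (N : Finset Site) : Prop :=
  ∀ a, a ∉ N → ∀ y, y - a ∈ siteBall R₀ → L < boxLevel x y

theorem zero_mem_siteBall (h : 0 ≤ R₀) : (0 : Site) ∈ siteBall R₀ := by
  simpa [siteBall, siteNorm] using h

/-- If the state of `x` is pivotal for hitting a ghost, a local change of the state makes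
an activation or a ghost mark near `x` pivotal. -/
theorem exists_local_pivotal (hφ : IsEnhancement R₀ φ) (hess : Essential adjZ2 φ) :
    ∃ L : ℤ, 10 ≤ L ∧ ∀ (x : Site) (N : Finset Site), Shields R₀ L x N → (0 : Site) ∉ N →
      ∀ S : Finset Idx, HitsGhost φ (insert (x, 0) S) → ¬ HitsGhost φ (S.erase (x, 0)) →
      ∃ j : Idx, j.1 ∈ N ∧ j.2 ≠ 0 ∧ ∃ S' : Finset Idx, (∀ i : Idx, i.1 ∉ N → (i ∈ S' ↔ i ∈ S)) ∧
        HitsGhost φ (insert j S') ∧ ¬ HitsGhost φ (S'.erase j) ∧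
        (∀ z, (z, 2) ∈ S' → (z, 2) ∈ S) ∧ (j.2 = 2 → j ∈ S ∧ j ∉ S') := by
  classical
  obtain ⟨L, hL, H⟩ := exists_surgery hφ hess
  refine ⟨L, hL, fun x N hN h0N S hS hS' => ?_⟩
  have hxN : ∀ a, boxLevel x a ≤ L → a ∈ N := by
    intro a ha
    by_contra hcon
    have := hN a hcon a (by simpa using zero_mem_siteBall hφ.1)
    omega
  have hx : x ∈ N := hxN x (by rw [boxLevel_self]; omega)
  set J : Finset Idx := N ×ˢ {1, 2} with hJ
  have memJ : ∀ i : Idx, i ∈ J ↔ i.1 ∈ N ∧ i.2 ≠ 0 := by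
    rintro ⟨a, b⟩
    rw [hJ, Finset.mem_product]
    fin_cases b <;> simp
  by_cases hoff : HitsGhost φ (insert (x, 0) S \ J)
  swap
  · obtain ⟨j, hj, T, hT1, hT2, hjT, hT3, hT4⟩ := exists_erase_step _ _ _ hS hoff
    have hj' := (memJ j).1 hj
    refine ⟨j, hj'.1, hj'.2, T.erase j, ?_, ?_, ?_, ?_, ?_⟩
    · intro i hi
      have hij : i ≠ j := fun h => hi (h ▸ hj'.1)
      have hix : i ≠ (x, 0) := fun h => hi (h ▸ hx)
      have hiJ : i ∉ J := fun h => hi ((memJ i).1 h).1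
      rw [Finset.mem_erase]
      constructor
      · exact fun h => (Finset.mem_insert.1 (hT1 h.2)).resolve_left hix
      · exact fun h => ⟨hij, hT2 (Finset.mem_sdiff.2 ⟨Finset.mem_insert_of_mem h, hiJ⟩)⟩
    · rwa [Finset.insert_erase hjT]
    · simpa using hT4
    · intro z hz
      exact (Finset.mem_insert.1 (hT1 (Finset.mem_of_mem_erase hz))).resolve_left (by simp)
    · intro h2
      refine ⟨(Finset.mem_insert.1 (hT1 hjT)).resolve_left ?_, by simp⟩
      rintro rfl
      simp at h2
  · set S₀ : Finset Idx := S.erase (x, 0) \ J with hS0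
    have hoff' : ¬ HitsGhost φ S₀ := fun h => hS' (h.mono (by
      ext p
      simp [openSites, memJ]) Finset.sdiff_subset)
    have mem0 : ∀ i : Idx, i ∈ S₀ ↔ i ∈ S ∧ i ≠ (x, 0) ∧ (i.1 ∈ N → i.2 = 0) := by
      intro i
      rw [hS0, Finset.mem_sdiff, Finset.mem_erase, memJ]
      tauto
    have hins : insert (x, 0) S \ J = insert (x, 0) S₀ := by
      ext i
      rw [Finset.mem_sdiff, Finset.mem_insert, Finset.mem_insert, mem0, memJ]
      by_cases hi : i = (x, 0)
      · simp [hi]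
      · tauto
    rw [hins] at hoff
    have hact : ∀ a, (a, 1) ∈ S₀ → a ∉ N := by
      intro a ha haN
      have := ((mem0 _).1 ha).2.2 haN
      simp at this
    have hgh : ∀ a, (a, 2) ∈ S₀ → a ∉ N := by
      intro a ha haN
      have := ((mem0 _).1 ha).2.2 haN
      simp at this
    have hlev : ∀ a, a ∉ N → L < boxLevel x a := fun a ha => by
      by_contra h
      exact ha (hxN a (by omega))
    set η := enhSites φ S₀ with hη
    have hη1 : enhSites φ (insert (x, 0) S₀) ⊆ insert x η := by
      rintro p (hp | ⟨a, ha, hp⟩)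
      · rcases Finset.mem_insert.1 hp with h | h
        · left; exact congrArg Prod.fst h
        · exact Or.inr (Or.inl h)
      · have ha' : (a, 1) ∈ S₀ := (Finset.mem_insert.1 ha).resolve_left (by simp)
        refine Or.inr (Or.inr ⟨a, ha', ?_⟩)
        rwa [enhAt_congr hφ (ω' := openSites (insert (x, 0) S₀))]
        intro y hy
        have := hN a (hact a ha') y hy
        have hyx : y ≠ x := by
          rintro rfl
          rw [boxLevel_self] at this; omega
        simp [openSites, hyx]
    obtain ⟨z, hz, hrz⟩ := hoff
    obtain ⟨η', c, h1, h2, h3, h4, z', hz', h5⟩ := H η x 0 (ghosts S₀) (hlev _ h0N)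
      (fun g hg => hlev g (hgh g hg))
      ⟨z, (Finset.mem_insert.1 hz).resolve_left (by simp), hrz.mono hη1⟩
      (fun g hg hr => hoff' ⟨g, hg, hr⟩)
    set S' : Finset Idx := S₀.filter (fun i => ¬ (i.2 = 0 ∧ boxLevel x i.1 ≤ L)) ∪
      (N.filter fun p => boxLevel x p ≤ L ∧ p ∈ η').image fun p => (p, 0) with hS'def
    have mem' : ∀ i : Idx, i ∈ S' ↔ (i ∈ S₀ ∧ ¬ (i.2 = 0 ∧ boxLevel x i.1 ≤ L)) ∨
        (i.2 = 0 ∧ boxLevel x i.1 ≤ L ∧ i.1 ∈ η') := by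
      rintro ⟨a, b⟩
      rw [hS'def, Finset.mem_union, Finset.mem_filter, Finset.mem_image]
      refine or_congr Iff.rfl ⟨?_, ?_⟩
      · rintro ⟨p, hp, heq⟩
        rw [Finset.mem_filter] at hp
        rw [Prod.mk.injEq] at heq
        obtain ⟨rfl, rfl⟩ := heq
        exact ⟨rfl, hp.2⟩
      · rintro ⟨rfl, h, h'⟩
        exact ⟨a, Finset.mem_filter.2 ⟨hxN a h, h, h'⟩, rfl⟩
    have act' : ∀ a, (a, 1) ∈ S' ↔ (a, 1) ∈ S₀ := fun a => by rw [mem']; simp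
    have gh' : ∀ a, (a, 2) ∈ S' ↔ (a, 2) ∈ S₀ := fun a => by rw [mem']; simp
    have open_out : ∀ y, L < boxLevel x y → (y ∈ openSites S' ↔ y ∈ openSites S₀) := by
      intro y hy
      have : ¬ boxLevel x y ≤ L := by omega
      change (y, 0) ∈ S' ↔ _
      rw [mem']
      simp [this, openSites]
    have open_in : ∀ y, boxLevel x y ≤ L → (y ∈ openSites S' ↔ y ∈ η') := by
      intro y hy
      change (y, 0) ∈ S' ↔ _
      rw [mem']
      simp [hy]
    have henh : ∀ a, a ∉ N → enhAt φ a (openSites S') = enhAt φ a (openSites S₀) := fun a ha =>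
      enhAt_congr hφ fun y hy => open_out y (hN a ha y hy)
    have hout : ∀ a, a ∉ N → ∀ p ω, p ∈ enhAt φ a ω → L < boxLevel x p := fun a ha p ω hp =>
      hN a ha p (sub_mem_ball_of_mem_enhAt hφ hp)
    have hS'η : enhSites φ S' = η' := by
      ext p
      by_cases hp : boxLevel x p ≤ L
      · rw [← open_in p hp]
        refine ⟨fun h => h.resolve_right ?_, Or.inl⟩
        rintro ⟨a, ha, hpa⟩
        have := hout a (hact a ((act' a).1 ha)) p _ hpa
        omega
      · rw [h1 p (by omega)]
        refine or_congr (open_out p (by omega)) (exists_congr fun a => ?_)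
        rw [act']
        refine and_congr_right fun ha => ?_
        rw [henh a (hact a ha)]
    have hcN : c ∈ N := hxN c h2
    have hcS : (c, 1) ∉ S' := fun h => hact c ((act' c).1 h) hcN
    refine ⟨(c, 1), hcN, by simp, S', ?_, ?_, ?_, ?_, by simp⟩
    · intro i hi
      have hl := hlev _ hi
      have hl' : ¬ boxLevel x i.1 ≤ L := by omega
      have hix : i ≠ (x, 0) := fun h => hi (h ▸ hx)
      rw [mem', mem0]
      simp [hl', hi, hix]
    · refine ⟨z', Finset.mem_insert_of_mem ((gh' z').2 hz'), h5.mono ?_⟩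
      have ho : openSites (insert (c, 1) S') = openSites S' := by
        ext p; simp [openSites]
      rintro p (hp | hp)
      · rw [← hS'η] at hp
        rcases hp with hp | ⟨a, ha, hp⟩
        · exact Or.inl (ho ▸ hp)
        · exact Or.inr ⟨a, Finset.mem_insert_of_mem ha, ho ▸ hp⟩
      · refine Or.inr ⟨c, Finset.mem_insert_self _ _, ?_⟩
        rw [ho, enhAt_congr hφ (ω' := η') fun y hy => open_in y (h3 y hy)]
        exact hp
    · rw [Finset.erase_eq_of_notMem hcS]
      rintro ⟨g, hg, hr⟩
      rw [hS'η] at hr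
      exact h4 g ((gh' g).1 hg) hr
    · exact fun z hz => ((mem0 _).1 ((gh' z).1 hz)).1

end

section

variable {ι : Type*} [DecidableEq ι]

/-- The real-valued truth value of a proposition. -/
noncomputable def ind (Q : Prop) : ℝ := open Classical in if Q then 1 else 0

theorem ind_nonneg (Q : Prop) : 0 ≤ ind Q := by
  unfold ind; split <;> norm_num

theorem ind_of_true {Q : Prop} (h : Q) : ind Q = 1 := by simp [ind, h]

theorem ind_of_false {Q : Prop} (h : ¬ Q) : ind Q = 0 := by simp [ind, h]

/-- The weight of the state `S` on the coordinates `V` under independent densities `q`. -/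
noncomputable def weight (V : Finset ι) (q : ι → ℝ) (S : Finset ι) : ℝ :=
  ∏ i ∈ V, if i ∈ S then q i else 1 - q i

/-- The probability of `Q` for independent coordinates in `V` of densities `q`. -/
noncomputable def prodProb (V : Finset ι) (q : ι → ℝ) (Q : Finset ι → Prop) : ℝ :=
  ∑ S ∈ V.powerset, weight V q S * ind (Q S)

/-- The signed influence of the coordinate `i`. -/
noncomputable def influence (V : Finset ι) (q : ι → ℝ) (Q : Finset ι → Prop) (i : ι) : ℝ :=
  ∑ S ∈ (V.erase i).powerset, weight (V.erase i) q S * (ind (Q (insert i S)) - ind (Q S))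

/-- `i` is positively pivotal for `Q` in the state `S`. -/
def Pivotal (Q : Finset ι → Prop) (i : ι) (S : Finset ι) : Prop := Q (insert i S) ∧ ¬ Q (S.erase i)

theorem weight_nonneg {V : Finset ι} {q : ι → ℝ} (hq : ∀ i ∈ V, 0 ≤ q i ∧ q i ≤ 1) (S : Finset ι) :
    0 ≤ weight V q S := by
  refine Finset.prod_nonneg fun i hi => ?_
  have := hq i hi
  split <;> linarith

theorem weight_congr {V : Finset ι} {q q' : ι → ℝ} {S S' : Finset ι} (hq : ∀ i ∈ V, q i = q' i)
    (hS : ∀ i ∈ V, i ∈ S ↔ i ∈ S') : weight V q S = weight V q' S' := by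
  refine Finset.prod_congr rfl fun i hi => ?_
  simp only [hq i hi, hS i hi]

theorem weight_union {A B : Finset ι} (hAB : Disjoint A B) (q : ι → ℝ) {S T : Finset ι} (hS : S ⊆ A)
    (hT : T ⊆ B) : weight (A ∪ B) q (S ∪ T) = weight A q S * weight B q T := by
  rw [weight, Finset.prod_union hAB]
  congr 1
  · refine Finset.prod_congr rfl fun i hi => ?_
    have : i ∉ T := fun h => Finset.disjoint_left.1 hAB hi (hT h)
    simp [this]
  · refine Finset.prod_congr rfl fun i hi => ?_
    have : i ∉ S := fun h => Finset.disjoint_left.1 hAB (hS h) hi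
    simp [this]

theorem sum_powerset_union {A B : Finset ι} (hAB : Disjoint A B) (f : Finset ι → ℝ) :
    ∑ S ∈ (A ∪ B).powerset, f S = ∑ S ∈ A.powerset, ∑ T ∈ B.powerset, f (S ∪ T) := by
  rw [← Finset.sum_product']
  refine Finset.sum_nbij' (fun S => (S ∩ A, S ∩ B)) (fun p => p.1 ∪ p.2) ?_ ?_ ?_ ?_ ?_
  · intro S _
    simp
  · intro p hp
    simp only [Finset.mem_product, Finset.mem_powerset] at hp ⊢
    exact Finset.union_subset_union hp.1 hp.2
  · intro S hS
    rw [Finset.mem_powerset] at hS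
    dsimp only
    rw [← Finset.inter_union_distrib_left, Finset.inter_eq_left.2 hS]
  · rintro ⟨S, T⟩ hp
    simp only [Finset.mem_product, Finset.mem_powerset] at hp
    have h1 : T ∩ A = ∅ := Finset.disjoint_iff_inter_eq_empty.1 (hAB.symm.mono_left hp.2)
    have h2 : S ∩ B = ∅ := Finset.disjoint_iff_inter_eq_empty.1 (hAB.mono_left hp.1)
    simp [Finset.union_inter_distrib_right, h1, h2, hp.1, hp.2]
  · intro S hS
    rw [Finset.mem_powerset] at hS
    dsimp only
    rw [← Finset.inter_union_distrib_left, Finset.inter_eq_left.2 hS]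

theorem sum_weight (V : Finset ι) (q : ι → ℝ) : ∑ S ∈ V.powerset, weight V q S = 1 := by
  induction V using Finset.induction_on with
  | empty => simp [weight]
  | insert a V ha ih =>
    have hd : Disjoint V {a} := by simpa using ha
    rw [Finset.insert_eq, Finset.union_comm, sum_powerset_union hd]
    have : ∀ S ∈ V.powerset, ∑ T ∈ ({a} : Finset ι).powerset, weight (V ∪ {a}) q (S ∪ T) = weight V q S := by
      intro S hS
      rw [Finset.sum_congr rfl fun T hT =>
        weight_union hd q (Finset.mem_powerset.1 hS) (Finset.mem_powerset.1 hT), ← Finset.mul_sum]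
      have : ({a} : Finset ι).powerset = {∅, {a}} := rfl
      simp [this, weight]
    rw [Finset.sum_congr rfl this, ih]

theorem sum_powerset_split {V : Finset ι} {i : ι} (hi : i ∈ V) (f : Finset ι → ℝ) :
    ∑ S ∈ V.powerset, f S = ∑ S ∈ (V.erase i).powerset, (f S + f (insert i S)) := by
  conv_lhs => rw [← Finset.insert_erase hi, Finset.sum_powerset_insert (Finset.notMem_erase i V)]
  rw [Finset.sum_add_distrib]

theorem weight_of_notMem {V : Finset ι} {i : ι} (hi : i ∈ V) (q : ι → ℝ) {S : Finset ι}
    (hS : S ⊆ V.erase i) : weight V q S = (1 - q i) * weight (V.erase i) q S := by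
  have : i ∉ S := fun h => Finset.notMem_erase i V (hS h)
  rw [weight, ← Finset.mul_prod_erase _ _ hi]
  simp [this, weight]

theorem weight_insert {V : Finset ι} {i : ι} (hi : i ∈ V) (q : ι → ℝ) (S : Finset ι) :
    weight V q (insert i S) = q i * weight (V.erase i) q S := by
  rw [weight, ← Finset.mul_prod_erase _ _ hi]
  simp only [Finset.mem_insert_self, if_true]
  congr 1
  exact weight_congr (fun _ _ => rfl) fun j hj => by simp [Finset.ne_of_mem_erase hj]

theorem hasDerivAt_weight (V : Finset ι) {q : ℝ → ι → ℝ} {q' : ι → ℝ} {t : ℝ}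
    (hq : ∀ i ∈ V, HasDerivAt (fun t => q t i) (q' i) t) (S : Finset ι) :
    HasDerivAt (fun t => weight V (q t) S)
      (∑ i ∈ V, q' i * (weight (V.erase i) (q t) S * if i ∈ S then 1 else -1)) t := by
  have h : ∀ i ∈ V, HasDerivAt (fun t => if i ∈ S then q t i else 1 - q t i)
      (if i ∈ S then q' i else - q' i) t := by
    intro i hi
    by_cases h : i ∈ S
    · simpa [h] using hq i hi
    · simpa [h] using (hq i hi).const_sub 1
  have := HasDerivAt.fun_finsetProd h
  simp only [smul_eq_mul] at this
  have heq : (∑ i ∈ V, q' i * (weight (V.erase i) (q t) S * if i ∈ S then 1 else -1)) =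
      ∑ i ∈ V, (∏ j ∈ V.erase i, if j ∈ S then q t j else 1 - q t j) *
        (if i ∈ S then q' i else - q' i) := by
    refine Finset.sum_congr rfl fun i hi => ?_
    rw [weight]
    split <;> ring
  rw [heq]
  exact this

/-- Russo's formula. -/
theorem hasDerivAt_prodProb (V : Finset ι) {q : ℝ → ι → ℝ} {q' : ι → ℝ} {t : ℝ}
    (hq : ∀ i ∈ V, HasDerivAt (fun t => q t i) (q' i) t) (Q : Finset ι → Prop) :
    HasDerivAt (fun t => prodProb V (q t) Q) (∑ i ∈ V, q' i * influence V (q t) Q i) t := by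
  unfold prodProb
  have := HasDerivAt.fun_sum (u := V.powerset)
    fun S _ => (hasDerivAt_weight V hq S).mul_const (ind (Q S))
  suffices heq : ∑ i ∈ V, q' i * influence V (q t) Q i = ∑ S ∈ V.powerset,
      (∑ i ∈ V, q' i * (weight (V.erase i) (q t) S * if i ∈ S then 1 else -1)) * ind (Q S) by
    rw [heq]; exact this
  simp only [Finset.sum_mul]
  rw [Finset.sum_comm]
  refine Finset.sum_congr rfl fun i hi => ?_
  rw [sum_powerset_split hi, influence, Finset.mul_sum]
  refine Finset.sum_congr rfl fun S hS => ?_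
  have hiS : i ∉ S := fun h => Finset.notMem_erase i V (Finset.mem_powerset.1 hS h)
  have : weight (V.erase i) (q t) (insert i S) = weight (V.erase i) (q t) S :=
    weight_congr (fun _ _ => rfl) fun j hj => by simp [Finset.ne_of_mem_erase hj]
  rw [this]
  simp only [hiS, if_false, Finset.mem_insert_self, if_true]
  ring

theorem prodProb_nonneg {V : Finset ι} {q : ι → ℝ} (hq : ∀ i ∈ V, 0 ≤ q i ∧ q i ≤ 1)
    (Q : Finset ι → Prop) : 0 ≤ prodProb V q Q :=
  Finset.sum_nonneg fun S _ => mul_nonneg (weight_nonneg hq S) (ind_nonneg _)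

theorem prodProb_mono {V : Finset ι} {q : ι → ℝ} (hq : ∀ i ∈ V, 0 ≤ q i ∧ q i ≤ 1)
    {Q Q' : Finset ι → Prop} (h : ∀ S ⊆ V, Q S → Q' S) : prodProb V q Q ≤ prodProb V q Q' := by
  refine Finset.sum_le_sum fun S hS => mul_le_mul_of_nonneg_left ?_ (weight_nonneg hq S)
  by_cases hQ : Q S
  · rw [ind_of_true hQ, ind_of_true (h S (Finset.mem_powerset.1 hS) hQ)]
  · rw [ind_of_false hQ]; exact ind_nonneg _

theorem prodProb_pivotal {V : Finset ι} {i : ι} (hi : i ∈ V) (q : ι → ℝ) (Q : Finset ι → Prop) :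
    prodProb V q (Pivotal Q i) =
      ∑ S ∈ (V.erase i).powerset, weight (V.erase i) q S * ind (Q (insert i S) ∧ ¬ Q S) := by
  rw [prodProb, sum_powerset_split hi]
  refine Finset.sum_congr rfl fun S hS => ?_
  rw [Finset.mem_powerset] at hS
  have hiS : i ∉ S := fun h => Finset.notMem_erase i V (hS h)
  have h1 : Pivotal Q i S ↔ (Q (insert i S) ∧ ¬ Q S) := by
    rw [Pivotal, Finset.erase_eq_of_notMem hiS]
  have h2 : Pivotal Q i (insert i S) ↔ (Q (insert i S) ∧ ¬ Q S) := by
    rw [Pivotal, Finset.erase_insert hiS, Finset.insert_idem]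
  rw [h1, h2, weight_of_notMem hi q hS, weight_insert hi]
  ring

theorem influence_le_pivotal {V : Finset ι} {q : ι → ℝ} (hq : ∀ i ∈ V, 0 ≤ q i ∧ q i ≤ 1) {i : ι}
    (hi : i ∈ V) (Q : Finset ι → Prop) : influence V q Q i ≤ prodProb V q (Pivotal Q i) := by
  rw [prodProb_pivotal hi]
  refine Finset.sum_le_sum fun S _ => mul_le_mul_of_nonneg_left ?_
    (weight_nonneg (fun j hj => hq j (Finset.mem_of_mem_erase hj)) S)
  by_cases h1 : Q (insert i S) <;> by_cases h2 : Q S <;> simp [ind, h1, h2]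

theorem influence_eq_pivotal {V : Finset ι} {q : ι → ℝ} {i : ι}
    (hi : i ∈ V) {Q : Finset ι → Prop} (hQ : ∀ S, Q S → Q (insert i S)) :
    influence V q Q i = prodProb V q (Pivotal Q i) := by
  rw [prodProb_pivotal hi]
  refine Finset.sum_congr rfl fun S _ => ?_
  congr 1
  have := hQ S
  by_cases h1 : Q (insert i S) <;> by_cases h2 : Q S <;> simp_all [ind]

theorem mul_influence_le {V : Finset ι} {q : ι → ℝ} (hq : ∀ i ∈ V, 0 ≤ q i ∧ q i ≤ 1) {i : ι}
    (hi : i ∈ V) (Q : Finset ι → Prop) : q i * influence V q Q i ≤ prodProb V q Q := by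
  rw [prodProb, sum_powerset_split hi, influence, Finset.mul_sum]
  refine Finset.sum_le_sum fun S hS => ?_
  have hw := weight_nonneg (fun j hj => hq j (Finset.mem_of_mem_erase hj)) S (V := V.erase i)
  rw [weight_of_notMem hi q (Finset.mem_powerset.1 hS), weight_insert hi]
  have h1 := mul_nonneg hw (ind_nonneg (Q S))
  nlinarith

/-- Comparison of two events through local modifications of the state inside `W`. -/
theorem prodProb_le_of_local {V W : Finset ι} (hWV : W ⊆ V) {q : ι → ℝ}
    (hq : ∀ i ∈ V, 0 ≤ q i ∧ q i ≤ 1) {Q : Finset ι → Prop} {J : Finset ι} {c : ι → ℝ}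
    (hc : ∀ j ∈ J, 0 ≤ c j) {Q' : ι → Finset ι → Prop} {K : ℝ} (hK : 0 ≤ K)
    (h : ∀ S ⊆ V, Q S → ∃ j ∈ J, ∃ S', S' \ W = S \ W ∧ Q' j S' ∧
      weight W q (S ∩ W) ≤ K * c j * weight W q (S' ∩ W)) :
    prodProb V q Q ≤ 2 ^ W.card * K * ∑ j ∈ J, c j * prodProb V q (Q' j) := by
  have hd : Disjoint (V \ W) W := Finset.sdiff_disjoint
  have hV : (V \ W) ∪ W = V := Finset.sdiff_union_of_subset hWV
  have hqW : ∀ i ∈ W, 0 ≤ q i ∧ q i ≤ 1 := fun i hi => hq i (hWV hi)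
  have hqV : ∀ i ∈ V \ W, 0 ≤ q i ∧ q i ≤ 1 := fun i hi => hq i (Finset.mem_sdiff.1 hi).1
  have expand : ∀ Q : Finset ι → Prop, prodProb V q Q = ∑ S ∈ (V \ W).powerset, weight (V \ W) q S *
      ∑ T ∈ W.powerset, weight W q T * ind (Q (S ∪ T)) := by
    intro Q
    rw [prodProb]
    conv_lhs => rw [← hV, sum_powerset_union hd]
    refine Finset.sum_congr rfl fun S hS => ?_
    rw [Finset.mul_sum]
    refine Finset.sum_congr rfl fun T hT => ?_
    rw [weight_union hd q (Finset.mem_powerset.1 hS) (Finset.mem_powerset.1 hT), mul_assoc]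
  rw [expand]
  have rhs : 2 ^ W.card * K * ∑ j ∈ J, c j * prodProb V q (Q' j) =
      ∑ S ∈ (V \ W).powerset, weight (V \ W) q S * (2 ^ W.card * (K * ∑ j ∈ J, c j *
        ∑ T ∈ W.powerset, weight W q T * ind (Q' j (S ∪ T)))) := by
    simp only [expand, Finset.mul_sum]
    conv_rhs => rw [Finset.sum_comm]
    refine Finset.sum_congr rfl fun j _ => Finset.sum_congr rfl fun S _ =>
      Finset.sum_congr rfl fun T _ => by ring
  rw [rhs]
  refine Finset.sum_le_sum fun S hS => mul_le_mul_of_nonneg_left ?_ (weight_nonneg hqV S)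
  rw [Finset.mem_powerset] at hS
  have inner_nonneg : ∀ j ∈ J, 0 ≤ c j * ∑ T ∈ W.powerset, weight W q T * ind (Q' j (S ∪ T)) :=
    fun j hj => mul_nonneg (hc j hj) (Finset.sum_nonneg fun T _ =>
      mul_nonneg (weight_nonneg hqW T) (ind_nonneg _))
  refine (Finset.sum_le_card_nsmul _ _ (K * ∑ j ∈ J, c j * ∑ T ∈ W.powerset,
    weight W q T * ind (Q' j (S ∪ T))) fun T hT => ?_).trans_eq
    (by rw [Finset.card_powerset, nsmul_eq_mul]; push_cast; rfl)
  rw [Finset.mem_powerset] at hT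
  by_cases hQ : Q (S ∪ T)
  · have hSW : S ∩ W = ∅ := Finset.disjoint_iff_inter_eq_empty.1 (hd.mono_left hS)
    have hSW' : S \ W = S := Finset.sdiff_eq_self_of_disjoint (hd.mono_left hS)
    obtain ⟨j, hj, S', h1, h2, h3⟩ := h (S ∪ T)
      (Finset.union_subset (hS.trans Finset.sdiff_subset) (hT.trans hWV)) hQ
    rw [Finset.union_inter_distrib_right, hSW, Finset.empty_union, Finset.inter_eq_left.2 hT] at h3
    rw [Finset.union_sdiff_distrib, hSW', Finset.sdiff_eq_empty_iff_subset.2 hT, Finset.union_empty] at h1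
    have h4 : S ∪ S' ∩ W = S' := by rw [← h1, Finset.sdiff_union_inter]
    rw [ind_of_true hQ, mul_one]
    refine h3.trans ?_
    rw [mul_assoc]
    refine mul_le_mul_of_nonneg_left (le_trans ?_ (Finset.single_le_sum inner_nonneg hj)) hK
    refine mul_le_mul_of_nonneg_left ?_ (hc j hj)
    refine le_trans ?_ (Finset.single_le_sum (f := fun T => weight W q T * ind (Q' j (S ∪ T)))
      (fun T _ => mul_nonneg (weight_nonneg hqW T) (ind_nonneg _))
      (Finset.mem_powerset.2 (Finset.inter_subset_right : S' ∩ W ⊆ W)))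
    rw [h4, ind_of_true h2, mul_one]
  · rw [ind_of_false hQ, mul_zero]
    exact mul_nonneg hK (Finset.sum_nonneg inner_nonneg)

end

section

variable {R₀ : ℝ} {φ : Config → Config}

/-- The square of side `2 * r + 1` centred at `x`. -/
noncomputable def nbr (r : ℕ) (x : Site) : Finset Site := Finset.Icc (x.1 - r, x.2 - r) (x.1 + r, x.2 + r)

theorem mem_nbr {r : ℕ} {x a : Site} :
    a ∈ nbr r x ↔ (x.1 - r ≤ a.1 ∧ a.1 ≤ x.1 + r) ∧ (x.2 - r ≤ a.2 ∧ a.2 ≤ x.2 + r) := by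
  rw [nbr, Finset.mem_Icc, Prod.le_def, Prod.le_def]
  dsimp only
  tauto

theorem mem_nbr_comm {r : ℕ} {x a : Site} : a ∈ nbr r x ↔ x ∈ nbr r a := by
  rw [mem_nbr, mem_nbr]; omega

theorem card_nbr (r : ℕ) (x : Site) : (nbr r x).card = (2 * r + 1) ^ 2 := by
  have h1 : (x.1 + r + 1 - (x.1 - r)).toNat = 2 * r + 1 := by omega
  have h2 : (x.2 + r + 1 - (x.2 - r)).toNat = 2 * r + 1 := by omega
  rw [nbr, ← Finset.Icc_product_Icc, Finset.card_product, Int.card_Icc, Int.card_Icc, h1, h2, sq]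

/-- All coordinates attached to a finite set of sites. -/
noncomputable def coords (Λ : Finset Site) : Finset Idx := Λ ×ˢ Finset.univ

theorem mem_coords {Λ : Finset Site} {i : Idx} : i ∈ coords Λ ↔ i.1 ∈ Λ := by
  simp [coords]

theorem shields_nbr (L : ℤ) (x : Site) : Shields R₀ L x (nbr (L + 1 + ⌈R₀⌉).toNat x) := by
  intro a ha y hy
  by_contra hcon
  have h1 : max |rotA (y - x)| |rotB (y - x)| ≤ L := not_lt.1 hcon
  have h2 := siteBall_bound hy
  rw [abs_le, abs_le] at h2
  rw [max_le_iff, abs_le, abs_le] at h1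
  apply ha
  rw [mem_nbr]
  simp only [rotA, rotB, Prod.fst_sub, Prod.snd_sub] at h1 h2
  omega

theorem weight_le_weight {W : Finset Idx} {q : Idx → ℝ} {κ h : ℝ} (hκ : 0 < κ) (hκ1 : κ ≤ 1) (h0 : 0 ≤ h)
    (h1 : h ≤ 1 / 2) (hq1 : ∀ i : Idx, i.2 ≠ 2 → κ ≤ q i ∧ q i ≤ 1 - κ)
    (hq2 : ∀ i : Idx, i.2 = 2 → q i = h) {S S' : Finset Idx} {j : Idx} (hjW : j ∈ W)
    (hg : ∀ z, (z, 2) ∈ S' → (z, 2) ∈ S) (hj : j.2 = 2 → j ∈ S ∧ j ∉ S') :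
    weight W q S ≤ κ⁻¹ ^ W.card * (if j.2 = 2 then 2 * h else 1) * weight W q S' := by
  have hκi : 1 ≤ κ⁻¹ := (one_le_inv₀ hκ).2 hκ1
  have amplify : ∀ {a : ℝ} (b : ℝ), 0 ≤ b → a ≤ b → a ≤ κ⁻¹ * b := fun b hb hab =>
    hab.trans (le_mul_of_one_le_left hb hκi)
  have hq : ∀ i : Idx, 0 ≤ q i ∧ q i ≤ 1 := by
    intro i
    by_cases hi : i.2 = 2
    · rw [hq2 i hi]; constructor <;> linarith
    · have := hq1 i hi; constructor <;> linarith
  have e2 : κ⁻¹ ^ W.card * (if j.2 = 2 then 2 * h else 1) * weight W q S' =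
      ∏ i ∈ W, κ⁻¹ * (if i = j then (if j.2 = 2 then 2 * h else 1) else 1) * if i ∈ S' then q i else 1 - q i := by
    rw [Finset.prod_mul_distrib, Finset.prod_mul_distrib, Finset.prod_const,
      Finset.prod_ite_eq' W j (fun _ => (if j.2 = 2 then 2 * h else 1 : ℝ)), if_pos hjW]
    rfl
  rw [e2]
  refine Finset.prod_le_prod (fun i _ => ?_) fun i _ => ?_
  · have := hq i; split <;> linarith
  · by_cases hi : i.2 = 2
    · rw [hq2 i hi]
      have hS'S : i ∈ S' → i ∈ S := by
        have := hg i.1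
        rwa [← hi] at this
      by_cases hi' : i ∈ S'
      · have hij : i ≠ j := by
          rintro rfl; exact (hj hi).2 hi'
        rw [if_pos hi', if_pos (hS'S hi'), if_neg hij, mul_one]
        exact amplify h h0 le_rfl
      · by_cases hiS : i ∈ S
        · rw [if_pos hiS, if_neg hi']
          by_cases hij : i = j
          · have : (if j.2 = 2 then 2 * h else 1 : ℝ) = 2 * h := by rw [← hij, if_pos hi]
            rw [if_pos hij, this, mul_assoc]
            have e7 : h ≤ 2 * h * (1 - h) := by nlinarith
            exact amplify _ (h0.trans e7) e7
          · rw [if_neg hij, mul_one]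
            exact amplify _ (by linarith) (by linarith)
        · have hij : i ≠ j := by
            rintro rfl; exact hiS (hj hi).1
          rw [if_neg hi', if_neg hiS, if_neg hij, mul_one]
          exact amplify _ (by linarith) le_rfl
    · have e3 := hq1 i hi
      have e4 : (if i = j then (if j.2 = 2 then 2 * h else 1) else 1 : ℝ) = 1 := by
        by_cases hij : i = j
        · rw [if_pos hij, ← hij, if_neg hi]
        · rw [if_neg hij]
      rw [e4, mul_one]
      have e5 : κ ≤ if i ∈ S' then q i else 1 - q i := by split <;> linarith
      have e6 : (if i ∈ S then q i else 1 - q i) ≤ 1 := by split <;> linarith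
      refine e6.trans ?_
      rw [← div_eq_inv_mul, one_le_div hκ]
      exact e5

theorem exists_influence_bound (hφ : IsEnhancement R₀ φ) (hess : Essential adjZ2 φ) :
    ∃ r : ℕ, ∀ κ : ℝ, 0 < κ → κ ≤ 1 → ∃ K : ℝ, 0 ≤ K ∧ ∀ (Λ : Finset Site) (q : Idx → ℝ) (h : ℝ),
      0 ≤ h → h ≤ 1 / 2 → (∀ i : Idx, i.2 ≠ 2 → κ ≤ q i ∧ q i ≤ 1 - κ) →
      (∀ i : Idx, i.2 = 2 → q i = h) → ∀ x : Site, nbr r x ⊆ Λ → (0 : Site) ∉ nbr r x →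
      influence (coords Λ) q (HitsGhost φ) (x, 0) ≤
        K * ∑ a ∈ nbr r x, (prodProb (coords Λ) q (Pivotal (HitsGhost φ) (a, 1)) +
          h * prodProb (coords Λ) q (Pivotal (HitsGhost φ) (a, 2))) := by
  obtain ⟨L, hL, H⟩ := exists_local_pivotal hφ hess
  refine ⟨(L + 1 + ⌈R₀⌉).toNat, fun κ hκ hκ1 => ?_⟩
  set r := (L + 1 + ⌈R₀⌉).toNat with hr
  set m := (2 * r + 1) ^ 2 * 3 with hm
  refine ⟨2 ^ m * κ⁻¹ ^ m * 2, by positivity, fun Λ q h h0 h1 hq1 hq2 x hxΛ hx0 => ?_⟩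
  have hq : ∀ i : Idx, 0 ≤ q i ∧ q i ≤ 1 := by
    intro i
    by_cases hi : i.2 = 2
    · rw [hq2 i hi]; constructor <;> linarith
    · have := hq1 i hi; constructor <;> linarith
  set W := coords (nbr r x) with hW
  have hWcard : W.card = m := by
    rw [hW, coords, Finset.card_product, card_nbr]; simp [hm]
  have hxx : x ∈ nbr r x := by rw [mem_nbr]; omega
  have hWV : W ⊆ coords Λ := fun i hi => mem_coords.2 (hxΛ (mem_coords.1 hi))
  set c : Idx → ℝ := fun j => if j.2 = 2 then 2 * h else 1 with hc
  have hc0 : ∀ j, 0 ≤ c j := by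
    intro j; simp only [hc]; split <;> linarith
  have main := prodProb_le_of_local hWV (q := q) (fun i _ => hq i) (Q := Pivotal (HitsGhost φ) (x, 0))
    (J := nbr r x ×ˢ {1, 2}) (c := c) (fun j _ => hc0 j)
    (Q' := fun j => Pivotal (HitsGhost φ) j) (K := κ⁻¹ ^ m) (by positivity) (by
      rintro S - ⟨hS1, hS2⟩
      obtain ⟨j, hj1, hj2, S', k1, k2, k3, k4, k5⟩ := H x (nbr r x) (shields_nbr L x) hx0 S hS1 hS2
      refine ⟨j, ?_, S', ?_, ⟨k2, k3⟩, ?_⟩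
      · obtain ⟨a, b⟩ := j
        rw [Finset.mem_product]
        refine ⟨hj1, ?_⟩
        fin_cases b <;> simp_all
      · ext i
        rw [Finset.mem_sdiff, Finset.mem_sdiff, hW, mem_coords]
        have := k1 i
        tauto
      · have hjW : j ∈ W := mem_coords.2 hj1
        have e1 : ∀ T : Finset Idx, weight W q (T ∩ W) = weight W q T := fun T =>
          weight_congr (fun _ _ => rfl) fun i hi => by simp [hi]
        rw [e1, e1]
        rw [← hWcard]
        exact weight_le_weight hκ hκ1 h0 h1 hq1 hq2 hjW k4 k5)
  rw [hWcard] at main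
  refine (influence_le_pivotal (fun i _ => hq i) (mem_coords.2 (hxΛ hxx)) _).trans (main.trans ?_)
  rw [mul_assoc _ (2 : ℝ)]
  refine mul_le_mul_of_nonneg_left ?_ (by positivity)
  rw [Finset.sum_product, Finset.mul_sum]
  refine Finset.sum_le_sum fun a _ => ?_
  rw [Finset.sum_pair (by decide)]
  have p1 := prodProb_nonneg (V := coords Λ) (fun i _ => hq i) (Pivotal (HitsGhost φ) (a, 1))
  have p2 := prodProb_nonneg (V := coords Λ) (fun i _ => hq i) (Pivotal (HitsGhost φ) (a, 2))
  have c1 : c (a, 1) = 1 := if_neg (by decide : ¬ (1 : Fin 3) = 2)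
  have c2 : c (a, 2) = 2 * h := if_pos rfl
  rw [c1, c2]
  linarith

end

section

variable {R₀ : ℝ} {φ : Config → Config}

/-- Densities of the three kinds of coordinates. -/
noncomputable def dens (p : Site → ℝ) (s h : ℝ) (i : Idx) : ℝ :=
  if i.2 = 0 then p i.1 else if i.2 = 1 then s else h

@[simp] theorem dens_zero (p : Site → ℝ) (s h : ℝ) (x : Site) : dens p s h (x, 0) = p x := rfl

@[simp] theorem dens_one (p : Site → ℝ) (s h : ℝ) (x : Site) : dens p s h (x, 1) = s := rfl

@[simp] theorem dens_two (p : Site → ℝ) (s h : ℝ) (x : Site) : dens p s h (x, 2) = h := rfl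

theorem forall_idx {Q : Idx → Prop} : (∀ i, Q i) ↔ ∀ x, Q (x, 0) ∧ Q (x, 1) ∧ Q (x, 2) := by
  constructor
  · exact fun h x => ⟨h _, h _, h _⟩
  · rintro h ⟨x, b⟩
    obtain ⟨h0, h1, h2⟩ := h x
    fin_cases b
    · exact h0
    · exact h1
    · exact h2

theorem sum_coords (Λ : Finset Site) (f : Idx → ℝ) :
    ∑ i ∈ coords Λ, f i = ∑ a ∈ Λ, (f (a, 0) + f (a, 1) + f (a, 2)) := by
  rw [coords, Finset.sum_product]
  refine Finset.sum_congr rfl fun a _ => ?_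
  rw [Fin.sum_univ_three]

theorem hitsGhost_insert {S : Finset Idx} {i : Idx} (hi : i.2 ≠ 0) (h : HitsGhost φ S) :
    HitsGhost φ (insert i S) := by
  refine h.mono ?_ (Finset.subset_insert _ _)
  ext p
  have : (p, 0) ≠ i := by rintro rfl; exact hi rfl
  simp [openSites, this]

/-- The density `p`, raised by `t` in the square of radius `M`. -/
noncomputable def ramp (M : ℕ) (p t : ℝ) (x : Site) : ℝ := if x ∈ nbr M 0 then p + t else p

/-- Total influence of the activations and ghost marks. -/
noncomputable def auxInfluence (φ : Config → Config) (Λ : Finset Site) (q : Idx → ℝ) (h : ℝ) : ℝ :=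
  ∑ a ∈ Λ, (prodProb (coords Λ) q (Pivotal (HitsGhost φ) (a, 1)) +
    h * prodProb (coords Λ) q (Pivotal (HitsGhost φ) (a, 2)))

theorem nbr_subset {M r : ℕ} {x : Site} (hx : x ∈ nbr M 0) : nbr r x ⊆ nbr (M + r) 0 := by
  intro a ha
  rw [mem_nbr] at *
  simp only [Prod.fst_zero, Prod.snd_zero] at *
  push_cast
  omega

theorem sum_influence_le {r M : ℕ} {κ K h : ℝ} {q : Idx → ℝ} (hκ : 0 < κ) (hK : 0 ≤ K) (h0 : 0 ≤ h)
    (hq : ∀ i, 0 ≤ q i ∧ q i ≤ 1) (hq0 : ∀ x, κ ≤ q (x, 0))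
    (H : ∀ x : Site, nbr r x ⊆ nbr (M + r) 0 → (0 : Site) ∉ nbr r x →
      influence (coords (nbr (M + r) 0)) q (HitsGhost φ) (x, 0) ≤
        K * ∑ a ∈ nbr r x, (prodProb (coords (nbr (M + r) 0)) q (Pivotal (HitsGhost φ) (a, 1)) +
          h * prodProb (coords (nbr (M + r) 0)) q (Pivotal (HitsGhost φ) (a, 2)))) :
    ∑ x ∈ nbr M 0, influence (coords (nbr (M + r) 0)) q (HitsGhost φ) (x, 0) ≤
      (2 * r + 1) ^ 2 * (κ⁻¹ * prodProb (coords (nbr (M + r) 0)) q (HitsGhost φ)) +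
        (2 * r + 1) ^ 2 * K * auxInfluence φ (nbr (M + r) 0) q h := by
  set Λ := nbr (M + r) 0 with hΛ
  set F := prodProb (coords Λ) q (HitsGhost φ) with hF
  set T : Site → ℝ := fun a => prodProb (coords Λ) q (Pivotal (HitsGhost φ) (a, 1)) +
    h * prodProb (coords Λ) q (Pivotal (HitsGhost φ) (a, 2)) with hT
  have hF0 : 0 ≤ F := prodProb_nonneg (fun i _ => hq i) _
  have hT0 : ∀ a, 0 ≤ T a := fun a => add_nonneg (prodProb_nonneg (fun i _ => hq i) _)
    (mul_nonneg h0 (prodProb_nonneg (fun i _ => hq i) _))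
  have hsub : nbr M 0 ⊆ Λ := fun x hx => nbr_subset (r := r) hx (by rw [mem_nbr]; omega)
  have step : ∀ x ∈ nbr M 0, influence (coords Λ) q (HitsGhost φ) (x, 0) ≤
      (if x ∈ nbr r 0 then κ⁻¹ * F else 0) + K * ∑ a ∈ Λ, if x ∈ nbr r a then T a else 0 := by
    intro x hx
    have e0 : 0 ≤ K * ∑ a ∈ Λ, if x ∈ nbr r a then T a else 0 :=
      mul_nonneg hK (Finset.sum_nonneg fun a _ => by split; exacts [hT0 a, le_rfl])
    by_cases hx0 : x ∈ nbr r 0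
    · rw [if_pos hx0]
      have e1 := mul_influence_le (fun i _ => hq i) (mem_coords.2 (hsub hx) : (x, 0) ∈ coords Λ)
        (HitsGhost φ)
      have e2 : influence (coords Λ) q (HitsGhost φ) (x, 0) ≤ κ⁻¹ * F := by
        rw [← div_eq_inv_mul, le_div_iff₀ hκ]
        by_cases hneg : influence (coords Λ) q (HitsGhost φ) (x, 0) ≤ 0
        · exact le_trans (mul_nonpos_of_nonpos_of_nonneg hneg hκ.le) hF0
        · rw [mul_comm]
          exact (mul_le_mul_of_nonneg_right (hq0 x) (not_le.1 hneg).le).trans e1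
      linarith
    · rw [if_neg hx0, zero_add]
      have hs := nbr_subset (r := r) hx
      refine (H x hs (fun h => hx0 (mem_nbr_comm.1 h))).trans (mul_le_mul_of_nonneg_left ?_ hK)
      rw [← Finset.sum_filter]
      refine Finset.sum_le_sum_of_subset_of_nonneg (fun a ha => ?_) fun a _ _ => hT0 a
      rw [Finset.mem_filter]
      exact ⟨hs ha, mem_nbr_comm.1 ha⟩
  refine (Finset.sum_le_sum step).trans ?_
  have hcard : ∀ y : Site, (((nbr M 0).filter (· ∈ nbr r y)).card : ℝ) ≤ (2 * r + 1) ^ 2 := by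
    intro y
    have : ((nbr M 0).filter (· ∈ nbr r y)).card ≤ (nbr r y).card :=
      Finset.card_le_card fun a ha => (Finset.mem_filter.1 ha).2
    rw [card_nbr] at this
    exact_mod_cast this
  rw [Finset.sum_add_distrib, ← Finset.mul_sum, Finset.sum_comm, ← Finset.sum_filter,
    Finset.sum_const, nsmul_eq_mul]
  refine add_le_add (mul_le_mul_of_nonneg_right (hcard 0) (by positivity)) ?_
  rw [mul_comm _ K, mul_assoc]
  refine mul_le_mul_of_nonneg_left ?_ hK
  rw [auxInfluence, Finset.mul_sum]
  refine Finset.sum_le_sum fun a _ => ?_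
  rw [← Finset.sum_filter, Finset.sum_const, nsmul_eq_mul]
  exact mul_le_mul_of_nonneg_right (hcard a) (hT0 a)

theorem le_exp_mul_of_deriv_le {F F' : ℝ → ℝ} {C δ : ℝ} (hδ : 0 ≤ δ)
    (hF : ∀ t, HasDerivAt F (F' t) t) (h : ∀ t ∈ Icc 0 δ, F' t ≤ C * F t) :
    F δ ≤ Real.exp (C * δ) * F 0 := by
  have hd : ∀ t, HasDerivAt (fun t => Real.exp (-(C * t)) * F t)
      (Real.exp (-(C * t)) * (-C) * F t + Real.exp (-(C * t)) * F' t) t := fun t =>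
    HasDerivAt.mul (by simpa using ((hasDerivAt_id t).const_mul C).neg.exp) (hF t)
  have hanti : AntitoneOn (fun t => Real.exp (-(C * t)) * F t) (Icc 0 δ) := by
    refine antitoneOn_of_deriv_nonpos (convex_Icc 0 δ)
      (fun t _ => (hd t).continuousAt.continuousWithinAt)
      (fun t _ => (hd t).differentiableAt.differentiableWithinAt) fun t ht => ?_
    rw [(hd t).deriv]
    have h1 := h t (interior_subset ht)
    have h2 := Real.exp_pos (-(C * t))
    nlinarith
  have := hanti (left_mem_Icc.2 hδ) (right_mem_Icc.2 hδ) hδ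
  simp only [mul_zero, neg_zero, Real.exp_zero, one_mul] at this
  have h3 := mul_le_mul_of_nonneg_left this (Real.exp_pos (C * δ)).le
  rwa [← mul_assoc, ← Real.exp_add, add_neg_cancel, Real.exp_zero, one_mul] at h3

set_option maxHeartbeats 1600000 in
/-- Along a curve trading activations and ghost marks for open sites, the probability of hitting
a ghost mark grows at most exponentially, uniformly in the volume. -/
theorem exists_flow_bound (hφ : IsEnhancement R₀ φ) (hess : Essential adjZ2 φ) :
    ∃ r : ℕ, ∀ κ : ℝ, 0 < κ → κ ≤ 1 → ∃ C : ℝ, 0 ≤ C ∧ ∀ (M : ℕ) (p s h δ : ℝ), 0 ≤ δ → κ ≤ p →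
      p + δ ≤ 1 - κ → κ ≤ s - C * δ → s ≤ 1 - κ → 0 ≤ h → h ≤ 1 / 2 →
      prodProb (coords (nbr (M + r) 0)) (dens (ramp M p δ) (s - C * δ) (h * Real.exp (-(C * δ))))
        (HitsGhost φ) ≤
      Real.exp (C * δ) * prodProb (coords (nbr (M + r) 0)) (dens (fun _ => p) s h) (HitsGhost φ) := by
  obtain ⟨r, hr⟩ := exists_influence_bound hφ hess
  refine ⟨r, fun κ hκ hκ1 => ?_⟩
  obtain ⟨K, hK, H⟩ := hr κ hκ hκ1
  set n : ℝ := (2 * r + 1) ^ 2 with hn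
  refine ⟨n * κ⁻¹ + n * K, by positivity, fun M p s h δ hδ hp1 hp2 hs1 hs2 h0 h1 => ?_⟩
  set C := n * κ⁻¹ + n * K with hC
  have hC0 : 0 ≤ C := by positivity
  set Λ := nbr (M + r) 0 with hΛ
  set q : ℝ → Idx → ℝ := fun t => dens (ramp M p t) (s - C * t) (h * Real.exp (-(C * t))) with hq
  set q' : ℝ → Idx → ℝ := fun t =>
    dens (fun x => if x ∈ nbr M 0 then 1 else 0) (-C) (-(C * (h * Real.exp (-(C * t))))) with hq'
  have hder : ∀ t, HasDerivAt (fun t => prodProb (coords Λ) (q t) (HitsGhost φ))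
      (∑ i ∈ coords Λ, q' t i * influence (coords Λ) (q t) (HitsGhost φ) i) t := by
    intro t
    suffices hq1 : ∀ i, HasDerivAt (fun t => q t i) (q' t i) t from
      hasDerivAt_prodProb _ (fun i _ => hq1 i) _
    rw [forall_idx]
    intro x
    refine ⟨?_, ?_, ?_⟩
    · simp only [hq, hq', dens_zero, ramp]
      by_cases hx : x ∈ nbr M 0
      · simpa [hx] using (hasDerivAt_id t).const_add p
      · simpa [hx] using hasDerivAt_const t p
    · simpa [hq, hq'] using ((hasDerivAt_id t).const_mul C).const_sub s
    · have : HasDerivAt (fun t => h * Real.exp (-(C * t))) (h * (Real.exp (-(C * t)) * -C)) t := by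
        simpa using (((hasDerivAt_id t).const_mul C).neg.exp).const_mul h
      simp only [hq, hq', dens_two]
      convert this using 1
      ring
  have key := le_exp_mul_of_deriv_le (C := C) hδ hder (by
    rintro t ⟨ht0, ht1⟩
    set ht := h * Real.exp (-(C * t)) with hht
    have hexp : Real.exp (-(C * t)) ≤ 1 := Real.exp_le_one_iff.2 (by
      have := mul_nonneg hC0 ht0; linarith)
    have hh0 : 0 ≤ ht := mul_nonneg h0 (Real.exp_pos _).le
    have hh1 : ht ≤ 1 / 2 := (mul_le_of_le_one_right h0 hexp).trans h1
    have hCt : C * t ≤ C * δ := mul_le_mul_of_nonneg_left ht1 hC0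
    have hCt0 : 0 ≤ C * t := mul_nonneg hC0 ht0
    have qb : ∀ i : Idx, i.2 ≠ 2 → κ ≤ q t i ∧ q t i ≤ 1 - κ := by
      rw [forall_idx]
      refine fun x => ⟨fun _ => ?_, fun _ => ?_, fun h => absurd rfl h⟩
      · simp only [hq, dens_zero, ramp]
        split <;> constructor <;> linarith
      · simp only [hq, dens_one]
        constructor <;> linarith
    have q2 : ∀ i : Idx, i.2 = 2 → q t i = ht := by
      rintro ⟨x, b⟩ hb
      dsimp only at hb
      rw [hb]; rfl
    have qq : ∀ i : Idx, 0 ≤ q t i ∧ q t i ≤ 1 := by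
      intro i
      by_cases hi : i.2 = 2
      · rw [q2 i hi]; constructor <;> linarith
      · have := qb i hi; constructor <;> linarith
    have b1 := sum_influence_le (φ := φ) (M := M) (r := r) hκ hK hh0 qq
      (fun x => (qb (x, 0) (by simp)).1)
      (fun x hx hx0 => H Λ (q t) ht hh0 hh1 qb q2 x hx hx0)
    have hsub : nbr M 0 ⊆ Λ := fun x hx => nbr_subset (r := r) hx (by rw [mem_nbr]; omega)
    have b2 : ∑ i ∈ coords Λ, q' t i * influence (coords Λ) (q t) (HitsGhost φ) i =
        (∑ x ∈ nbr M 0, influence (coords Λ) (q t) (HitsGhost φ) (x, 0)) -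
          C * auxInfluence φ Λ (q t) ht := by
      rw [sum_coords, auxInfluence, Finset.mul_sum, ← Finset.inter_eq_right.2 hsub,
        ← Finset.sum_ite_mem, ← Finset.sum_sub_distrib]
      refine Finset.sum_congr rfl fun a ha => ?_
      rw [influence_eq_pivotal (i := (a, 1)) (mem_coords.2 ha)
        (fun S hS => hitsGhost_insert (by simp) hS),
        influence_eq_pivotal (i := (a, 2)) (mem_coords.2 ha)
        (fun S hS => hitsGhost_insert (by simp) hS)]
      simp only [hq', dens_zero, dens_one, dens_two]
      split <;> ring
    have aux0 : 0 ≤ auxInfluence φ Λ (q t) ht := Finset.sum_nonneg fun a _ =>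
      add_nonneg (prodProb_nonneg (fun i _ => qq i) _)
        (mul_nonneg hh0 (prodProb_nonneg (fun i _ => qq i) _))
    have F0 := prodProb_nonneg (V := coords Λ) (fun i _ => qq i) (HitsGhost φ)
    rw [b2]
    have e1 : C * auxInfluence φ Λ (q t) ht = n * κ⁻¹ * auxInfluence φ Λ (q t) ht +
        n * K * auxInfluence φ Λ (q t) ht := by rw [hC]; ring
    have e2 : C * prodProb (coords Λ) (q t) (HitsGhost φ) =
        n * (κ⁻¹ * prodProb (coords Λ) (q t) (HitsGhost φ)) +
        n * K * prodProb (coords Λ) (q t) (HitsGhost φ) := by rw [hC]; ring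
    have e3 : 0 ≤ n * κ⁻¹ * auxInfluence φ Λ (q t) ht :=
      mul_nonneg (by positivity) aux0
    have e4 : 0 ≤ n * K * prodProb (coords Λ) (q t) (HitsGhost φ) :=
      mul_nonneg (by positivity) F0
    linarith)
  have hq0 : q 0 = dens (fun _ => p) s h := by
    funext i
    revert i
    rw [forall_idx]
    intro x
    simp [hq, ramp]
  rw [hq0] at key
  exact key

/-- Monotonicity in the activation density. -/
theorem prodProb_mono_activation (Λ : Finset Site) {p s s' h : ℝ} (hp : 0 ≤ p ∧ p ≤ 1) (hs : 0 ≤ s)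
    (hss' : s ≤ s') (hs' : s' ≤ 1) (hh : 0 ≤ h ∧ h ≤ 1) :
    prodProb (coords Λ) (dens (fun _ => p) s h) (HitsGhost φ) ≤
      prodProb (coords Λ) (dens (fun _ => p) s' h) (HitsGhost φ) := by
  have hder : ∀ t, HasDerivAt (fun t => prodProb (coords Λ) (dens (fun _ => p) t h) (HitsGhost φ))
      (∑ i ∈ coords Λ, dens (fun _ => 0) 1 0 i *
        influence (coords Λ) (dens (fun _ => p) t h) (HitsGhost φ) i) t := by
    intro t
    suffices hq1 : ∀ i, HasDerivAt (fun t => dens (fun _ => p) t h i) (dens (fun _ => 0) 1 0 i) t from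
      hasDerivAt_prodProb _ (fun i _ => hq1 i) _
    rw [forall_idx]
    exact fun x => ⟨hasDerivAt_const _ _, hasDerivAt_id _, hasDerivAt_const _ _⟩
  have hmono : MonotoneOn (fun t => prodProb (coords Λ) (dens (fun _ => p) t h) (HitsGhost φ))
      (Icc s s') := by
    refine monotoneOn_of_deriv_nonneg (convex_Icc s s')
      (fun t _ => (hder t).continuousAt.continuousWithinAt)
      (fun t _ => (hder t).differentiableAt.differentiableWithinAt) fun t ht => ?_
    have ht' := interior_subset ht
    rw [(hder t).deriv, sum_coords]
    refine Finset.sum_nonneg fun a ha => ?_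
    rw [influence_eq_pivotal (i := (a, 1)) (mem_coords.2 ha)
        (fun S hS => hitsGhost_insert (by simp) hS)]
    simp only [dens_zero, dens_one, dens_two, zero_mul, zero_add, add_zero, one_mul]
    suffices hq1 : ∀ i, 0 ≤ dens (fun _ => p) t h i ∧ dens (fun _ => p) t h i ≤ 1 from
      prodProb_nonneg (fun i _ => hq1 i) _
    rw [forall_idx]
    exact fun x => ⟨hp, ⟨hs.trans ht'.1, ht'.2.trans hs'⟩, hh⟩
  exact hmono (left_mem_Icc.2 hss') (right_mem_Icc.2 hss') hss'

end

section

variable {R₀ : ℝ} {φ : Config → Config}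

theorem prodProb_of_subset {ι : Type*} [DecidableEq ι] {U V : Finset ι} (hUV : U ⊆ V) (q : ι → ℝ)
    {Q : Finset ι → Prop} (hQ : ∀ S, Q S ↔ Q (S ∩ U)) : prodProb V q Q = prodProb U q Q := by
  have hd : Disjoint U (V \ U) := Finset.disjoint_sdiff
  rw [prodProb, ← Finset.union_sdiff_of_subset hUV, sum_powerset_union hd, prodProb]
  refine Finset.sum_congr rfl fun S hS => ?_
  rw [Finset.mem_powerset] at hS
  have : ∀ T ∈ (V \ U).powerset, weight (U ∪ V \ U) q (S ∪ T) * ind (Q (S ∪ T)) =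
      weight U q S * ind (Q S) * weight (V \ U) q T := by
    intro T hT
    rw [Finset.mem_powerset] at hT
    have h1 : (S ∪ T) ∩ U = S := by
      rw [Finset.union_inter_distrib_right, Finset.inter_eq_left.2 hS,
        Finset.disjoint_iff_inter_eq_empty.1 (hd.symm.mono_left hT), Finset.union_empty]
    rw [weight_union hd q hS hT, hQ, h1]
    ring
  rw [Finset.sum_congr rfl this, ← Finset.mul_sum, sum_weight, mul_one]

theorem prodProb_congr_dens {ι : Type*} [DecidableEq ι] {V : Finset ι} {q q' : ι → ℝ}
    (hq : ∀ i ∈ V, q i = q' i) (Q : Finset ι → Prop) : prodProb V q Q = prodProb V q' Q := by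
  refine Finset.sum_congr rfl fun S _ => ?_
  rw [weight_congr hq fun _ _ => Iff.rfl]

theorem measurableSet_cylinder (F : Finset Site) (b : Site → Bool) : MeasurableSet (cylinder F b) := by
  have : cylinder F b = ⋂ x ∈ F, {η | η x = b x} := by
    ext η; simp [cylinder]
  rw [this]
  exact Finset.measurableSet_biInter F fun x _ => measurable_pi_apply x (measurableSet_singleton _)

theorem measurableSet_of_local {A : Set (Site → Bool)} (F : Finset Site)
    (h : ∀ η η' : Site → Bool, (∀ x ∈ F, η x = η' x) → η ∈ A → η' ∈ A) : MeasurableSet A := by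
  have : A = F.restrict (π := fun _ => Bool) ⁻¹' (F.restrict (π := fun _ => Bool) '' A) := by
    refine Subset.antisymm (subset_preimage_image _ _) ?_
    rintro η' ⟨η, hη, he⟩
    exact h η η' (fun x hx => congrFun he ⟨x, hx⟩) hη
  rw [this]
  exact (Finset.measurable_restrict F) (Set.toFinite _).measurableSet

/-- Site, activation and ghost variables. -/
abbrev Env : Type := ((Site → Bool) × (Site → Bool)) × (Site → Bool)

/-- The state of the coordinate `i`. -/
def Env.val (ω : Env) (i : Idx) : Bool := if i.2 = 0 then ω.1.1 i.1 else if i.2 = 1 then ω.1.2 i.1 else ω.2 i.1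

/-- The finite-volume state. -/
noncomputable def Env.trunc (Λ : Finset Site) (ω : Env) : Finset Idx := (coords Λ).filter (fun i => ω.val i = true)

theorem Env.mem_trunc {Λ : Finset Site} {ω : Env} {i : Idx} :
    i ∈ ω.trunc Λ ↔ i.1 ∈ Λ ∧ ω.val i = true := by
  rw [Env.trunc, Finset.mem_filter, mem_coords]

@[simp] theorem Env.val_zero (ω : Env) (x : Site) : ω.val (x, 0) = ω.1.1 x := rfl

@[simp] theorem Env.val_one (ω : Env) (x : Site) : ω.val (x, 1) = ω.1.2 x := rfl

@[simp] theorem Env.val_two (ω : Env) (x : Site) : ω.val (x, 2) = ω.2 x := rfl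

theorem prod_coords {N : Type*} [CommMonoid N] (Λ : Finset Site) (f : Idx → N) :
    ∏ i ∈ coords Λ, f i = (∏ x ∈ Λ, f (x, 0)) * (∏ x ∈ Λ, f (x, 1)) * ∏ x ∈ Λ, f (x, 2) := by
  rw [coords, Finset.prod_product, ← Finset.prod_mul_distrib, ← Finset.prod_mul_distrib]
  refine Finset.prod_congr rfl fun a _ => ?_
  rw [Fin.prod_univ_three]

theorem trunc_eq_iff {Λ : Finset Site} {S : Finset Idx} (hS : S ⊆ coords Λ) (ω : Env) :
    ω.trunc Λ = S ↔ ω ∈ (cylinder Λ (fun x => decide ((x, 0) ∈ S)) ×ˢ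
      cylinder Λ (fun x => decide ((x, 1) ∈ S))) ×ˢ cylinder Λ (fun x => decide ((x, 2) ∈ S)) := by
  have h1 : ω.trunc Λ = S ↔ ∀ i : Idx, i.1 ∈ Λ → (ω.val i = true ↔ i ∈ S) := by
    constructor
    · rintro rfl i hi
      rw [Env.mem_trunc]; tauto
    · intro h
      ext i
      rw [Env.mem_trunc]
      refine ⟨fun hi => (h i hi.1).1 hi.2, fun hi => ?_⟩
      have := mem_coords.1 (hS hi)
      exact ⟨this, (h i this).2 hi⟩
  rw [h1, forall_idx]
  simp only [Set.mem_prod, cylinder, mem_ofPred_eq, Env.val_zero, Env.val_one, Env.val_two]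
  have key : ∀ (b : Bool) (Q : Prop) [Decidable Q], b = decide Q ↔ (b = true ↔ Q) := by
    intro b Q _; cases b <;> simp
  simp only [key]
  exact ⟨fun h => ⟨⟨fun x hx => (h x).1 hx, fun x hx => (h x).2.1 hx⟩, fun x hx => (h x).2.2 hx⟩,
    fun h x => ⟨h.1.1 x, h.1.2 x, h.2 x⟩⟩

theorem IsBernoulli.real_cylinder {p : ℝ} {μ : Measure (Site → Bool)} (hμ : IsBernoulli p μ) (h0 : 0 ≤ p)
    (h1 : p ≤ 1) (F : Finset Site) (b : Site → Bool) :
    μ.real (cylinder F b) = ∏ x ∈ F, if b x then p else 1 - p := by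
  rw [measureReal_def, hμ.2, ENNReal.toReal_prod]
  refine Finset.prod_congr rfl fun x _ => ENNReal.toReal_ofReal ?_
  split <;> linarith

theorem real_trunc {p s h : ℝ} {μ ν γ : Measure (Site → Bool)} (hμ : IsBernoulli p μ)
    (hν : IsBernoulli s ν) (hγ : IsBernoulli h γ) (hp : 0 ≤ p ∧ p ≤ 1) (hs : 0 ≤ s ∧ s ≤ 1)
    (hh : 0 ≤ h ∧ h ≤ 1) (Λ : Finset Site) (Q : Finset Idx → Prop) :
    ((μ.prod ν).prod γ).real {ω | Q (Env.trunc Λ ω)} =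
      prodProb (coords Λ) (dens (fun _ => p) s h) Q := by
  classical
  have := hμ.1
  have := hν.1
  have := hγ.1
  have hset : {ω : Env | Q (Env.trunc Λ ω)} =
      ⋃ S ∈ (coords Λ).powerset.filter Q, {ω : Env | Env.trunc Λ ω = S} := by
    ext ω
    simp only [mem_ofPred_eq, mem_iUnion, Finset.mem_filter, Finset.mem_powerset, exists_prop,
      exists_eq_right']
    exact ⟨fun h => ⟨Finset.filter_subset _ _, h⟩, fun h => h.2⟩
  have hcyl : ∀ S ⊆ coords Λ, {ω : Env | Env.trunc Λ ω = S} =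
      (cylinder Λ (fun x => decide ((x, 0) ∈ S)) ×ˢ
      cylinder Λ (fun x => decide ((x, 1) ∈ S))) ×ˢ cylinder Λ (fun x => decide ((x, 2) ∈ S)) :=
    fun S hS => Set.ext fun ω => trunc_eq_iff hS ω
  rw [hset, measureReal_biUnion_finset, Finset.sum_filter, prodProb]
  · refine Finset.sum_congr rfl fun S hS => ?_
    rw [Finset.mem_powerset] at hS
    by_cases hQ : Q S
    · rw [if_pos hQ, ind_of_true hQ, mul_one, hcyl S hS, measureReal_prod_prod, measureReal_prod_prod,
        hμ.real_cylinder hp.1 hp.2, hν.real_cylinder hs.1 hs.2, hγ.real_cylinder hh.1 hh.2, weight,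
        prod_coords]
      simp
    · rw [if_neg hQ, ind_of_false hQ, mul_zero]
  · intro S _ T _ hST
    refine Set.disjoint_left.2 fun ω h1 h2 => hST ?_
    rw [mem_ofPred_eq] at h1 h2
    rw [← h1, h2]
  · intro S hS
    rw [Finset.mem_filter, Finset.mem_powerset] at hS
    rw [hcyl S hS.1]
    exact ((measurableSet_cylinder _ _).prod (measurableSet_cylinder _ _)).prod
      (measurableSet_cylinder _ _)

theorem measurableSet_connectedIn {α : Type*} [MeasurableSpace α] {f : α → Config}
    (hf : ∀ x, MeasurableSet {a | x ∈ f a}) (x y : Site) : MeasurableSet {a | Reach (f a) x y} := by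
  have : {a | Reach (f a) x y} = ⋃ l : {l : List Site // IsPathOn adjZ2 l ∧ l.head? = some x ∧
      l.getLast? = some y}, ⋂ z ∈ l.1.toFinset, {a | z ∈ f a} := by
    ext a
    simp only [mem_ofPred_eq, ← connectedIn_iff, ConnectedIn, mem_iUnion, mem_iInter, List.mem_toFinset,
      Subtype.exists, exists_prop]
    exact exists_congr fun l => by tauto
  rw [this]
  exact MeasurableSet.iUnion fun l => Finset.measurableSet_biInter _ fun z _ => hf z

theorem measurableSet_mem_enhanced (hφ : IsEnhancement R₀ φ) (x : Site) :
    MeasurableSet {ηα : (Site → Bool) × (Site → Bool) | x ∈ enhanced φ (toConfig ηα.1) ηα.2} := by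
  have : {ηα : (Site → Bool) × (Site → Bool) | x ∈ enhanced φ (toConfig ηα.1) ηα.2} =
      (Prod.fst ⁻¹' {η | η x = true}) ∪ ⋃ c : Site, (Prod.snd ⁻¹' {α | α c = true}) ∩
        (Prod.fst ⁻¹' {η | x ∈ enhAt φ c (toConfig η)}) := by
    ext ηα
    simp [enhanced, toConfig]
  have hb : ∀ c : Site, MeasurableSet {α : Site → Bool | α c = true} := fun c =>
    measurableSet_eq_fun (measurable_pi_apply c) measurable_const
  rw [this]
  refine (measurable_fst (hb x)).union (MeasurableSet.iUnion fun c =>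
    (measurable_snd (hb c)).inter (measurable_fst ?_))
  refine measurableSet_of_local (nbr ⌈R₀⌉.toNat c) fun η η' h hη => ?_
  rw [mem_ofPred_eq] at hη ⊢
  rwa [← enhAt_congr hφ (ω := toConfig η)]
  intro y hy
  have := siteBall_bound hy
  rw [Prod.fst_sub, Prod.snd_sub, abs_le, abs_le] at this
  simp only [toConfig, mem_ofPred_eq]
  rw [h y (by rw [mem_nbr]; omega)]

end

section

variable {R₀ : ℝ} {φ : Config → Config}

theorem exists_nbr_superset (F : Set Site) (hF : F.Finite) : ∃ K : ℕ, F ⊆ nbr K 0 := by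
  refine ⟨hF.toFinset.sup (fun z => z.1.natAbs + z.2.natAbs), fun z hz => ?_⟩
  have := Finset.le_sup (f := fun z : Site => z.1.natAbs + z.2.natAbs) (hF.mem_toFinset.2 hz)
  rw [Finset.mem_coe, mem_nbr]
  simp only [Prod.fst_zero, Prod.snd_zero]
  omega

theorem nbr_mono {K L : ℕ} (h : K ≤ L) : nbr K 0 ⊆ nbr L 0 := by
  intro z hz
  rw [mem_nbr] at *
  simp only [Prod.fst_zero, Prod.snd_zero] at *
  omega

theorem inInfiniteCluster_iff {ω : Config} {x : Site} :
    InInfiniteCluster adjZ2 ω x ↔ ∀ K : ℕ, ∃ z, z ∉ nbr K 0 ∧ Reach ω x z := by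
  simp only [InInfiniteCluster, connectedIn_iff]
  constructor
  · intro h K
    obtain ⟨z, hz, hz'⟩ := h.exists_notMem_finset (nbr K 0)
    exact ⟨z, hz', hz⟩
  · intro h hfin
    obtain ⟨K, hK⟩ := exists_nbr_superset _ hfin
    obtain ⟨z, hz, hz'⟩ := h K
    exact hz (hK hz')

/-- A connection leaving a square leaves it through a neighbouring site. -/
theorem Reach.exists_exit {ω : Config} {z : Site} {K : ℕ} (h : Reach ω 0 z) (hz : z ∉ nbr K 0) :
    ∃ z', z' ∉ nbr K 0 ∧ Reach (ω ∩ nbr (K + 1) 0) 0 z' := by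
  by_contra! hcon
  refine hz (Reach.mem_of_closed (T := {p | p ∈ nbr K 0 ∧ Reach (ω ∩ nbr (K + 1) 0) 0 p}) ?_ h
    ⟨by rw [mem_nbr]; simp, Reach.refl ⟨h.left_mem, by rw [Finset.mem_coe, mem_nbr]; simp; omega⟩⟩).1
  rintro a ⟨ha, hra⟩ b hb hab
  have hb' : b ∈ nbr (K + 1) 0 := by
    rw [mem_nbr] at *
    simp only [adjZ2, Prod.fst_zero, Prod.snd_zero] at *
    have h1 := abs_nonneg (a.1 - b.1)
    have h2 := abs_nonneg (a.2 - b.2)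
    have h3 := abs_le.1 (show |a.1 - b.1| ≤ 1 by omega)
    have h4 := abs_le.1 (show |a.2 - b.2| ≤ 1 by omega)
    push_cast
    omega
  have hr : Reach (ω ∩ nbr (K + 1) 0) 0 b := hra.tail hab ⟨hb, hb'⟩
  refine ⟨?_, hr⟩
  by_contra hbK
  exact hcon b hbK hr

theorem Env.openSites_trunc {Λ : Finset Site} {ω : Env} :
    openSites (ω.trunc Λ) = {x | x ∈ Λ ∧ ω.1.1 x = true} := by
  ext x
  simp [openSites, Env.mem_trunc]

theorem Env.mem_enhSites_trunc (hφ : IsEnhancement R₀ φ) {N : ℕ} {ω : Env} {x : Site}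
    (hx : nbr (2 * ⌈R₀⌉.toNat) x ⊆ nbr N 0) :
    x ∈ enhSites φ (ω.trunc (nbr N 0)) ↔ x ∈ enhanced φ (toConfig ω.1.1) ω.1.2 := by
  have hxN : x ∈ nbr N 0 := hx (by rw [mem_nbr]; omega)
  simp only [enhSites, enhanced, Env.openSites_trunc, toConfig, mem_union, mem_ofPred_eq, hxN, true_and,
    Env.mem_trunc, Env.val_one]
  refine or_congr Iff.rfl (exists_congr fun c => ?_)
  by_cases hc : x - c ∈ siteBall R₀
  · have hc' := siteBall_bound hc
    rw [Prod.fst_sub, Prod.snd_sub, abs_le, abs_le] at hc'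
    have hcN : c ∈ nbr N 0 := hx (by rw [mem_nbr]; omega)
    simp only [hcN, true_and]
    refine and_congr_right fun _ => ?_
    rw [enhAt_congr hφ]
    intro y hy
    have hy' := siteBall_bound hy
    rw [Prod.fst_sub, Prod.snd_sub, abs_le, abs_le] at hy'
    have hyN : y ∈ nbr N 0 := hx (by rw [mem_nbr]; omega)
    simp [hyN]
  · have h1 : ∀ ω', ¬ x ∈ enhAt φ c ω' := fun ω' h => hc (sub_mem_ball_of_mem_enhAt hφ h)
    simp [h1]

/-- The origin is connected to the complement of the square of radius `K`. -/
def exitEvent (φ : Config → Config) (K : ℕ) : Set ((Site → Bool) × (Site → Bool)) :=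
  {ηα | ∃ z, z ∉ nbr K 0 ∧ Reach (enhanced φ (toConfig ηα.1) ηα.2) 0 z}

theorem hitsGhost_trunc (hφ : IsEnhancement R₀ φ) {K N : ℕ} (hN : K + 1 + 2 * ⌈R₀⌉.toNat ≤ N) {ω : Env}
    (h : HitsGhost φ (ω.trunc (nbr N 0))) : ω.1 ∈ exitEvent φ K ∨ ∃ z ∈ nbr K 0, ω.2 z = true := by
  obtain ⟨z, hz, hr⟩ := h
  have hz2 : ω.2 z = true := (Env.mem_trunc.1 hz).2
  by_cases hzK : z ∈ nbr K 0
  · exact Or.inr ⟨z, hzK, hz2⟩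
  · obtain ⟨z', hz', hr'⟩ := hr.exists_exit hzK
    refine Or.inl ⟨z', hz', hr'.mono ?_⟩
    rintro x ⟨hx, hxK⟩
    exact (Env.mem_enhSites_trunc hφ ((nbr_subset hxK).trans (nbr_mono hN))).1 hx

theorem prodProb_le_exit (hφ : IsEnhancement R₀ φ) {p s h : ℝ} {μ ν γ : Measure (Site → Bool)}
    (hμ : IsBernoulli p μ) (hν : IsBernoulli s ν) (hγ : IsBernoulli h γ) (hp : 0 ≤ p ∧ p ≤ 1)
    (hs : 0 ≤ s ∧ s ≤ 1) (hh : 0 ≤ h ∧ h ≤ 1) {K N : ℕ} (hN : K + 1 + 2 * ⌈R₀⌉.toNat ≤ N) :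
    prodProb (coords (nbr N 0)) (dens (fun _ => p) s h) (HitsGhost φ) ≤
      (μ.prod ν).real (exitEvent φ K) + (nbr K 0).card * h := by
  have := hμ.1
  have := hν.1
  have := hγ.1
  rw [← real_trunc hμ hν hγ hp hs hh]
  have hsub : {ω : Env | HitsGhost φ (ω.trunc (nbr N 0))} ⊆
      exitEvent φ K ×ˢ univ ∪ ⋃ z ∈ nbr K 0, univ ×ˢ cylinder {z} (fun _ => true) := by
    intro ω hω
    rcases hitsGhost_trunc hφ hN hω with h1 | ⟨z, hz, h2⟩
    · exact Or.inl ⟨h1, mem_univ _⟩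
    · refine Or.inr (mem_iUnion₂.2 ⟨z, hz, mem_univ _, ?_⟩)
      simpa [cylinder] using h2
  refine (measureReal_mono hsub).trans ((measureReal_union_le _ _).trans (add_le_add ?_ ?_))
  · rw [measureReal_prod_prod, probReal_univ, mul_one]
  · refine (measureReal_biUnion_finset_le _ _).trans ?_
    rw [← nsmul_eq_mul, ← Finset.sum_const]
    refine Finset.sum_le_sum fun z _ => ?_
    rw [measureReal_prod_prod, probReal_univ, one_mul, hγ.real_cylinder hh.1 hh.2]
    simp

/-- A ghost mark in a square is connected to the origin by open sites of the square. -/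
def OpenHit (M : ℕ) (S : Finset Idx) : Prop :=
  ∃ z ∈ nbr M 0, z ∈ ghosts S ∧ Reach (openSites S ∩ nbr M 0) 0 z

theorem OpenHit.hitsGhost {M : ℕ} {S : Finset Idx} (h : OpenHit M S) : HitsGhost φ S := by
  obtain ⟨z, _, hg, hr⟩ := h
  exact ⟨z, hg, hr.mono (inter_subset_left.trans subset_union_left)⟩

theorem openHit_inter (M : ℕ) (S : Finset Idx) : OpenHit M S ↔ OpenHit M (S ∩ coords (nbr M 0)) := by
  have h1 : openSites (S ∩ coords (nbr M 0)) ∩ nbr M 0 = openSites S ∩ nbr M 0 := by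
    ext x
    simp only [openSites, mem_inter_iff, mem_ofPred_eq, Finset.mem_inter, mem_coords, Finset.mem_coe]
    tauto
  rw [OpenHit, OpenHit, h1]
  refine exists_congr fun z => ?_
  simp only [ghosts, mem_ofPred_eq, Finset.mem_inter, mem_coords]
  tauto

/-- The origin is connected to a ghost mark by open sites. -/
def openHitEvent : Set Env := {ω | ∃ z, ω.2 z = true ∧ Reach (toConfig ω.1.1) 0 z}

theorem tendsto_openHit (m : Measure Env) [IsProbabilityMeasure m] :
    Tendsto (fun M => m.real {ω | OpenHit M (ω.trunc (nbr M 0))}) atTop (𝓝 (m.real openHitEvent)) := by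
  have heq : ∀ M (ω : Env), OpenHit M (ω.trunc (nbr M 0)) ↔
      ∃ z ∈ nbr M 0, ω.2 z = true ∧ Reach (toConfig ω.1.1 ∩ nbr M 0) 0 z := by
    intro M ω
    have : openSites (ω.trunc (nbr M 0)) ∩ nbr M 0 = toConfig ω.1.1 ∩ nbr M 0 := by
      ext x
      simp only [Env.openSites_trunc, toConfig, mem_inter_iff, mem_ofPred_eq, Finset.mem_coe]
      tauto
    rw [OpenHit, this]
    refine exists_congr fun z => ?_
    simp only [ghosts, mem_ofPred_eq, Env.mem_trunc, Env.val_two]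
    tauto
  have hU : openHitEvent = ⋃ M, {ω : Env | OpenHit M (ω.trunc (nbr M 0))} := by
    ext ω
    simp only [openHitEvent, mem_ofPred_eq, mem_iUnion, heq]
    constructor
    · rintro ⟨z, hz, hr⟩
      obtain ⟨l, hl, hl0, hl1, hl2⟩ := connectedIn_iff.2 hr
      obtain ⟨K, hK⟩ := exists_nbr_superset {x | x ∈ l} (List.finite_toSet l)
      have hr' : Reach (toConfig ω.1.1 ∩ nbr K 0) 0 z :=
        connectedIn_iff.1 ⟨l, hl, fun x hx => ⟨hl0 x hx, hK hx⟩, hl1, hl2⟩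
      exact ⟨K, z, hr'.right_mem.2, hz, hr'⟩
    · rintro ⟨M, z, _, hz, hr⟩
      exact ⟨z, hz, hr.mono inter_subset_left⟩
  rw [hU]
  refine (ENNReal.tendsto_toReal (measure_ne_top m _)).comp (tendsto_measure_iUnion_atTop ?_)
  intro M M' hM ω hω
  rw [mem_ofPred_eq, heq] at hω ⊢
  obtain ⟨z, hz, h1, h2⟩ := hω
  exact ⟨z, nbr_mono hM hz, h1, h2.mono (inter_subset_inter_right _ (nbr_mono hM))⟩

theorem IsBernoulli.measure_none {h : ℝ} {γ : Measure (Site → Bool)} (hγ : IsBernoulli h γ) (h0 : 0 < h)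
    (h1 : h ≤ 1) {C : Set Site} (hC : C.Infinite) : γ {g | ∀ z ∈ C, g z = false} = 0 := by
  have := hγ.1
  have hb : ∀ n : ℕ, γ.real {g | ∀ z ∈ C, g z = false} ≤ (1 - h) ^ n := by
    intro n
    obtain ⟨F, hF, hn⟩ := hC.exists_subset_card_eq n
    calc γ.real {g | ∀ z ∈ C, g z = false} ≤ γ.real (cylinder F fun _ => false) :=
          measureReal_mono fun g hg x hx => hg x (hF hx)
      _ = (1 - h) ^ n := by
          rw [hγ.real_cylinder h0.le h1]
          simp [hn]
  have := ge_of_tendsto' (tendsto_pow_atTop_nhds_zero_of_lt_one (by linarith) (by linarith)) hb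
  rw [← measureReal_eq_zero_iff]
  exact le_antisymm this measureReal_nonneg

theorem theta_le_openHit {p h : ℝ} {μ ν γ : Measure (Site → Bool)} (hμ : IsBernoulli p μ)
    [IsProbabilityMeasure ν] (hγ : IsBernoulli h γ) (h0 : 0 < h) (h1 : h ≤ 1) :
    theta adjZ2 μ ≤ ((μ.prod ν).prod γ).real openHitEvent := by
  have := hμ.1
  have := hγ.1
  set I : Set (Site → Bool) := {η | InInfiniteCluster adjZ2 (toConfig η) 0} with hI
  have hmem : ∀ x : Site, MeasurableSet {η : Site → Bool | x ∈ toConfig η} := fun x =>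
    measurableSet_eq_fun (measurable_pi_apply x) measurable_const
  have hreach : ∀ z : Site, MeasurableSet {η : Site → Bool | Reach (toConfig η) 0 z} := fun z =>
    measurableSet_connectedIn hmem 0 z
  have hIm : MeasurableSet I := by
    have : I = ⋂ K : ℕ, ⋃ z ∈ {z : Site | z ∉ nbr K 0}, {η | Reach (toConfig η) 0 z} := by
      ext η; simp [hI, inInfiniteCluster_iff]
    rw [this]
    exact MeasurableSet.iInter fun K => MeasurableSet.biUnion (Set.to_countable _) fun z _ => hreach z
  have hHm : MeasurableSet openHitEvent := by
    have : openHitEvent = ⋃ z : Site, (Prod.snd ⁻¹' {g | z ∈ toConfig g}) ∩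
        ((fun ω : Env => ω.1.1) ⁻¹' {η | Reach (toConfig η) 0 z}) := by
      ext ω; simp [openHitEvent, toConfig]
    rw [this]
    exact MeasurableSet.iUnion fun z => (measurable_snd (hmem z)).inter
      ((measurable_fst.comp measurable_fst) (hreach z))
  have hnull : ((μ.prod ν).prod γ) ((I ×ˢ univ) ×ˢ univ \ openHitEvent) = 0 := by
    rw [Measure.measure_prod_null (((hIm.prod .univ).prod .univ).diff hHm)]
    refine Eventually.of_forall fun ηα => ?_
    by_cases hη : ηα.1 ∈ I
    · refine measure_mono_null ?_ (hγ.measure_none h0 h1 hη)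
      rintro g ⟨-, hg⟩ z hz
      by_contra hgz
      exact hg ⟨z, by simpa using hgz, connectedIn_iff.1 hz⟩
    · refine measure_mono_null (t := ∅) ?_ measure_empty
      rintro g ⟨⟨⟨hg, -⟩, -⟩, -⟩
      exact hη hg
  have h2 : theta adjZ2 μ = ((μ.prod ν).prod γ).real ((I ×ˢ univ) ×ˢ univ) := by
    rw [measureReal_prod_prod, measureReal_prod_prod, probReal_univ, probReal_univ, mul_one, mul_one]
    rfl
  rw [h2]
  have h3 : ((μ.prod ν).prod γ).real ((I ×ˢ univ) ×ˢ univ \ openHitEvent) = 0 := by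
    rw [measureReal_def, hnull, ENNReal.toReal_zero]
  have h4 := measureReal_inter_add_sdiff (μ := (μ.prod ν).prod γ) (s := (I ×ˢ univ) ×ˢ univ) hHm
  have h5 := measureReal_mono (μ := (μ.prod ν).prod γ)
    (inter_subset_right : ((I ×ˢ univ) ×ˢ univ) ∩ openHitEvent ⊆ openHitEvent)
  linarith

end

section

variable {R₀ : ℝ} {φ : Config → Config}

theorem tendsto_exit (hφ : IsEnhancement R₀ φ) (μ ν : Measure (Site → Bool)) [IsProbabilityMeasure μ]
    [IsProbabilityMeasure ν] :
    Tendsto (fun K => (μ.prod ν).real (exitEvent φ K)) atTop (𝓝 (thetaEnh adjZ2 φ μ ν)) := by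
  have hI : {ηα : (Site → Bool) × (Site → Bool) |
      InInfiniteCluster adjZ2 (enhanced φ (toConfig ηα.1) ηα.2) 0} = ⋂ K, exitEvent φ K := by
    ext ηα
    simp only [mem_ofPred_eq, inInfiniteCluster_iff, mem_iInter, exitEvent]
  rw [thetaEnh, hI]
  refine (ENNReal.tendsto_toReal (measure_ne_top _ _)).comp
    (tendsto_measure_iInter_atTop (fun K => ?_) ?_ ⟨0, measure_ne_top _ _⟩)
  · have : exitEvent φ K = ⋃ z ∈ {z : Site | z ∉ nbr K 0},
        {ηα | Reach (enhanced φ (toConfig ηα.1) ηα.2) 0 z} := by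
      ext ηα; simp [exitEvent]
    rw [this]
    exact (MeasurableSet.biUnion (Set.to_countable _) fun z _ =>
      measurableSet_connectedIn (measurableSet_mem_enhanced hφ) 0 z).nullMeasurableSet
  · rintro K K' hK ηα ⟨z, hz, hr⟩
    exact ⟨z, fun h => hz (nbr_mono hK h), hr⟩

/-- Comparison of the enhanced model with the unenhanced model at a larger density. -/
theorem exists_theta_comparison (hφ : IsEnhancement R₀ φ) (hess : Essential adjZ2 φ)
    {P : ℝ → Measure (Site → Bool)} (hP : ∀ p ∈ Icc (0 : ℝ) 1, IsBernoulli p (P p)) {κ : ℝ} (hκ : 0 < κ)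
    (hκ1 : κ ≤ 1) : ∃ C : ℝ, 0 ≤ C ∧ ∀ p s s' δ : ℝ, 0 ≤ δ → κ ≤ p → p + δ ≤ 1 - κ → κ ≤ s - C * δ →
      s ≤ 1 - κ → s ≤ s' → s' ≤ 1 →
      theta adjZ2 (P (p + δ)) ≤ Real.exp (C * δ) * thetaEnh adjZ2 φ (P p) (P s') := by
  obtain ⟨r, hr⟩ := exists_flow_bound hφ hess
  obtain ⟨C, hC, H⟩ := hr κ hκ hκ1
  refine ⟨C, hC, fun p s s' δ hδ hp hpδ hs hs1 hss' hs' => ?_⟩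
  have hCδ : 0 ≤ C * δ := mul_nonneg hC hδ
  have hp01 : 0 ≤ p ∧ p ≤ 1 := ⟨by linarith, by linarith⟩
  have hq01 : 0 ≤ p + δ ∧ p + δ ≤ 1 := ⟨by linarith, by linarith⟩
  have hs01 : 0 ≤ s ∧ s ≤ 1 := ⟨by linarith, by linarith⟩
  have ht01 : 0 ≤ s - C * δ ∧ s - C * δ ≤ 1 := ⟨by linarith, by linarith⟩
  have hs'01 : 0 ≤ s' ∧ s' ≤ 1 := ⟨by linarith, hs'⟩
  have hμ := hP p hp01
  have hμ' := hP (p + δ) hq01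
  have hν := hP s' hs'01
  have hν' := hP (s - C * δ) ht01
  have := hμ.1
  have := hμ'.1
  have := hν.1
  have := hν'.1
  have hexp : Real.exp (-(C * δ)) ≤ 1 := Real.exp_le_one_iff.2 (by linarith)
  have hexp0 := Real.exp_pos (-(C * δ))
  have step : ∀ K : ℕ, ∀ h : ℝ, 0 < h → h ≤ 1 / 2 → theta adjZ2 (P (p + δ)) ≤
      Real.exp (C * δ) * (((P p).prod (P s')).real (exitEvent φ K) + (nbr K 0).card * h) := by
    intro K h h0 h1
    have hh01 : 0 ≤ h ∧ h ≤ 1 := ⟨h0.le, by linarith⟩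
    have hg0 : 0 < h * Real.exp (-(C * δ)) := mul_pos h0 hexp0
    have hg1 : h * Real.exp (-(C * δ)) ≤ 1 := (mul_le_of_le_one_right h0.le hexp).trans hh01.2
    have hγ := hP h hh01
    have hγ' := hP (h * Real.exp (-(C * δ))) ⟨hg0.le, hg1⟩
    have := hγ'.1
    refine (theta_le_openHit (ν := P (s - C * δ)) hμ' hγ' hg0 hg1).trans ?_
    refine le_of_tendsto (tendsto_openHit _) (eventually_atTop.2 ⟨K + 1 + 2 * ⌈R₀⌉.toNat, fun M hM => ?_⟩)
    have hsub : coords (nbr M 0) ⊆ coords (nbr (M + r) 0) := fun i hi =>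
      mem_coords.2 (nbr_mono (by omega) (mem_coords.1 hi))
    calc (((P (p + δ)).prod (P (s - C * δ))).prod (P (h * Real.exp (-(C * δ))))).real
            {ω : Env | OpenHit M (ω.trunc (nbr M 0))}
        = prodProb (coords (nbr M 0)) (dens (fun _ => p + δ) (s - C * δ) (h * Real.exp (-(C * δ))))
            (OpenHit M) := real_trunc hμ' hν' hγ' hq01 ht01 ⟨hg0.le, hg1⟩ _ _
      _ = prodProb (coords (nbr M 0)) (dens (ramp M p δ) (s - C * δ) (h * Real.exp (-(C * δ))))
            (OpenHit M) := by
          refine prodProb_congr_dens (fun i hi => ?_) _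
          rw [mem_coords] at hi
          simp only [dens, ramp, if_pos hi]
      _ = prodProb (coords (nbr (M + r) 0)) (dens (ramp M p δ) (s - C * δ) (h * Real.exp (-(C * δ))))
            (OpenHit M) := (prodProb_of_subset hsub _ (openHit_inter M)).symm
      _ ≤ prodProb (coords (nbr (M + r) 0)) (dens (ramp M p δ) (s - C * δ) (h * Real.exp (-(C * δ))))
            (HitsGhost φ) := by
          suffices hq : ∀ i, 0 ≤ dens (ramp M p δ) (s - C * δ) (h * Real.exp (-(C * δ))) i ∧
              dens (ramp M p δ) (s - C * δ) (h * Real.exp (-(C * δ))) i ≤ 1 from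
            prodProb_mono (fun i _ => hq i) fun S _ hS => hS.hitsGhost
          rw [forall_idx]
          refine fun x => ⟨?_, ht01, ⟨hg0.le, hg1⟩⟩
          rw [dens_zero, ramp]
          split
          · exact hq01
          · exact hp01
      _ ≤ Real.exp (C * δ) * prodProb (coords (nbr (M + r) 0)) (dens (fun _ => p) s h) (HitsGhost φ) :=
          H M p s h δ hδ hp hpδ hs hs1 h0.le h1
      _ ≤ Real.exp (C * δ) * (((P p).prod (P s')).real (exitEvent φ K) + (nbr K 0).card * h) := by
          refine mul_le_mul_of_nonneg_left ?_ (Real.exp_pos _).le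
          exact (prodProb_mono_activation _ hp01 hs01.1 hss' hs' hh01).trans
            (prodProb_le_exit hφ hμ hν hγ hp01 hs'01 hh01 (by omega))
  have step2 : ∀ K : ℕ, theta adjZ2 (P (p + δ)) ≤
      Real.exp (C * δ) * ((P p).prod (P s')).real (exitEvent φ K) := by
    intro K
    have hc : Tendsto (fun h : ℝ => Real.exp (C * δ) * (((P p).prod (P s')).real (exitEvent φ K) +
        (nbr K 0).card * h)) (𝓝[>] 0) (𝓝 (Real.exp (C * δ) * (((P p).prod (P s')).real (exitEvent φ K) +
        (nbr K 0).card * 0))) :=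
      (Continuous.tendsto (by fun_prop) 0).mono_left nhdsWithin_le_nhds
    rw [mul_zero, add_zero] at hc
    refine ge_of_tendsto hc ?_
    filter_upwards [Ioo_mem_nhdsGT (show (0 : ℝ) < 1 / 2 by norm_num)] with h hh
    exact step K h hh.1 hh.2.le
  exact ge_of_tendsto' ((tendsto_exit hφ (P p) (P s')).const_mul _) step2

theorem exists_shift (hφ : IsEnhancement R₀ φ) (hess : Essential adjZ2 φ)
    {P : ℝ → Measure (Site → Bool)} (hP : ∀ p ∈ Icc (0 : ℝ) 1, IsBernoulli p (P p))
    (h0 : 0 < pcOf adjZ2 P) (h1 : pcOf adjZ2 P < 1) {s : ℝ} (hs : 0 < s) (hs1 : s ≤ 1) :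
    ∃ π < pcOf adjZ2 P, ∀ p, π < p → p < pcOf adjZ2 P → 0 < thetaEnh adjZ2 φ (P p) (P s) := by
  set pc := pcOf adjZ2 P with hpc
  set κ := min (pc / 2) (min ((1 - pc) / 2) (s / 4)) with hκ
  have k1 : κ ≤ pc / 2 := min_le_left _ _
  have k2 : κ ≤ (1 - pc) / 2 := (min_le_right _ _).trans (min_le_left _ _)
  have k3 : κ ≤ s / 4 := (min_le_right _ _).trans (min_le_right _ _)
  have k0 : 0 < κ := lt_min (by linarith) (lt_min (by linarith) (by linarith))
  obtain ⟨C, hC, H⟩ := exists_theta_comparison hφ hess hP k0 (by linarith)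
  set δ := min ((1 - pc) / 2) (s / (4 * (C + 1))) with hδ
  have d1 : δ ≤ (1 - pc) / 2 := min_le_left _ _
  have d0 : 0 < δ := lt_min (by linarith) (by positivity)
  have d2 : C * δ ≤ s / 4 := by
    have h2 : δ ≤ s / (4 * (C + 1)) := min_le_right _ _
    rw [le_div_iff₀ (by positivity)] at h2
    nlinarith
  refine ⟨max (pc / 2) (pc - δ), max_lt (by linarith) (by linarith), fun p hp hp' => ?_⟩
  have p1 := (le_max_left _ _).trans_lt hp
  have p2 := (le_max_right _ _).trans_lt hp
  have key := H p (s / 2) s δ d0.le (by linarith) (by linarith) (by linarith) (by linarith) (by linarith) hs1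
  have hθ : 0 < theta adjZ2 (P (p + δ)) := by
    refine lt_of_le_of_ne ENNReal.toReal_nonneg fun h => ?_
    have : p + δ ≤ pc := le_csSup ⟨1, fun x hx => hx.1.2⟩ ⟨⟨by linarith, by linarith⟩, h.symm⟩
    linarith
  exact pos_of_mul_pos_right (hθ.trans_le key) (Real.exp_pos _).le

end

section Contour

variable {ω C K : Config} {B : ℤ}

open Classical in
/-- The edge cochain marking the edges between `C` and `K`. -/
noncomputable def crossing (C K : Config) (a b : Site) : ZMod 2 :=
  if (a ∈ C ∧ b ∈ K) ∨ (a ∈ K ∧ b ∈ C) then 1 else 0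

theorem crossing_eq_zero {a b : Site} (h1 : a ∈ C → b ∉ K) (h2 : b ∈ C → a ∉ K) : crossing C K a b = 0 := by
  rw [crossing, if_neg]; tauto

/-- `K` is closed under star-adjacency inside the complement of `ω`, and the boundary of `C` lies
in the complement of `ω`. -/
structure Separates (ω C K : Config) : Prop where
  subset : C ⊆ ω
  boundary : ∀ a ∈ C, ∀ b, adjZ2 a b → b ∉ C → b ∉ ω
  disjoint : ∀ a ∈ K, a ∉ ω
  closed : ∀ a ∈ K, ∀ b, b ∉ ω → adjStar a b → b ∈ K

theorem Separates.crossing_square (h : Separates ω C K) (x y : ℤ) :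
    crossing C K (x, y) (x, y + 1) + crossing C K (x + 1, y) (x + 1, y + 1) =
      crossing C K (x, y) (x + 1, y) + crossing C K (x, y + 1) (x + 1, y + 1) := by
  have hd : ∀ a, a ∈ C → a ∉ K := fun a ha hk => h.disjoint a hk (h.subset ha)
  have star : ∀ a b, a ∈ K → b ∉ ω → a ≠ b → max |a.1 - b.1| |a.2 - b.2| = 1 → b ∈ K :=
    fun a b ha hb hne hm => h.closed a ha b hb ⟨hne, hm⟩
  have s1 := star (x, y) (x + 1, y)
  have s2 := star (x, y) (x, y + 1)
  have s3 := star (x, y) (x + 1, y + 1)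
  have s4 := star (x + 1, y) (x, y)
  have s5 := star (x + 1, y) (x, y + 1)
  have s6 := star (x + 1, y) (x + 1, y + 1)
  have s7 := star (x, y + 1) (x, y)
  have s8 := star (x, y + 1) (x + 1, y)
  have s9 := star (x, y + 1) (x + 1, y + 1)
  have s10 := star (x + 1, y + 1) (x, y)
  have s11 := star (x + 1, y + 1) (x + 1, y)
  have s12 := star (x + 1, y + 1) (x, y + 1)
  have b1 := h.boundary (x, y) |> fun H ha => H ha (x + 1, y)
  have b2 := h.boundary (x, y) |> fun H ha => H ha (x, y + 1)
  have b3 := h.boundary (x + 1, y) |> fun H ha => H ha (x, y)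
  have b4 := h.boundary (x + 1, y) |> fun H ha => H ha (x + 1, y + 1)
  have b5 := h.boundary (x, y + 1) |> fun H ha => H ha (x, y)
  have b6 := h.boundary (x, y + 1) |> fun H ha => H ha (x + 1, y + 1)
  have b7 := h.boundary (x + 1, y + 1) |> fun H ha => H ha (x + 1, y)
  have b8 := h.boundary (x + 1, y + 1) |> fun H ha => H ha (x, y + 1)
  simp [adjZ2] at s1 s2 s3 s4 s5 s6 s7 s8 s9 s10 s11 s12 b1 b2 b3 b4 b5 b6 b7 b8
  have d1 := hd (x, y)
  have d2 := hd (x + 1, y)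
  have d3 := hd (x, y + 1)
  have d4 := hd (x + 1, y + 1)
  have o1 := @h.subset (x, y)
  have o2 := @h.subset (x + 1, y)
  have o3 := @h.subset (x, y + 1)
  have o4 := @h.subset (x + 1, y + 1)
  have two : (1 + 1 : ZMod 2) = 0 := by decide
  unfold crossing
  clear star hd h
  by_cases c1 : (x, y) ∈ C <;> by_cases c2 : (x + 1, y) ∈ C <;> by_cases c3 : (x, y + 1) ∈ C <;>
    by_cases c4 : (x + 1, y + 1) ∈ C <;> grind

/-- Number of crossings of the row of `p` to the left of `p`, modulo two. -/
noncomputable def crossings (C K : Config) (B x y : ℤ) : ZMod 2 :=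
  ∑ i ∈ Finset.Ico (-B) x, crossing C K (i, y) (i + 1, y)

/-- `C` lies in the open square of radius `B`. -/
def BoundedBy (B : ℤ) (C : Config) : Prop := ∀ a ∈ C, -B < a.1 ∧ a.1 < B ∧ -B < a.2 ∧ a.2 < B

theorem crossings_succ (hB : BoundedBy B C) (x y : ℤ) :
    crossings C K B (x + 1) y = crossings C K B x y + crossing C K (x, y) (x + 1, y) := by
  by_cases hx : -B ≤ x
  · have : Finset.Ico (-B) (x + 1) = insert x (Finset.Ico (-B) x) := by
      ext i; simp only [Finset.mem_Ico, Finset.mem_insert]; omega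
    rw [crossings, this, Finset.sum_insert (by simp), add_comm]
    rfl
  · have h0 : ∀ z ≤ -B, crossings C K B z y = 0 := fun z hz => by
      rw [crossings, Finset.Ico_eq_empty (by omega), Finset.sum_empty]
    rw [h0 _ (by omega), h0 _ (by omega), crossing_eq_zero, add_zero]
    · intro h; have := hB _ h; dsimp only at this; omega
    · intro h; have := hB _ h; dsimp only at this; omega

theorem Separates.crossings_succ' (h : Separates ω C K) (hB : BoundedBy B C) (x y : ℤ) :
    crossings C K B x (y + 1) = crossings C K B x y + crossing C K (x, y) (x, y + 1) := by
  have h0 : ∀ z ≤ -B, crossings C K B z (y + 1) =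
      crossings C K B z y + crossing C K (z, y) (z, y + 1) := fun z hz => by
    rw [crossings, crossings, Finset.Ico_eq_empty (by omega), Finset.sum_empty, Finset.sum_empty,
      crossing_eq_zero, add_zero]
    · intro h; have := hB _ h; dsimp only at this; omega
    · intro h; have := hB _ h; dsimp only at this; omega
  by_cases hx : x ≤ -B
  · exact h0 x hx
  · have hx' : -B ≤ x := by omega
    clear hx
    induction x, hx' using Int.leInduction with
    | base => exact h0 _ le_rfl
    | succ x _ ih =>
      rw [crossings_succ hB, crossings_succ hB, ih]
      have sq := h.crossing_square x y
      have two : ∀ a b c d e : ZMod 2, b + c = d + e → a + b + e = a + d + c := by decide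
      exact two _ _ _ _ _ sq

theorem Separates.crossings_of_adj (h : Separates ω C K) (hB : BoundedBy B C) {a b : Site} (ha : a ∈ C)
    (hb : b ∈ C) (hab : adjZ2 a b) : crossings C K B a.1 a.2 = crossings C K B b.1 b.2 := by
  have hz : ∀ a ∈ C, ∀ b ∈ C, crossing C K a b = 0 := fun a ha b hb =>
    crossing_eq_zero (fun _ h' => h.disjoint _ h' (h.subset hb)) (fun _ h' => h.disjoint _ h' (h.subset ha))
  obtain ⟨x, y⟩ := a
  obtain ⟨x', y'⟩ := b
  have hc : (x' = x + 1 ∧ y' = y) ∨ (x = x' + 1 ∧ y = y') ∨ (x' = x ∧ y' = y + 1) ∨ (x = x' ∧ y = y' + 1) := by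
    simp only [adjZ2] at hab
    rcases abs_cases (x - x') with ⟨h1, _⟩ | ⟨h1, _⟩ <;> rcases abs_cases (y - y') with ⟨h2, _⟩ | ⟨h2, _⟩ <;>
      omega
  rcases hc with ⟨rfl, rfl⟩ | ⟨rfl, rfl⟩ | ⟨rfl, rfl⟩ | ⟨rfl, rfl⟩
  · rw [crossings_succ hB, hz _ ha _ hb, add_zero]
  · rw [crossings_succ hB, hz _ hb _ ha, add_zero]
  · rw [h.crossings_succ' hB, hz _ ha _ hb, add_zero]
  · rw [h.crossings_succ' hB, hz _ hb _ ha, add_zero]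

theorem Separates.crossings_of_reach (h : Separates ω C K) (hB : BoundedBy B C) {a b : Site}
    (hab : Reach C a b) : crossings C K B a.1 a.2 = crossings C K B b.1 b.2 := by
  refine (Reach.mem_of_closed (T := {p | p ∈ C ∧ crossings C K B a.1 a.2 = crossings C K B p.1 p.2})
    ?_ hab ⟨hab.left_mem, rfl⟩).2
  rintro p ⟨hp, he⟩ q hq hpq
  exact ⟨hq, he.trans (h.crossings_of_adj hB hp hq hpq)⟩

theorem Separates.crossings_far (h : Separates ω C K) (hB : BoundedBy B C) (n : ℕ) :
    crossings C K B B (B - n) = 0 := by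
  induction n with
  | zero =>
    refine Finset.sum_eq_zero fun i _ => crossing_eq_zero ?_ ?_
    · intro h; have := hB _ h; dsimp only at this; omega
    · intro h; have := hB _ h; dsimp only at this; omega
  | succ n ih =>
    have h1 := h.crossings_succ' hB B (B - (n + 1))
    have h2 : crossing C K (B, B - (n + 1)) (B, B - (n + 1) + 1) = 0 := by
      refine crossing_eq_zero ?_ ?_
      · intro h; have := hB _ h; dsimp only at this; omega
      · intro h; have := hB _ h; dsimp only at this; omega
    rw [h2, add_zero, show B - ((n : ℤ) + 1) + 1 = B - n by ring, ih] at h1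
    push_cast
    exact h1.symm

/-- The closed star-cluster of the right exit of a finite cluster contains its left exit. -/
theorem Separates.mem_of_exits (h : Separates ω C K) (hB : BoundedBy B C) {k m : ℤ}
    (hr : Reach C (k, 0) (m, 0)) (hk : ∀ j, k < j → ((j, 0) : Site) ∉ C) (hkK : (k + 1, 0) ∈ K)
    (hm : ∀ j, j < m → ((j, 0) : Site) ∉ C) : ((m - 1, 0) : Site) ∈ K := by
  have hkC := hr.left_mem
  have hmC := hr.right_mem
  have hkB := hB _ hkC
  have hmB := hB _ hmC
  dsimp only at hkB hmB
  have hright : ∀ j, k < j → crossings C K B j 0 = crossings C K B (k + 1) 0 := by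
    intro j hj
    have hj' : k + 1 ≤ j := hj
    clear hj
    induction j, hj' using Int.leInduction with
    | base => rfl
    | succ j hj ih =>
      rw [crossings_succ hB, ih, crossing_eq_zero, add_zero]
      · exact fun h => absurd h (hk _ (by omega))
      · exact fun h => absurd h (hk _ (by omega))
  have h1 : crossings C K B (k + 1) 0 = 0 := by
    rw [← hright B (by omega)]
    have := h.crossings_far hB B.toNat
    rwa [Int.toNat_of_nonneg (by omega), sub_self] at this
  have h2 : crossing C K (k, 0) (k + 1, 0) = 1 := if_pos (Or.inl ⟨hkC, hkK⟩)
  have h3 : crossings C K B (m - 1) 0 = 0 := Finset.sum_eq_zero fun i hi => by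
    rw [Finset.mem_Ico] at hi
    exact crossing_eq_zero (fun h => absurd h (hm _ (by omega))) (fun h => absurd h (hm _ (by omega)))
  have h4 := crossings_succ (K := K) hB (m - 1) 0
  have h5 := crossings_succ (K := K) hB k 0
  have h6 := h.crossings_of_reach hB hr
  dsimp only at h6
  rw [sub_add_cancel, h3, zero_add] at h4
  rw [h1, h2, h6, h4] at h5
  by_contra hcon
  rw [crossing_eq_zero (fun h => absurd h (hm _ (by omega))) (fun _ => hcon)] at h5
  exact absurd h5 (by decide)

end Contour

section

/-- Sequences of `n + 1` sites started at `v`, with steps of sup-norm at most one. -/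
noncomputable def starLists : ℕ → Site → Finset (List Site)
  | 0, v => {[v]}
  | n + 1, v => (nbr 1 v).biUnion fun w => (starLists n w).image (v :: ·)

theorem card_starLists (n : ℕ) (v : Site) : (starLists n v).card ≤ 9 ^ n := by
  induction n generalizing v with
  | zero => simp [starLists]
  | succ n ih =>
    calc (starLists (n + 1) v).card ≤ ∑ w ∈ nbr 1 v, ((starLists n w).image (v :: ·)).card :=
          Finset.card_biUnion_le
      _ ≤ ∑ w ∈ nbr 1 v, 9 ^ n := Finset.sum_le_sum fun w _ => Finset.card_image_le.trans (ih w)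
      _ = 9 ^ (n + 1) := by rw [Finset.sum_const, card_nbr, smul_eq_mul]; ring

theorem length_of_mem_starLists {n : ℕ} {v : Site} {l : List Site} (h : l ∈ starLists n v) :
    l.length = n + 1 := by
  induction n generalizing v l with
  | zero => simp_all [starLists]
  | succ n ih =>
    simp only [starLists, Finset.mem_biUnion, Finset.mem_image] at h
    obtain ⟨w, _, l', hl', rfl⟩ := h
    simp [ih hl']

/-- Star-adjacency among closed sites. -/
def closedStarGraph (ω : Config) : SimpleGraph Site where
  Adj a b := adjStar a b ∧ a ∉ ω ∧ b ∉ ω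
  symm := ⟨fun a b h => ⟨⟨h.1.1.symm, by rw [abs_sub_comm b.1, abs_sub_comm b.2]; exact h.1.2⟩, h.2.2, h.2.1⟩⟩
  loopless := ⟨fun a h => h.1.1 rfl⟩

variable {ω : Config}

theorem adjStar.mem_nbr {a b : Site} (h : adjStar a b) : b ∈ nbr 1 a := by
  have h1 := (le_max_left _ _).trans h.2.le
  have h2 := (le_max_right _ _).trans h.2.le
  rw [abs_le] at h1 h2
  rw [PercEnh.mem_nbr]
  push_cast
  omega

theorem sub_le_length {a b : Site} (p : (closedStarGraph ω).Walk a b) : a.1 - b.1 ≤ p.length := by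
  induction p with
  | nil => simp
  | cons h p ih =>
    have := h.1.mem_nbr
    rw [mem_nbr] at this
    rw [SimpleGraph.Walk.length_cons]
    push_cast at *
    omega

theorem exists_starList {a b : Site} (p : (closedStarGraph ω).Walk a b) {n : ℕ} (hn : n ≤ p.length) :
    ∃ l ∈ starLists n a, l.Sublist p.support := by
  induction p generalizing n with
  | nil =>
    obtain rfl : n = 0 := by simpa using hn
    exact ⟨_, by simp [starLists], List.Sublist.refl _⟩
  | @cons u v w h p ih =>
    cases n with
    | zero => exact ⟨[u], by simp [starLists], by simp⟩
    | succ n =>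
      obtain ⟨l, hl, hs⟩ := ih (by simpa using hn)
      refine ⟨u :: l, ?_, by simpa using hs⟩
      simp only [starLists, Finset.mem_biUnion, Finset.mem_image]
      exact ⟨v, h.1.mem_nbr, l, hl, rfl⟩

theorem closed_of_mem_support {a b : Site} (p : (closedStarGraph ω).Walk a b) (ha : a ∉ ω) :
    ∀ z ∈ p.support, z ∉ ω := by
  induction p with
  | nil => simpa using ha
  | cons h p ih =>
    intro z hz
    rw [SimpleGraph.Walk.support_cons, List.mem_cons] at hz
    rcases hz with rfl | hz
    · exact ha
    · exact ih h.2.2 z hz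

/-- A finite cluster of the origin is blocked by a closed star-path. -/
theorem exists_blocking (h0 : (0 : Site) ∈ ω) (hfin : ¬ InInfiniteCluster adjZ2 ω 0) :
    ∃ n : ℕ, ∃ l ∈ starLists n ((n + 1 : ℤ), 0), l.Nodup ∧ ∀ z ∈ l, z ∉ ω := by
  classical
  set C : Config := {y | Reach ω 0 y} with hC
  have hCfin : C.Finite := by
    by_contra hinf
    refine hfin ?_
    simp only [InInfiniteCluster, connectedIn_iff]
    exact hinf
  obtain ⟨B, hB⟩ := exists_nbr_superset C hCfin
  have hB' : BoundedBy (B + 1) C := by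
    intro a ha
    have := hB ha
    rw [Finset.mem_coe, mem_nbr] at this
    simp only [Prod.fst_zero, Prod.snd_zero] at this
    omega
  have h0C : ((0 : ℤ), (0 : ℤ)) ∈ C := Reach.refl h0
  obtain ⟨k, hk, hkmax⟩ := Int.exists_greatest_of_bdd (P := fun j => ((j, 0) : Site) ∈ C)
    ⟨B + 1, fun z hz => (hB' _ hz).2.1.le⟩ ⟨0, h0C⟩
  obtain ⟨m, hm, hmmin⟩ := Int.exists_least_of_bdd (P := fun j => ((j, 0) : Site) ∈ C)
    ⟨-(B + 1), fun z hz => (hB' _ hz).1.le⟩ ⟨0, h0C⟩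
  have hk0 := hkmax 0 h0C
  have hm0 := hmmin 0 h0C
  have hbd : ∀ a ∈ C, ∀ b, adjZ2 a b → b ∉ C → b ∉ ω := fun a ha b hab hb hbω =>
    hb (Reach.tail ha hab hbω)
  have hk1 : ((k + 1, 0) : Site) ∉ C := fun h => by
    have := hkmax _ h; omega
  have hk2 : ((k + 1, 0) : Site) ∉ ω := hbd _ hk _ (by simp [adjZ2]) hk1
  set K : Config := {a | a ∉ ω ∧ (closedStarGraph ω).Reachable (k + 1, 0) a} with hK
  have hsep : Separates ω C K := by
    refine ⟨fun a ha => Reach.right_mem ha, hbd, fun a ha => ha.1, fun a ha b hb hab => ⟨hb, ?_⟩⟩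
    exact ha.2.trans (SimpleGraph.Adj.reachable ⟨hab, ha.1, hb⟩)
  have hCC : ∀ a ∈ C, Reach C 0 a := fun a ha =>
    Reach.mem_of_closed (T := {p | Reach C 0 p}) (fun p hp q hq hpq =>
      Reach.tail hp hpq (Reach.tail hp.right_mem hpq hq)) ha (Reach.refl (Reach.refl h0))
  have hmem := hsep.mem_of_exits hB' ((hCC _ hk).symm.trans (hCC _ hm))
    (fun j hj h => by have := hkmax _ h; omega) ⟨hk2, SimpleGraph.Reachable.refl _⟩
    (fun j hj h => by have := hmmin _ h; omega)
  obtain ⟨p, hp⟩ := hmem.2.exists_isPath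
  have hlen := sub_le_length p
  dsimp only at hlen
  obtain ⟨l, hl, hs⟩ := exists_starList p (n := k.toNat) (by omega)
  refine ⟨k.toNat, l, ?_, hp.support_nodup.sublist hs, fun z hz =>
    closed_of_mem_support p hk2 z (hs.subset hz)⟩
  rwa [Int.toNat_of_nonneg hk0]

theorem theta_pos {p : ℝ} {μ : Measure (Site → Bool)} (hμ : IsBernoulli p μ) (h0 : 19 / 20 < p) (h1 : p ≤ 1) :
    0 < theta adjZ2 μ := by
  have := hμ.1
  by_contra hcon
  have hz : μ {η | InInfiniteCluster adjZ2 (toConfig η) 0} = 0 :=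
    (measureReal_eq_zero_iff (measure_ne_top μ _)).1 (le_antisymm (not_lt.1 hcon) measureReal_nonneg)
  set q := 1 - p with hq
  have hq0 : 0 ≤ q := by linarith
  have hcyl : ∀ l : List Site, l.Nodup → μ (cylinder l.toFinset fun _ => false) = ENNReal.ofReal (q ^ l.length) := by
    intro l hl
    rw [hμ.2, ENNReal.ofReal_pow hq0]
    simp [List.toFinset_card_of_nodup hl, hq]
  set E : ℕ → Set (Site → Bool) := fun n =>
    ⋃ l ∈ (starLists n ((n + 1 : ℤ), 0)).filter (·.Nodup), cylinder l.toFinset fun _ => false with hE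
  have hEn : ∀ n, μ (E n) ≤ ENNReal.ofReal (q * (9 * q) ^ n) := by
    intro n
    calc μ (E n) ≤ ∑ l ∈ (starLists n ((n + 1 : ℤ), 0)).filter (·.Nodup),
          μ (cylinder l.toFinset fun _ => false) := measure_biUnion_finset_le _ _
      _ ≤ ∑ l ∈ (starLists n ((n + 1 : ℤ), 0)).filter (·.Nodup), ENNReal.ofReal (q ^ (n + 1)) := by
          refine Finset.sum_le_sum fun l hl => ?_
          rw [Finset.mem_filter] at hl
          rw [hcyl l hl.2, length_of_mem_starLists hl.1]
      _ ≤ (9 ^ n : ℕ) * ENNReal.ofReal (q ^ (n + 1)) := by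
          rw [Finset.sum_const, nsmul_eq_mul]
          gcongr
          exact (Finset.card_filter_le _ _).trans (card_starLists _ _)
      _ = ENNReal.ofReal (q * (9 * q) ^ n) := by
          rw [← ENNReal.ofReal_natCast, ← ENNReal.ofReal_mul (by positivity)]
          congr 1
          push_cast
          ring_nf
  have hcover : (univ : Set (Site → Bool)) ⊆ ({η | InInfiniteCluster adjZ2 (toConfig η) 0} ∪
      cylinder [(0 : Site)].toFinset fun _ => false) ∪ ⋃ n, E n := by
    intro η _
    by_cases hη : InInfiniteCluster adjZ2 (toConfig η) 0
    · exact Or.inl (Or.inl hη)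
    by_cases h0 : (0 : Site) ∈ toConfig η
    · obtain ⟨n, l, hl, hd, hc⟩ := exists_blocking h0 hη
      refine Or.inr (mem_iUnion.2 ⟨n, mem_iUnion₂.2 ⟨l, Finset.mem_filter.2 ⟨hl, hd⟩, fun z hz => ?_⟩⟩)
      simpa [toConfig] using hc z (by simpa using hz)
    · refine Or.inl (Or.inr fun z hz => ?_)
      obtain rfl : z = 0 := by simpa using hz
      simpa [toConfig] using h0
  have h9 : 9 * q < 1 := by linarith
  have hsum : ∑' n, ENNReal.ofReal (q * (9 * q) ^ n) = ENNReal.ofReal (q * (1 - 9 * q)⁻¹) := by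
    rw [← ENNReal.ofReal_tsum_of_nonneg (fun n => by positivity)
      ((summable_geometric_of_lt_one (by positivity) h9).mul_left q), tsum_mul_left,
      tsum_geometric_of_lt_one (by positivity) h9]
  have hle : (1 : ℝ≥0∞) ≤ ENNReal.ofReal (q + q * (1 - 9 * q)⁻¹) := by
    calc (1 : ℝ≥0∞) = μ univ := measure_univ.symm
      _ ≤ _ := (measure_mono hcover).trans ((measure_union_le _ _).trans
          (add_le_add (measure_union_le _ _) (measure_iUnion_le _)))
      _ ≤ ENNReal.ofReal q + ENNReal.ofReal (q * (1 - 9 * q)⁻¹) := by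
          rw [hz, zero_add, hcyl _ (List.nodup_singleton _), ← hsum]
          gcongr with n
          · simp
          · exact hEn n
      _ = _ := (ENNReal.ofReal_add hq0 (mul_nonneg hq0 (inv_nonneg.2 (by linarith)))).symm
  rw [ENNReal.one_le_ofReal] at hle
  have : (1 - 9 * q)⁻¹ ≤ 2 := by
    rw [inv_le_comm₀ (by linarith) (by norm_num)]
    linarith
  nlinarith

theorem pcOf_lt_one {P : ℝ → Measure (Site → Bool)} (hP : ∀ p ∈ Icc (0 : ℝ) 1, IsBernoulli p (P p)) :
    pcOf adjZ2 P < 1 := by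
  have : pcOf adjZ2 P ≤ 19 / 20 := by
    refine Real.sSup_le (fun p hp => ?_) (by norm_num)
    by_contra! h
    exact (theta_pos (hP p hp.1) h hp.1.2).ne' hp.2
  linarith

end

/-- Aizenman–Grimmett: suppose `p_c > 0` and let `s > 0`. For any
essential enhancement (of some finite range `R₀`) of site percolation on `ℤ²`, there
exists `π(s) < p_c` such that `θ(p,s) > 0` for all `p` with `π(s) < p < p_c`. -/
theorem essential_enhancement_shifts_pc
    (P : ℝ → Measure (Site → Bool))
    (hP : ∀ p ∈ Icc (0:ℝ) 1, IsBernoulli p (P p))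
    (R₀ : ℝ) (φ : Config → Config) (hφ : IsEnhancement R₀ φ)
    (hess : Essential adjZ2 φ)
    (hpc : 0 < pcOf adjZ2 P)
    (s : ℝ) (hs : 0 < s) (hs1 : s ≤ 1) :
    ∃ π : ℝ, π < pcOf adjZ2 P ∧
      ∀ p : ℝ, π < p → p < pcOf adjZ2 P → 0 < thetaEnh adjZ2 φ (P p) (P s) := by
  exact exists_shift hφ hess hP hpc (pcOf_lt_one hP) hs hs1

end PercEnh
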